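/- arXiv:1702.00156 — 3 statements merged into one kernel-verified Lean document; each statement's English description precedes it below -/
import Mathlib

section
/- The number of isomorphism classes of finite connected simple graphs with no isolated vertices having exactly 9 edges is 710. -/
/-- A graphlet with `k` edges: a finite connected simple graph with no isolated
vertices whose edge set has cardinality `k` (vertex set taken as `Fin n` for some `n`). -/
def Graphlet (k : ℕ) :=
  { G : Σ n : ℕ, SimpleGraph (Fin n) //
      G.2.Connected ∧ (∀ v, ∃ w, G.2.Adj v w) ∧ G.2.edgeSet.ncard = k }

/-- Two graphlets are related iff they are isomorphic as simple graphs. -/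
def graphletIso {k : ℕ} (G H : Graphlet k) : Prop :=
  Nonempty (G.1.2 ≃g H.1.2)

namespace GraphletCount

/-! ### Graphs encoded by natural numbers -/

/-- The value `k x`, arranged so that the kernel evaluates `x` before substituting it. -/
def force {α : Type} (x : ℕ) (k : ℕ → α) : α :=
  Nat.rec (k 0) (fun n _ => k n.succ) x

/-- The value `k l`, arranged so that the kernel evaluates the entries of `l` first. -/
def forceList {α : Type} (l : List ℕ) : (List ℕ → α) → α :=
  List.rec (fun k => k []) (fun x _ ih k => force x fun y => ih fun ys => k (y :: ys)) l

/-- The value `k M`, arranged so that the kernel evaluates the entries of `M` first. -/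
def forceMatrix {α : Type} (M : List (List ℕ)) : (List (List ℕ) → α) → α :=
  List.rec (fun k => k []) (fun r _ ih k => forceList r fun s => ih fun N => k (s :: N)) M

@[simp] lemma force_eq {α : Type} (x : ℕ) (k : ℕ → α) : force x k = k x := by
  cases x <;> rfl

@[simp] lemma forceList_eq {α : Type} (l : List ℕ) (k : List ℕ → α) : forceList l k = k l := by
  induction l generalizing k with
  | nil => rfl
  | cons x l ih =>
    change force x (fun y => forceList l fun ys => k (y :: ys)) = _
    rw [force_eq, ih]

@[simp] lemma forceMatrix_eq {α : Type} (M : List (List ℕ)) (k : List (List ℕ) → α) :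
    forceMatrix M k = k M := by
  induction M generalizing k with
  | nil => rfl
  | cons r M ih =>
    change forceList r (fun s => forceMatrix M fun N => k (s :: N)) = _
    rw [forceList_eq, ih]

/-- Whether `f` holds at all natural numbers below `n`. -/
def allBelow (n : ℕ) (f : ℕ → Bool) : Bool :=
  Nat.rec true (fun i b => f i && b) n

lemma allBelow_iff {n : ℕ} {f : ℕ → Bool} : allBelow n f = true ↔ ∀ i < n, f i = true := by
  induction n with
  | zero => simp [allBelow]
  | succ n ih =>
    change (f n && allBelow n f) = true ↔ _
    rw [Bool.and_eq_true, ih]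
    exact ⟨fun h i hi => (Nat.lt_succ_iff_lt_or_eq.mp hi).elim (h.2 i) fun e => e ▸ h.1,
      fun h => ⟨h n (by omega), fun i hi => h i (by omega)⟩⟩

/-- The position of the pair `u < v` in the colexicographic order of pairs. -/
def index (u v : ℕ) : ℕ := ((v.mul (v.sub 1)).div 2).add u

lemma index_eq (u v : ℕ) : index u v = v.choose 2 + u := by
  rw [Nat.choose_two_right]; rfl

lemma index_lt_choose {u v n : ℕ} (huv : u < v) (hv : v < n) : index u v < n.choose 2 := by
  have h : (v + 1).choose 2 ≤ n.choose 2 := Nat.choose_le_choose 2 hv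
  have h' : (v + 1).choose 2 = v + v.choose 2 := by simp [Nat.choose_succ_succ' v 1]
  rw [index_eq]
  omega

lemma index_inj {u v x y : ℕ} (huv : u < v) (hxy : x < y) (h : index u v = index x y) :
    u = x ∧ v = y := by
  have key : ∀ {a b c d : ℕ}, a < b → index a b = index c d → ¬ b < d := fun hab e hbd => by
    have := index_lt_choose hab hbd
    rw [e, index_eq] at this
    omega
  obtain rfl : v = y := le_antisymm (not_lt.mp (key hxy h.symm)) (not_lt.mp (key huv h))
  simp only [index_eq] at h
  omega

/-- The binary digit of `m` at position `k`. -/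
def bit (m k : ℕ) : Bool := ((m.shiftRight k).land 1).beq 1

lemma bit_eq (m k : ℕ) : bit m k = m.testBit k := by
  rw [Bool.eq_iff_iff, Nat.testBit_eq_decide_div_mod_eq, decide_eq_true_eq, bit, Nat.beq_eq]
  change (m >>> k) &&& 1 = 1 ↔ _
  rw [Nat.and_one_is_mod, Nat.shiftRight_eq_div_pow]

/-- Adjacency in the graph whose edges are the pairs indexed by the binary digits of `m`. -/
def adj (m u v : ℕ) : Bool :=
  bif u.blt v then bit m (index u v) else bif v.blt u then bit m (index v u) else false

lemma adj_of_lt {m u v : ℕ} (h : u < v) : adj m u v = m.testBit (index u v) := by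
  have : u.blt v = true := by simpa [Nat.blt_eq] using h
  simp [adj, this, bit_eq]

lemma adj_comm (m u v : ℕ) : adj m u v = adj m v u := by
  unfold adj
  rcases lt_trichotomy u v with h | rfl | h
  · have h₁ : u.blt v = true := Nat.blt_eq.mpr h
    have h₂ : v.blt u = false := by rw [← Bool.not_eq_true, Nat.blt_eq]; omega
    simp [h₁, h₂]
  · rfl
  · have h₁ : v.blt u = true := Nat.blt_eq.mpr h
    have h₂ : u.blt v = false := by rw [← Bool.not_eq_true, Nat.blt_eq]; omega
    simp [h₁, h₂]

@[simp] lemma adj_self (m u : ℕ) : adj m u u = false := by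
  have : u.blt u = false := by rw [← Bool.not_eq_true, Nat.blt_eq]; omega
  simp [adj, this]

/-- The graph on `n` vertices with code `m`, for `g = (n, m)`. -/
def graph (g : ℕ × ℕ) : SimpleGraph (Fin g.1) where
  Adj u v := adj g.2 u v = true
  symm := ⟨fun u v h => by rwa [adj_comm]⟩
  loopless := ⟨fun u h => by simp at h⟩

lemma graph_adj {g : ℕ × ℕ} {u v : Fin g.1} : (graph g).Adj u v ↔ adj g.2 u v = true := Iff.rfl

/-- The code `m` with the edge between `u < v` added. -/
def addEdge (m u v : ℕ) : ℕ := m.lor (Nat.shiftLeft 1 (index u v))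

lemma adj_addEdge_of_lt {m u v x y : ℕ} (huv : u < v) (hxy : x < y) :
    adj (addEdge m u v) x y = true ↔ adj m x y = true ∨ (x = u ∧ y = v) := by
  rw [adj_of_lt hxy, adj_of_lt hxy]
  change (m ||| 1 <<< index u v).testBit _ = true ↔ _
  rw [Nat.testBit_or, Nat.one_shiftLeft, Nat.testBit_two_pow, Bool.or_eq_true, decide_eq_true_eq]
  refine or_congr Iff.rfl ⟨fun h => ?_, fun h => by rw [h.1, h.2]⟩
  exact (index_inj huv hxy h).imp Eq.symm Eq.symm

lemma adj_addEdge {m u v : ℕ} (huv : u < v) (x y : ℕ) :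
    adj (addEdge m u v) x y = true ↔
      adj m x y = true ∨ (x = u ∧ y = v) ∨ (x = v ∧ y = u) := by
  rcases lt_trichotomy x y with h | rfl | h
  · rw [adj_addEdge_of_lt huv h]
    exact or_congr Iff.rfl ⟨Or.inl, fun h' => h'.resolve_right (by omega)⟩
  · simp only [adj_self, Bool.false_eq_true, false_or, false_iff]
    omega
  · rw [adj_comm, adj_addEdge_of_lt huv h, adj_comm m]
    exact or_congr Iff.rfl ⟨fun h' => .inr h'.symm, fun h' => (h'.resolve_left (by omega)).symm⟩

/-- The decimal digit of `p` at position `u`; thus `p` encodes a map between indices below ten. -/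
def digit (p u : ℕ) : ℕ := (p.div (Nat.pow 10 u)).mod 10

/-- Whether the map encoded by `p` is an isomorphism between the graphs on `n` vertices with codes
`m` and `m'`. -/
def relabels (p n m m' : ℕ) : Bool :=
  allBelow n fun v => force (digit p v) fun y => y.blt n && allBelow v fun u =>
    force (digit p u) fun x => !x.beq y &&
      bif bit m (index u v) then adj m' x y else !adj m' x y

lemma nonempty_iso_of_relabels {p n m m' : ℕ} (h : relabels p n m m' = true) :
    Nonempty (graph (n, m) ≃g graph (n, m')) := by
  simp only [relabels, allBelow_iff, force_eq, Bool.and_eq_true, Nat.blt_eq] at h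
  have hne : ∀ v < n, ∀ u < v, digit p u ≠ digit p v := fun v hv u hu => by
    simpa [← Nat.beq_eq] using ((h v hv).2 u hu).1
  have hadj : ∀ v < n, ∀ u < v, adj m' (digit p u) (digit p v) = adj m u v := fun v hv u hu => by
    have := ((h v hv).2 u hu).2
    rw [bit_eq, ← adj_of_lt hu] at this
    cases hm : adj m u v <;> simpa [hm] using this
  let f : Fin n → Fin n := fun u => ⟨digit p u, (h u u.2).1⟩
  have hf : Function.Injective f := fun u v e => by
    have e' : digit p u = digit p v := congrArg Fin.val e
    by_contra huv
    rcases lt_or_gt_of_ne huv with hlt | hlt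
    · exact hne v v.2 u hlt e'
    · exact hne u u.2 v hlt e'.symm
  refine ⟨⟨Equiv.ofBijective f (Finite.injective_iff_bijective.mp hf), fun {u v} => ?_⟩⟩
  change adj m' (digit p u) (digit p v) = true ↔ adj m u v = true
  rcases lt_trichotomy u v with hlt | rfl | hlt
  · rw [hadj v v.2 u hlt]
  · simp
  · rw [adj_comm m', adj_comm m, hadj u u.2 v hlt]

/-! ### Extending graphs by one edge -/

/-- Whether `u` has exactly one neighbour in the graph on `n` vertices with code `m`. -/
def isLeaf (n m u : ℕ) : Bool :=
  (List.range n).any fun v => adj m u v && allBelow n fun w => !adj m u w || w.beq v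

lemma isLeaf_iff {n m u : ℕ} :
    isLeaf n m u = true ↔ ∃ v < n, adj m u v = true ∧ ∀ w < n, adj m u w = true → w = v := by
  simp only [isLeaf, List.any_eq_true, List.mem_range, Bool.and_eq_true, allBelow_iff,
    Bool.or_eq_true, Bool.not_eq_true', Nat.beq_eq, ← Bool.not_eq_true, imp_iff_not_or]

/-- Edges that may be added to the graph on `n` vertices with code `m`: edges to a new vertex `n`,
and edges between non-adjacent vertices that include all leaves. -/
def newEdges (n m : ℕ) : List (ℕ × ℕ) :=
  (List.range n).map (fun u => (u, n)) ++
    forceList ((List.range n).filter (isLeaf n m)) fun l =>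
      (List.range n).flatMap fun v => ((List.range v).filter fun u =>
        !bit m (index u v) && l.all fun w => w.beq u || w.beq v).map fun u => (u, v)

lemma mem_newEdges_pendant {n m u : ℕ} (hu : u < n) : (u, n) ∈ newEdges n m := by
  simp [newEdges, hu]

lemma mem_newEdges {n m u v : ℕ} (huv : u < v) (hv : v < n) (hadj : adj m u v = false)
    (hleaf : ∀ w < n, isLeaf n m w = true → w = u ∨ w = v) : (u, v) ∈ newEdges n m := by
  rw [adj_of_lt huv] at hadj
  simp only [newEdges, forceList_eq, List.mem_append, List.mem_flatMap, List.mem_map,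
    List.mem_filter, List.mem_range]
  refine .inr ⟨v, hv, u, ⟨huv, ?_⟩, rfl⟩
  simpa [bit_eq, hadj, ← Bool.not_eq_true, imp_iff_not_or] using hleaf

/-- Whether `c`, read as a position in `L` followed by the ten digits of a map, shows the graph on
`n` vertices with code `m` to be isomorphic to a member of `L`. -/
def certifies (L : List (ℕ × ℕ)) (c n m : ℕ) : Bool :=
  match L[c.div 10000000000]? with
  | none => false
  | some h => n.beq h.1 && force h.2 (relabels c n m)

lemma exists_iso_of_certifies {L : List (ℕ × ℕ)} {c n m : ℕ} (h : certifies L c n m = true) :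
    ∃ g ∈ L, Nonempty (graph (n, m) ≃g graph g) := by
  unfold certifies at h
  split at h
  · cases h
  · next g hg =>
    simp only [Bool.and_eq_true, Nat.beq_eq, force_eq] at h
    obtain ⟨rfl, h⟩ := h
    exact ⟨g, List.mem_of_getElem? hg, nonempty_iso_of_relabels h⟩

/-- Whether `f` relates each member of `l` to the member of a second list at the same position. -/
def allMatched {α β : Type} (f : α → β → Bool) (l : List α) : List β → Bool :=
  List.rec (fun _ => true)
    (fun x _ ih s => List.rec false (fun y ys _ => f x y && ih ys) s) l

lemma exists_of_allMatched {α β : Type} {f : α → β → Bool} {l : List α} {s : List β}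
    (h : allMatched f l s = true) {x : α} (hx : x ∈ l) : ∃ y, f x y = true := by
  induction l generalizing s with
  | nil => cases hx
  | cons a l ih =>
    cases s with
    | nil => cases h
    | cons y s =>
      have h' : (f a y && allMatched f l s) = true := h
      rw [Bool.and_eq_true] at h'
      rcases List.mem_cons.mp hx with rfl | hx
      · exact ⟨y, h'.1⟩
      · exact ih h'.2 hx

/-- Whether the certificates `C` show that adding new edges to the graphs in `L` leads, up to
isomorphism, to graphs in `L'`. -/
def extendsTo (L : List (ℕ × ℕ)) (C : List (List ℕ)) (L' : List (ℕ × ℕ)) : Bool :=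
  allMatched (fun g cs => force g.1 fun n => force g.2 fun m =>
    m.blt (Nat.pow 2 (index 0 n)) && allMatched (fun e c => force c fun c =>
      force (addEdge m e.1 e.2) fun m' => force (n.max e.2.succ) fun k =>
        certifies L' c k m') (newEdges n m) cs) L C

lemma exists_iso_of_extendsTo {L L' : List (ℕ × ℕ)} {C : List (List ℕ)}
    (h : extendsTo L C L' = true) {n m : ℕ} (hg : (n, m) ∈ L) {u v : ℕ}
    (he : (u, v) ∈ newEdges n m) :
    m < 2 ^ n.choose 2 ∧
      ∃ g ∈ L', Nonempty (graph (max n (v + 1), addEdge m u v) ≃g graph g) := by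
  obtain ⟨cs, hcs⟩ := exists_of_allMatched h hg
  simp only [force_eq, Bool.and_eq_true, Nat.blt_eq, index_eq, Nat.add_zero] at hcs
  obtain ⟨c, hc⟩ := exists_of_allMatched hcs.2 he
  exact ⟨hcs.1, exists_iso_of_certifies hc⟩

/-- Every connected graph with `k` edges is isomorphic to one of the graphs in `L`. -/
def Exhausts (L : List (ℕ × ℕ)) (k : ℕ) : Prop :=
  ∀ (V : Type) [Finite V] (G : SimpleGraph V), G.Connected → G.edgeSet.ncard = k →
    ∃ g ∈ L, Nonempty (G ≃g graph g)

lemma exhausts_zero : Exhausts [(1, 0)] 0 := by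
  intro V _ G hG hk
  have hG' : G = ⊥ := by
    rwa [Set.ncard_eq_zero (Set.toFinite _), SimpleGraph.edgeSet_eq_empty] at hk
  have : Nonempty V := hG.nonempty
  have : Subsingleton V := by
    subst hG'
    refine ⟨fun u v => ?_⟩
    simpa using hG.preconnected u v
  obtain ⟨_⟩ := nonempty_unique V
  have e : V ≃ Fin 1 := Equiv.ofUnique V (Fin 1)
  refine ⟨(1, 0), by simp, ⟨⟨e, fun {u v} => ?_⟩⟩⟩
  rw [Subsingleton.elim u v]
  simp

section Extension

variable {V : Type} {G : SimpleGraph V} {n m : ℕ}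

/-- If removing a vertex of degree one from `G` leaves an encoded graph, then `G` is isomorphic to
that graph with a pendant edge added. -/
lemma nonempty_iso_addEdge_of_pendant {v w : V} (hvw : G.Adj v w) (hw : ∀ x, G.Adj v x → x = w)
    (hm : m < 2 ^ n.choose 2) (φ : G.induce {v}ᶜ ≃g graph (n, m)) :
    Nonempty (G ≃g graph (n + 1, addEdge m (φ ⟨w, hvw.ne'⟩) n)) := by
  have hnew : ∀ x < n, adj m x n = false := fun x hx => by
    rw [adj_of_lt hx, index_eq]
    exact Nat.testBit_lt_two_pow
      (hm.trans_le (Nat.pow_le_pow_right (by norm_num) (Nat.le_add_right _ _)))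
  have hwn : (φ ⟨w, hvw.ne'⟩ : ℕ) < n := (φ ⟨w, hvw.ne'⟩).2
  let f : Fin (n + 1) → V := Fin.lastCases v fun i => φ.symm i
  have hlast : f (Fin.last n) = v := by simp [f]
  have hcast : ∀ i, f (Fin.castSucc i) = φ.symm i := fun i => by simp [f]
  have hne : ∀ i : Fin n, (φ.symm i : V) ≠ v := fun i => (φ.symm i).2
  have hf : Function.Bijective f := by
    constructor
    · intro x y
      induction x using Fin.lastCases <;> induction y using Fin.lastCases <;>
        simp [hlast, hcast, hne, (hne _).symm, ← Subtype.ext_iff]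
    · intro x
      by_cases hx : x = v
      · exact ⟨Fin.last n, hx ▸ hlast⟩
      · exact ⟨Fin.castSucc (φ ⟨x, hx⟩), by simp [hcast]⟩
  have hvf : ∀ i : Fin n, G.Adj v (φ.symm i) ↔ (i : ℕ) = φ ⟨w, hvw.ne'⟩ := fun i => by
    rw [← Fin.ext_iff, ← φ.symm_apply_eq, Subtype.ext_iff]
    exact ⟨fun h => hw _ h, fun h => h ▸ hvw⟩
  refine ⟨SimpleGraph.Iso.symm ⟨Equiv.ofBijective f hf, fun {x y} => ?_⟩⟩
  change G.Adj (f x) (f y) ↔ adj (addEdge m _ n) x y = true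
  rw [adj_addEdge hwn]
  induction x using Fin.lastCases with
  | last =>
    induction y using Fin.lastCases with
    | last => simp [hlast]; omega
    | cast j =>
      rw [hlast, hcast, hvf, adj_comm]
      have := j.2
      simp [hnew j j.2]; omega
  | cast i =>
    have := i.2
    induction y using Fin.lastCases with
    | last =>
      rw [hlast, hcast, G.adj_comm, hvf]
      simp [hnew i i.2]; omega
    | cast j =>
      have := j.2
      have hij : G.Adj (φ.symm i) (φ.symm j) ↔ adj m i j = true := φ.symm.map_adj_iff
      simp [hcast, hij]; omega

lemma nonempty_iso_addEdge_of_deleteEdges {x y : V} (hxy : G.Adj x y)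
    (φ : G.deleteEdges {s(x, y)} ≃g graph (n, m)) (hlt : φ x < φ y) :
    Nonempty (G ≃g graph (n, addEdge m (φ x) (φ y))) := by
  refine ⟨⟨φ.toEquiv, fun {u v} => ?_⟩⟩
  change adj (addEdge m _ _) (φ u) (φ v) = true ↔ _
  have huv : adj m (φ u) (φ v) = true ↔ (G.deleteEdges {s(x, y)}).Adj u v := φ.map_adj_iff
  rw [adj_addEdge hlt, huv]
  simp only [SimpleGraph.deleteEdges_adj, Set.mem_singleton_iff, Sym2.eq_iff, ← Fin.ext_iff,
    φ.injective.eq_iff]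
  constructor
  · rintro (h | ⟨rfl, rfl⟩ | ⟨rfl, rfl⟩)
    exacts [h.1, hxy, hxy.symm]
  · tauto

lemma existsUnique_adj_of_isLeaf {x y : V} (φ : G.deleteEdges {s(x, y)} ≃g graph (n, m))
    {z : V} (hz : isLeaf n m (φ z) = true) (hx : z ≠ x) (hy : z ≠ y) : ∃! w, G.Adj z w := by
  obtain ⟨i, hi, hadj, huniq⟩ := isLeaf_iff.mp hz
  have hG : ∀ w, G.Adj z w ↔ adj m (φ z) (φ w) = true := fun w => by
    change _ ↔ (graph (n, m)).Adj (φ z) (φ w)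
    rw [φ.map_adj_iff, SimpleGraph.deleteEdges_adj]
    simp [hx, hy]
  refine ⟨φ.symm ⟨i, hi⟩, by simpa [hG] using hadj, fun w hw => ?_⟩
  rw [φ.eq_symm_apply]
  exact Fin.ext (huniq _ (φ w).2 ((hG w).mp hw))

end Extension

lemma exists_existsUnique_adj_or_exists_connected_deleteEdges {V : Type} [Finite V]
    {G : SimpleGraph V} (hG : G.Connected) (hE : G.edgeSet.Nonempty) :
    (∃ v, ∃! w, G.Adj v w) ∨ ∃ x y, G.Adj x y ∧ (G.deleteEdges {s(x, y)}).Connected := by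
  classical
  have := Fintype.ofFinite V
  by_cases hac : G.IsAcyclic
  · obtain ⟨⟨x, y⟩, hxy⟩ := hE
    have : Nontrivial V := ⟨x, y, G.ne_of_adj hxy⟩
    obtain ⟨v, hv⟩ := (SimpleGraph.IsTree.mk hG hac).exists_vert_degree_one_of_nontrivial
    exact .inl ⟨v, SimpleGraph.degree_eq_one_iff_existsUnique_adj.mp hv⟩
  · rw [SimpleGraph.isAcyclic_iff_forall_adj_isBridge] at hac
    push Not at hac
    obtain ⟨x, y, hxy, hb⟩ := hac
    exact .inr ⟨x, y, hxy, hG.connected_delete_edge_of_not_isBridge hb⟩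

lemma Exhausts.succ {L L' : List (ℕ × ℕ)} {C : List (List ℕ)} {k : ℕ} (hL : Exhausts L k)
    (h : extendsTo L C L' = true) : Exhausts L' (k + 1) := by
  intro V _ G hG hk
  have hE : G.edgeSet.Nonempty := Set.nonempty_of_ncard_ne_zero (by omega)
  by_cases hleaf : ∃ v, ∃! w, G.Adj v w
  · classical
    have := Fintype.ofFinite V
    obtain ⟨v, hv⟩ := hleaf
    have hdeg := SimpleGraph.degree_eq_one_iff_existsUnique_adj.mpr hv
    obtain ⟨w, hvw, hw⟩ := hv
    have hcard : (G.induce {v}ᶜ).edgeSet.ncard = k := by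
      have := G.card_edgeFinset_induce_compl_singleton v
      rw [G.card_edgeFinset_deleteIncidenceSet, hdeg] at this
      simp only [← Set.ncard_coe_finset, SimpleGraph.coe_edgeFinset] at this
      omega
    obtain ⟨⟨n, m⟩, hg, ⟨φ⟩⟩ :=
      hL _ _ (hG.induce_compl_singleton_of_degree_eq_one hdeg) hcard
    have he := mem_newEdges_pendant (m := m) (φ ⟨w, hvw.ne'⟩).2
    obtain ⟨hm, g', hg', ⟨ψ⟩⟩ := exists_iso_of_extendsTo h hg he
    obtain ⟨χ⟩ := nonempty_iso_addEdge_of_pendant hvw hw hm φ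
    rw [max_eq_right n.le_succ] at ψ
    exact ⟨g', hg', ⟨χ.trans ψ⟩⟩
  · obtain ⟨x, y, hxy, hconn⟩ :=
      (exists_existsUnique_adj_or_exists_connected_deleteEdges hG hE).resolve_left hleaf
    have hcard : (G.deleteEdges {s(x, y)}).edgeSet.ncard = k := by
      rw [SimpleGraph.edgeSet_deleteEdges, Set.ncard_sdiff_singleton_of_mem (by exact hxy), hk,
        Nat.add_sub_cancel]
    obtain ⟨x, y, hxy, n, m, hg, φ, hlt⟩ : ∃ x y, G.Adj x y ∧ ∃ n m, (n, m) ∈ L ∧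
        ∃ φ : G.deleteEdges {s(x, y)} ≃g graph (n, m), φ x < φ y := by
      obtain ⟨⟨n, m⟩, hg, ⟨φ⟩⟩ := hL _ _ hconn hcard
      rcases lt_or_gt_of_ne (φ.injective.ne hxy.ne) with hlt | hlt
      · exact ⟨x, y, hxy, n, m, hg, φ, hlt⟩
      · refine ⟨y, x, hxy.symm, n, m, hg, ?_⟩
        rw [Sym2.eq_swap]
        exact ⟨φ, hlt⟩
    have hadj : adj m (φ x) (φ y) = false := by
      rw [← Bool.not_eq_true]
      change ¬ (graph (n, m)).Adj (φ x) (φ y)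
      simp [φ.map_adj_iff]
    have he := mem_newEdges (n := n) (show (φ x : ℕ) < φ y from hlt) (φ y).2 hadj
      fun z hz hzl => by
        by_contra! hne
        refine hleaf ⟨φ.symm ⟨z, hz⟩, existsUnique_adj_of_isLeaf φ (by simpa using hzl) ?_ ?_⟩
        · rintro e
          exact hne.1 (congrArg Fin.val (φ.symm_apply_eq.mp e))
        · rintro e
          exact hne.2 (congrArg Fin.val (φ.symm_apply_eq.mp e))
    obtain ⟨-, g', hg', ⟨ψ⟩⟩ := exists_iso_of_extendsTo h hg he
    obtain ⟨χ⟩ := nonempty_iso_addEdge_of_deleteEdges hxy φ hlt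
    rw [max_eq_left (φ y).2] at ψ
    exact ⟨g', hg', ⟨χ.trans ψ⟩⟩

/-! ### An isomorphism invariant -/

section Invariant

open Classical in
/-- The square of the number of walks from `u` to `v` of length one or two. -/
noncomputable def weight {V : Type} [Fintype V] (G : SimpleGraph V) (u v : V) : ℕ :=
  ((if G.Adj u v then 1 else 0) +
    ∑ w, (if G.Adj u w then 1 else 0) * (if G.Adj v w then 1 else 0)) ^ 2

/-- The weighted sums of the squares of the values of `c`. -/
noncomputable def relax {V : Type} [Fintype V] (G : SimpleGraph V) (c : V → ℕ) (u : V) : ℕ :=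
  ∑ v, weight G u v * c v ^ 2

/-- An isomorphism invariant of graphs. -/
noncomputable def invariant {V : Type} [Fintype V] (G : SimpleGraph V) : ℕ :=
  ∑ u, relax G (relax G fun u => ∑ v, weight G u v) u

variable {V W : Type} [Fintype V] [Fintype W] {G : SimpleGraph V} {H : SimpleGraph W}

lemma sum_map_iso (φ : G ≃g H) (f : W → ℕ) : ∑ w, f w = ∑ v, f (φ v) :=
  (φ.toEquiv.sum_comp f).symm

lemma weight_map (φ : G ≃g H) (u v : V) : weight H (φ u) (φ v) = weight G u v := by
  classical
  simp only [weight, sum_map_iso φ, φ.map_adj_iff]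

lemma relax_map (φ : G ≃g H) {c : V → ℕ} {d : W → ℕ} (h : ∀ u, d (φ u) = c u) (u : V) :
    relax H d (φ u) = relax G c u := by
  simp only [relax, sum_map_iso φ, weight_map, h]

lemma invariant_eq_of_iso (φ : G ≃g H) : invariant G = invariant H := by
  have h : ∀ u, ∑ v, weight H (φ u) v = ∑ v, weight G u v := fun u => by
    rw [sum_map_iso φ]
    simp only [weight_map]
  rw [invariant, invariant, sum_map_iso φ]
  exact Finset.sum_congr rfl fun u _ => (relax_map φ (relax_map φ h) u).symm

end Invariant

/-- The sum of the products of the entries of two lists. -/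
def dot (r : List ℕ) : List ℕ → ℕ :=
  List.rec (fun _ => 0) (fun x _ ih s => List.rec 0 (fun y ys _ => (x.mul y).add (ih ys)) s) r

lemma dot_map {α : Type} (l : List α) (f g : α → ℕ) :
    dot (l.map f) (l.map g) = (l.map fun x => f x * g x).sum := by
  induction l with
  | nil => rfl
  | cons x l ih =>
    rw [List.map_cons, List.map_cons, List.map_cons, List.sum_cons, ← ih]
    rfl

/-- The adjacency matrix of an encoded graph. -/
def rows (n m : ℕ) : List (List ℕ) :=
  (List.range n).map fun u => (List.range n).map fun v => (adj m u v).toNat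

/-- The matrix of weights of a graph with adjacency matrix `A`. -/
def weightRows (A : List (List ℕ)) : List (List ℕ) :=
  A.map fun r => List.zipWith (fun x s => force (x.add (dot r s)) fun y => y.mul y) r A

/-- The invariant of a graph, computed from its code. -/
def codeInvariant (n m : ℕ) : ℕ :=
  force n fun n => force m fun m =>
  forceMatrix (rows n m) fun A =>
  forceMatrix (weightRows A) fun M =>
  forceList (M.map List.sum) fun c => forceList (c.map fun x => x.mul x) fun c =>
  forceList (M.map fun r => dot r c) fun c => forceList (c.map fun x => x.mul x) fun c =>
  (M.map fun r => dot r c).sum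

lemma sum_map_range (n : ℕ) (f : ℕ → ℕ) : ((List.range n).map f).sum = ∑ i : Fin n, f i := by
  rw [Fin.sum_univ_eq_sum_range f n]
  rfl

lemma codeInvariant_eq (g : ℕ × ℕ) : codeInvariant g.1 g.2 = invariant (graph g) := by
  obtain ⟨n, m⟩ := g
  set w : ℕ → ℕ → ℕ := fun u v =>
    ((adj m u v).toNat + ∑ i : Fin n, (adj m u i).toNat * (adj m v i).toNat) ^ 2 with hw
  have hrows : weightRows (rows n m) = (List.range n).map fun u => (List.range n).map (w u) := by
    simp only [weightRows, rows, List.map_map, List.zipWith_map, List.zipWith_self, force_eq,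
      Function.comp_def, dot_map, sum_map_range]
    simp only [hw, sq]
    rfl
  have hweight : ∀ u v : Fin n, weight (graph (n, m)) u v = w u v := fun u v => by
    simp only [weight, graph_adj, hw, Bool.toNat, Bool.cond_eq_ite]
  simp only [codeInvariant, force_eq, forceMatrix_eq, forceList_eq, hrows, List.map_map,
    Function.comp_def, dot_map, sum_map_range, Nat.mul_eq, ← sq]
  simp only [invariant, relax, hweight]

/-! ### Connected graphs with nine edges -/

/-- Whether the graph on `n` vertices with code `m` has `k` edges, and each vertex but the first
has a smaller neighbour. -/
def isConnectedWithEdges (k n m : ℕ) : Bool :=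
  force n fun n => force m fun m =>
    Nat.blt 0 n && Nat.beq ((rows n m).map List.sum).sum (2 * k) &&
      allBelow n fun v => v.beq 0 || (List.range v).any fun u => adj m u v

lemma connected_of_isConnectedWithEdges {k n m : ℕ} (h : isConnectedWithEdges k n m = true) :
    (graph (n, m)).Connected := by
  simp only [isConnectedWithEdges, force_eq, Bool.and_eq_true, Nat.blt_eq, allBelow_iff,
    Bool.or_eq_true, Nat.beq_eq, List.any_eq_true, List.mem_range] at h
  obtain ⟨⟨hn, -⟩, hadj⟩ := h
  have hreach : ∀ v (hv : v < n), (graph (n, m)).Reachable ⟨0, hn⟩ ⟨v, hv⟩ := by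
    intro v
    induction v using Nat.strong_induction_on with
    | _ v ih =>
      intro hv
      rcases hadj v hv with rfl | ⟨u, hu, huv⟩
      · rfl
      · have huv' : (graph (n, m)).Adj ⟨u, hu.trans hv⟩ ⟨v, hv⟩ := huv
        exact (ih u hu (hu.trans hv)).trans huv'.reachable
  have : Nonempty (Fin n) := ⟨⟨0, hn⟩⟩
  exact ⟨fun u v => (hreach u u.2).symm.trans (hreach v v.2)⟩

lemma ncard_edgeSet_of_isConnectedWithEdges {k n m : ℕ}
    (h : isConnectedWithEdges k n m = true) : (graph (n, m)).edgeSet.ncard = k := by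
  classical
  simp only [isConnectedWithEdges, force_eq, Bool.and_eq_true, Nat.beq_eq, rows, List.map_map,
    Function.comp_def, sum_map_range] at h
  have hdeg : ∀ u : Fin n, (graph (n, m)).degree u = ∑ v : Fin n, (adj m u v).toNat := fun u => by
    rw [← SimpleGraph.card_neighborFinset_eq_degree, SimpleGraph.neighborFinset_eq_filter,
      Finset.card_filter]
    simp only [graph_adj, Bool.toNat, Bool.cond_eq_ite]
  have hsum := (graph (n, m)).sum_degrees_eq_twice_card_edges
  simp only [hdeg, h.1.2] at hsum
  rw [← SimpleGraph.coe_edgeFinset, Set.ncard_coe_finset]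
  omega

/-! ### The graphs with at most nine edges -/

/-- Codes of the connected graphs with `k` edges, for `k` at most nine, up to isomorphism.
Those with nine edges are listed in the order of their invariants. -/
def graphCodes : ℕ → List (ℕ × ℕ)
  | 0 => [
    (1, 0)]
  | 1 => [
    (2, 1)]
  | 2 => [
    (3, 3)]
  | 3 => [
    (3, 7), (4, 11), (4, 19)]
  | 4 => [
    (4, 15), (4, 51), (5, 75), (5, 139), (5, 275)]
  | 5 => [
    (4, 31), (5, 79), (5, 115), (5, 143), (5, 527), (5, 787), (6, 1099), (6, 2123), (6, 2187),
    (6, 4173), (6, 4235), (6, 8467)]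
  | 6 => [
    (4, 63), (5, 95), (5, 287), (5, 365), (5, 591), (5, 655), (6, 1103), (6, 1139), (6, 1811),
    (6, 2127), (6, 2163), (6, 2219), (6, 4205), (6, 4239), (6, 8271), (6, 8335), (6, 16499),
    (6, 16911), (6, 24851), (7, 33867), (7, 66635), (7, 67659), (7, 132173), (7, 133195),
    (7, 133259), (7, 135245), (7, 263269), (7, 266323), (7, 266379), (7, 532755)]
  | 7 => [
    (5, 127), (5, 223), (5, 351), (5, 799), (6, 1119), (6, 1143), (6, 1389), (6, 1615),
    (6, 1679), (6, 2143), (6, 2413), (6, 2639), (6, 4191), (6, 4751), (6, 8479), (6, 8847),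
    (6, 16479), (6, 16671), (6, 17523), (6, 18547), (6, 18603), (6, 20589), (6, 24719),
    (7, 33871), (7, 33907), (7, 33909), (7, 34579), (7, 57619), (7, 66639), (7, 66675),
    (7, 67347), (7, 67663), (7, 67691), (7, 68363), (7, 132205), (7, 132877), (7, 133199),
    (7, 133235), (7, 133291), (7, 263247), (7, 263255), (7, 264271), (7, 266383), (7, 282763),
    (7, 525427), (7, 525839), (7, 526451), (7, 526507), (7, 526863), (7, 528493), (7, 532559),
    (7, 532623), (7, 541199), (7, 1065075), (7, 1065487), (7, 1581331), (8, 2131019),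
    (8, 4228171), (8, 4260939), (8, 4261963), (8, 8422477), (8, 8455243), (8, 8455245),
    (8, 8456267), (8, 8520781), (8, 8521867), (8, 16811109), (8, 16844899), (8, 16909395),
    (8, 16910411), (8, 16910419), (8, 16910475), (8, 16912461), (8, 17040485), (8, 33588773),
    (8, 33687059), (8, 33817875), (8, 33820811), (8, 67641619)]
  | 8 => [
    (5, 255), (5, 863), (6, 1151), (6, 1247), (6, 1375), (6, 1655), (6, 1823), (6, 2175),
    (6, 2399), (6, 4319), (6, 5485), (6, 6771), (6, 8543), (6, 9815), (6, 10831), (6, 12943),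
    (6, 16511), (6, 17183), (6, 17503), (6, 17527), (6, 18527), (6, 18543), (6, 24863),
    (6, 25231), (7, 33887), (7, 33911), (7, 34157), (7, 34221), (7, 34227), (7, 34383),
    (7, 34447), (7, 34583), (7, 50291), (7, 51315), (7, 51371), (7, 53357), (7, 57487),
    (7, 66655), (7, 66679), (7, 66925), (7, 67151), (7, 67215), (7, 68175), (7, 76387),
    (7, 83059), (7, 86125), (7, 90191), (7, 132191), (7, 132461), (7, 132751), (7, 133215),
    (7, 133711), (7, 133747), (7, 148589), (7, 149619), (7, 149675), (7, 155791), (7, 263287),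
    (7, 263767), (7, 263823), (7, 264783), (7, 266335), (7, 266895), (7, 286863), (7, 525407),
    (7, 525431), (7, 525599), (7, 526431), (7, 528479), (7, 532767), (7, 533135), (7, 540767),
    (7, 540959), (7, 543247), (7, 674315), (7, 1049965), (7, 1050191), (7, 1050255),
    (7, 1050989), (7, 1051215), (7, 1053327), (7, 1057423), (7, 1065055), (7, 1065247),
    (7, 1116939), (7, 1182283), (7, 1182347), (7, 1574003), (7, 1577069), (7, 1581199),
    (7, 1589775), (8, 2131023), (8, 2131059), (8, 2131061), (8, 2131731), (8, 2131733),
    (8, 2131749), (8, 2154771), (8, 3678483), (8, 4228175), (8, 4228211), (8, 4228213),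
    (8, 4228883), (8, 4251923), (8, 4260943), (8, 4260971), (8, 4260979), (8, 4261643),
    (8, 4284683), (8, 8422509), (8, 8422517), (8, 8423059), (8, 8423181), (8, 8446221),
    (8, 8455247), (8, 8455277), (8, 8455283), (8, 8455955), (8, 8456271), (8, 8456299),
    (8, 8456971), (8, 8520813), (8, 8522317), (8, 16811087), (8, 16811095), (8, 16830603),
    (8, 16843855), (8, 16844451), (8, 16844879), (8, 16845411), (8, 16863371), (8, 16909399),
    (8, 16910415), (8, 16910451), (8, 16910507), (8, 17040471), (8, 18354315), (8, 33588339),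
    (8, 33588403), (8, 33588525), (8, 33588751), (8, 33588759), (8, 33608211), (8, 33621107),
    (8, 33621163), (8, 33621519), (8, 33622123), (8, 33622315), (8, 33686637), (8, 33686707),
    (8, 33687667), (8, 33687723), (8, 33688079), (8, 33817679), (8, 33817743), (8, 33818703),
    (8, 33820815), (8, 34080271), (8, 34081295), (8, 67158131), (8, 67158543), (8, 67177227),
    (8, 67190899), (8, 67190955), (8, 67191311), (8, 67241741), (8, 67256429), (8, 67634291),
    (8, 67635315), (8, 67635371), (8, 67637357), (8, 67641423), (8, 67641487), (8, 67650063),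
    (8, 68173939), (8, 68174351), (8, 134500491), (8, 135282803), (8, 135283215), (8, 201859347),
    (9, 270566475), (9, 539001931), (9, 541099083), (9, 541131851), (9, 1075872845),
    (9, 1077969995), (9, 1077969997), (9, 1078002763), (9, 1078003787), (9, 1082164301),
    (9, 1082197069), (9, 1082198091), (9, 1082262605), (9, 2149614693), (9, 2151711845),
    (9, 2151744611), (9, 2155906131), (9, 2155906133), (9, 2155906149), (9, 2155938891),
    (9, 2155938899), (9, 2155939915), (9, 2156004429), (9, 2156005459), (9, 2156005515),
    (9, 2164294757), (9, 2164328547), (9, 4297098789), (9, 4299228707), (9, 4303390227),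
    (9, 4303488525), (9, 4311778579), (9, 4311811347), (9, 4311812363), (9, 4311876747),
    (9, 4311876877), (9, 4311877707), (9, 4311877771), (9, 4311879757), (9, 4328556069),
    (9, 4328654355), (9, 8592081445), (9, 8598372883), (9, 8606859403), (9, 8623530259),
    (9, 8623755403), (9, 17247510803)]
  | 9 => [
    (10, 8813340533011), (9, 51607249171), (10, 4398318109221), (10, 4399123415571),
    (10, 4402344632595), (10, 4406639075603), (9, 470294803), (10, 2207615336997),
    (10, 4400203448459), (10, 4406653751435), (10, 4406670266507), (10, 2207621628435),
    (9, 2349338763), (10, 2203351814675), (9, 34378092683), (9, 34494238859),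
    (10, 2200105435661), (10, 2203326661139), (10, 2207630114955), (10, 2203326652685),
    (9, 4298641939), (10, 2203326750797), (10, 2199564370467), (9, 1077420301), (9, 4329703947),
    (10, 2203335135309), (10, 1103815116301), (9, 8607907979), (10, 2201174982931),
    (9, 4304670797), (10, 2203322458387), (10, 2201175015691), (10, 1103810856483),
    (9, 17189308173), (10, 2203322491147), (9, 540549395), (9, 542646539), (9, 17247110925),
    (10, 2203335037075), (10, 2203335069835), (8, 85082251), (10, 1101663372835),
    (10, 1101675955363), (9, 2153255051), (9, 4300476555), (8, 167922187), (10, 1101675956323),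
    (9, 4303409677), (9, 17184346251), (10, 2203335133323), (9, 34495021171), (9, 2151735459),
    (9, 17196732555), (10, 1100593825299), (9, 2151768163), (9, 17315151987), (8, 151081099),
    (10, 1100593826315), (10, 1101667566867), (10, 1101667632275), (9, 8594170531),
    (10, 1101667633291), (9, 17248043123), (9, 8606779043), (9, 1077993747), (9, 1078026507),
    (9, 8598358803), (10, 551911819347), (9, 2155958411), (8, 4868619), (9, 17185114891),
    (10, 551911819403), (9, 17247046411), (8, 5375757), (9, 2155939603), (9, 17189322861),
    (9, 1082220621), (9, 17185128563), (9, 34495021583), (9, 8657191021), (9, 17247506541),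
    (9, 17315152399), (9, 8657125491), (8, 201855085), (9, 17247504499), (9, 17248043535),
    (8, 201460363), (9, 17214489103), (9, 17247519247), (8, 201394955), (9, 8606780003),
    (8, 68305005), (9, 8594203235), (9, 8657584655), (9, 8598391563), (8, 17893027),
    (9, 8594199307), (9, 17185128619), (8, 5507683), (9, 8657125547), (8, 201867791),
    (9, 17247504555), (8, 9570955), (8, 151144587), (8, 134294115), (9, 8598372531),
    (10, 2199293837861), (9, 8598405235), (9, 8598393421), (10, 1103808726565), (9, 8598456909),
    (10, 1101661242917), (9, 8623622259), (9, 8623526067), (10, 1100587501093), (8, 5771373),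
    (8, 9963635), (10, 1101661242661), (8, 202392079), (9, 2155940451), (10, 551911720037),
    (9, 2155940619), (8, 8463973), (8, 134303853), (10, 2200099144211), (10, 2203320361235),
    (9, 272113939), (10, 1103815018003), (9, 270590245), (9, 17185128975), (9, 4297118227),
    (10, 1100593792525), (10, 1101667534093), (9, 8657125903), (10, 1100050630181),
    (9, 1075896589), (8, 8464995), (8, 17893987), (9, 8623571471), (10, 551907525733),
    (9, 8592069389), (10, 1101661242645), (9, 270590229), (9, 17214480527), (8, 9505547),
    (9, 17247510671), (9, 270590501), (8, 201859215), (10, 2201179177099), (10, 2203335037067),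
    (10, 550833783909), (9, 2151157899), (9, 8624015887), (9, 4311877747), (9, 2155906661),
    (9, 17182249099), (10, 550837978197), (10, 1101667632205), (8, 35129871),
    (10, 1100052727331), (9, 8598405291), (8, 5378637), (10, 1100589598227), (10, 1101663339795),
    (9, 8598357773), (9, 8623622315), (9, 539025683), (8, 134760975), (10, 551907558499),
    (10, 1101667533971), (8, 8478835), (9, 8594211115), (9, 8592067347), (9, 4328655019),
    (8, 2771467), (9, 8623558827), (10, 550838010957), (8, 18358415), (10, 2203335133259),
    (9, 2151712419), (10, 551920108645), (8, 134367347), (9, 2149634317), (9, 4312926283),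
    (9, 1077970701), (8, 134504591), (8, 5784079), (8, 9962613), (10, 1101663372555),
    (9, 2149615269), (10, 1101667566731), (9, 1075896467), (9, 541122827), (9, 4328589611),
    (9, 2151731339), (9, 1075873557), (8, 33835535), (10, 550838010963), (9, 539002661),
    (9, 1077970707), (8, 33841295), (10, 550838076493), (9, 2149615397), (10, 1101667567691),
    (8, 33703091), (8, 33704051), (10, 550838011979), (9, 8598405647), (9, 8592069267),
    (9, 17183031411), (8, 16926835), (8, 134367403), (8, 2140835), (9, 4328655375),
    (9, 8657092723), (9, 1082165005), (9, 8592081197), (9, 8623628431), (7, 607539),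
    (8, 9969807), (10, 275960104013), (9, 2155923595), (9, 4328555821), (9, 4311877803),
    (9, 8592081075), (9, 8623755407), (8, 33704463), (9, 17247503475), (9, 1082164883),
    (8, 2142821), (8, 134373519), (9, 8598372461), (8, 142696523), (7, 574773), (9, 4311812395),
    (9, 8623525997), (9, 8594164491), (9, 1082164877), (8, 3674221), (8, 16933007),
    (8, 33704107), (9, 4297098549), (9, 8594178163), (7, 674319), (10, 550296945763),
    (9, 4303389813), (9, 8623523955), (8, 135275151), (8, 3279499), (9, 8623621229),
    (8, 33604909), (9, 8594196235), (9, 4303389869), (9, 2151745123), (9, 4299195693),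
    (8, 2150517), (8, 68166287), (8, 16926891), (10, 550833816659), (8, 134271085),
    (10, 550833817675), (7, 673963), (9, 541099795), (9, 8623555699), (9, 4303389875),
    (10, 275955910731), (8, 4237923), (9, 1078003467), (9, 4303422573), (8, 3214091),
    (8, 2150579), (9, 17183031823), (8, 135268717), (9, 8657093135), (7, 673907),
    (9, 8623538703), (8, 4247661), (9, 4303422579), (8, 135271055), (9, 2155906165),
    (8, 68159853), (8, 67641999), (8, 2150573), (9, 2155938931), (9, 17214480463), (8, 17057895),
    (8, 3686927), (9, 17247510607), (8, 201460299), (9, 8624014863), (9, 8594178219),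
    (8, 9471757), (9, 8623524011), (8, 9962605), (9, 539002645), (8, 67248783), (9, 1082197581),
    (9, 1075873573), (8, 67375759), (8, 3672235), (9, 8592081431), (9, 4328556055), (7, 1313551),
    (8, 5768307), (8, 67242611), (9, 8594210923), (7, 1115955), (9, 4303488109), (9, 8623556715),
    (8, 5376587), (9, 4311778839), (9, 8594178575), (7, 1312179), (8, 134269043),
    (9, 4328588815), (8, 8439917), (8, 33821327), (9, 8606761103), (9, 8623530127), (8, 3678351),
    (8, 8441965), (8, 33606159), (9, 4299228275), (8, 8439923), (7, 574765), (9, 4312007767),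
    (9, 1082198603), (8, 2155031), (8, 34670699), (9, 1082197101), (9, 8623562831),
    (8, 16834647), (8, 5775439), (8, 8438901), (9, 4303422635), (9, 8623753295), (8, 34867279),
    (8, 67143085), (9, 4299228459), (8, 33688179), (9, 1078002803), (8, 16834703),
    (9, 1082164341), (9, 1077970579), (8, 134366317), (9, 4303423595), (9, 4303390231),
    (8, 8439979), (9, 4297098421), (9, 4311778583), (8, 8423091), (8, 134300787), (8, 2154775),
    (9, 2164393047), (9, 4303422991), (8, 16811381), (9, 4311876751), (8, 8446095), (8, 8471661),
    (9, 4311877711), (9, 1077970037), (8, 134307919), (8, 67143091), (9, 2155939947),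
    (7, 537231), (8, 8471667), (7, 156303), (8, 33637903), (8, 135267983), (8, 135267693),
    (8, 4245619), (7, 607759), (8, 67150423), (8, 8537197), (8, 8472683), (8, 16811443),
    (8, 67150479), (8, 16830607), (8, 16811799), (8, 4245675), (8, 67372631), (8, 17057871),
    (8, 4269667), (8, 67144045), (7, 1312343), (8, 4277363), (8, 67372687), (8, 8478799),
    (10, 1099782194725), (9, 4299228687), (10, 551905428581), (10, 550831686757), (8, 135282975),
    (8, 33818255), (8, 68174111), (7, 1082797), (8, 67146383), (8, 67175789), (8, 135268943),
    (9, 270567205), (9, 4311811215), (9, 4311812175), (8, 67649823), (8, 4251791),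
    (10, 275960071245), (9, 2164328527), (8, 17056855), (8, 67241615), (8, 16909911),
    (10, 1100587501075), (10, 1101661242643), (7, 1116971), (9, 270590227), (10, 550837978189),
    (10, 550294815845), (8, 16909967), (8, 8455795), (9, 1075873549), (10, 550831686741),
    (7, 42357), (10, 275955876941), (8, 8422829), (9, 270567189), (8, 2131765), (7, 531059),
    (9, 2151744615), (8, 4228525), (8, 67373647), (8, 4284495), (7, 1115563),
    (10, 1101667533963), (9, 2155939919), (9, 2149634187), (10, 550296912995),
    (10, 550833783891), (9, 1075872885), (7, 1313359), (8, 67242575), (9, 539002643),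
    (8, 67387679), (7, 1082803), (7, 57999), (7, 1115501), (8, 67641631), (7, 1581343),
    (8, 34087199), (9, 1075873427), (8, 4228531), (7, 45655), (7, 549151), (10, 275419006029),
    (10, 1101667566667), (7, 1181327), (10, 550833816651), (10, 275955909707), (8, 67241325),
    (7, 1182287), (8, 16910927), (8, 67176079), (10, 275419038795), (9, 4297098541), (7, 45711),
    (8, 16844431), (7, 1181037), (8, 4228887), (8, 67177039), (9, 8592081011), (8, 8455533),
    (9, 4297098419), (9, 539001973), (9, 4303389805), (8, 2150509), (8, 67158135),
    (9, 1077970029), (8, 8455823), (8, 16845391), (9, 1082164333), (9, 8623522931),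
    (9, 541099787), (8, 67634295), (9, 4299195507), (8, 34079863), (8, 8456783), (9, 1082198095),
    (7, 39539), (7, 534159), (8, 135282783), (9, 1077970035), (8, 68173919), (8, 2131373),
    (8, 33588791), (7, 141903), (9, 541099123), (6, 29327), (8, 67649631), (7, 1115791),
    (8, 33817719), (7, 1574007), (7, 280207), (9, 8592081423), (7, 57463), (7, 1116523),
    (9, 4328556047), (7, 1116751), (7, 140887), (8, 67158303), (8, 34080031), (8, 3671155),
    (9, 4297098775), (8, 67256415), (8, 4262251), (9, 2164294743), (8, 67637343),
    (9, 8623530063), (8, 2148467), (7, 1575023), (8, 3279435), (9, 4299195563), (8, 2148523),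
    (8, 34082911), (9, 4299195919), (7, 76367), (10, 137980085323), (9, 4311778447),
    (8, 2154639), (9, 8623752271), (7, 1065759), (9, 4299228267), (8, 2131379), (8, 33817887),
    (7, 271959), (7, 57631), (9, 2155906135), (7, 541815), (9, 541131883), (9, 4311811151),
    (9, 1078002795), (8, 33820767), (8, 17040503), (7, 279671), (7, 75351), (9, 2155938895),
    (8, 2131735), (7, 541871), (8, 8438893), (9, 2151711831), (7, 542831), (8, 33621111),
    (7, 34739), (8, 134268019), (8, 33588407), (9, 2151744591), (8, 4244595), (8, 67190879),
    (8, 67143021), (8, 16811607), (8, 4251727), (7, 280687), (8, 4228461), (8, 67143311),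
    (8, 67635295), (9, 1078002767), (7, 1575007), (8, 34080863), (8, 16811663), (8, 16843895),
    (8, 2131607), (8, 8423055), (8, 33621279), (7, 1050231), (8, 8422765), (8, 33687647),
    (7, 83063), (8, 135267919), (7, 84079), (7, 525943), (8, 4228751), (8, 67144271),
    (7, 1050399), (8, 4277355), (8, 16910431), (7, 526111), (6, 23155), (8, 67176015),
    (7, 86111), (8, 33588343), (7, 542815), (8, 16844367), (8, 16811127), (8, 8455759),
    (8, 8455287), (8, 4261455), (7, 149599), (7, 71021), (7, 1082733), (7, 263799),
    (9, 541131855), (7, 1083023), (6, 18039), (7, 67191), (7, 1057119), (7, 42583), (7, 43599),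
    (10, 550026380389), (8, 67158111), (10, 275953779789), (8, 4228215), (7, 67359),
    (8, 67634271), (8, 33588511), (8, 34079839), (7, 532831), (10, 550831686739), (9, 270567187),
    (10, 275416908877), (9, 270566517), (7, 50295), (8, 33686623), (6, 18207), (7, 68207),
    (10, 550833783883), (10, 275419006027), (8, 16909407), (10, 137980052555), (7, 1573983),
    (7, 1050975), (8, 4260975), (6, 24927), (8, 33588383), (9, 1075872877), (7, 34423),
    (7, 51311), (8, 33621087), (7, 264431), (7, 264543), (9, 4297098355), (9, 539001971),
    (8, 8455263), (7, 541791), (7, 34591), (7, 148575), (7, 51295), (7, 38253), (7, 133471),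
    (9, 4297098767), (9, 2149614679), (9, 4311778383), (9, 541099115), (7, 83039),
    (9, 2151711823), (9, 1077969999), (6, 9847), (9, 541099087), (6, 3703), (7, 1052895),
    (8, 2131309), (8, 2147443), (8, 4260959), (6, 10591), (7, 1049951), (8, 2131599),
    (7, 1065087), (7, 266463), (7, 34207), (7, 263519), (7, 540799), (7, 135391), (8, 2131063),
    (7, 66911), (8, 67143247), (8, 4228687), (6, 12511), (6, 6495), (7, 526463), (8, 33588319),
    (8, 8422495), (6, 18559), (7, 1049823), (8, 4228191), (7, 1082959), (6, 2911), (6, 9567),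
    (7, 132319), (7, 133247), (7, 525439), (10, 275148473421), (7, 50271), (10, 275416908875),
    (10, 137977955403), (7, 66687), (6, 17535), (9, 270566515), (7, 66783), (6, 1887),
    (7, 34143), (6, 5343), (6, 16639), (9, 2149614671), (9, 539001935), (6, 4351), (7, 34015),
    (7, 33919), (8, 2131535), (6, 1279), (8, 2131039), (6, 3295), (10, 137709519947),
    (9, 270566479), (5, 511), (10, 68990043211)]
  | _ => []

set_option maxRecDepth 100000 in
/-- For each graph in `graphCodes k`, and each of its new edges, the position in
`graphCodes (k + 1)` of a graph isomorphic to the extended graph, followed by the ten digits of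
an isomorphism. -/
def extensionCertificates : ℕ → List (List ℕ)
  | 0 => [
    [10]]
  | 1 => [
    [210, 201]]
  | 2 => [
    [10000003210, 20000003210, 20000003120, 210]]
  | 3 => [
    [3210, 3201, 3021], [20000043210, 30000043210, 30000043120, 30000041320], [30000034210,
    30000032401, 40000043210, 40000042301, 10000003210]]
  | 4 => [
    [10000043210, 30000043210, 30000043120, 40000043210, 3210, 3120], [20000043210, 20000042301,
    20000042031, 20000040213, 3102, 1320], [60000543210, 70000543210, 70000543120, 70000541320,
    70000514320], [70000453210, 80000543210, 100000543210, 100000542310, 90000524310],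
    [100000354210, 90000453201, 90000435021, 110000543210, 110000534120, 50000043210]]
  | 5 => [
    [10000043210, 10000043201, 20000043210, 20000042310, 3210], [60000543210, 90000543210,
    90000543120, 140000543210, 140000534210, 40000043210], [70000543210, 100000543210,
    100000543120, 120000542310, 160000543210, 50000024310, 50000024130, 30000042310],
    [90000453210, 90000435201, 130000543210, 150000543210, 150000534201, 50000043210],
    [140000453210, 150000453210, 150000453120, 110000541320, 170000543210, 40000043210,
    50000043210, 50000043120], [80000543210, 80000542301, 80000524031, 80000520413, 80000502143,
    50000043102, 50000041320, 50000021043, 50000014230, 50000012403], [190006543210,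
    200006543210, 200006543120, 200006541320, 200006514320, 200006154320], [200005643210,
    210006543210, 230006543210, 230006542310, 230006524310, 220006254310], [210004653210,
    210004326501, 240006543210, 240006542310, 240006325401, 240006235401], [220005643210,
    240003654201, 250006543210, 270005642310, 270005624310, 260006354210], [230004653210,
    240005643210, 240005463120, 280006543210, 270006534210, 270006354120], [270004653210,
    270004562301, 260005643021, 260005460312, 290006543210, 290006452301, 180000543210]]
  | 6 => [
    [43210, 43201, 43021, 40321], [40000543210, 90000543210, 120000543210, 120000542310,
    160000543210, 10000043210, 20000043210, 20000042310], [120000453210, 120000453201,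
    50000543021, 140000543210, 170000543210, 20000043210, 20000043201, 30000043210],
    [60000543210, 100000543210, 60000543012, 100000541230, 100000514230, 10000043120,
    30000041302, 30000014302, 30000010342], [70000543210, 110000543210, 110000543120,
    110000521430, 110000512430, 20000042310, 20000042130, 20000024310, 20000024130],
    [80000543210, 80000534201, 130000543210, 150000543210, 150000534201, 20000042301,
    30000043120, 20000024310, 30000034102], [230006543210, 280006543210, 280006543120,
    390006543210, 390006534210, 390006354210], [240006543210, 290006543210, 290006543120,
    340006542310, 440006543210, 440006453210, 180000543210], [260006543210, 300006543210,
    300006534120, 350006542310, 350006524130, 430006354210, 220000254310, 220000245130,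
    210000352410, 210000325140], [280005643210, 310006543210, 360006543210, 410006543210,
    410006534210, 400006354210], [290005643210, 290005462301, 370006543210, 370006452301,
    460006543210, 460006452301, 190000543210], [320004653210, 250006543201, 380006543210,
    380006542310, 470006543210, 470006453210, 200000543210], [340005643210, 370004653201,
    340005463012, 370004650231, 490006543210, 490006453012, 210000543210], [360004653210,
    360004635201, 360004365021, 420006543210, 420006534201, 420006354021], [390005643210,
    410005643210, 410005643120, 320006541320, 500006543210, 450006453210, 180000321540],
    [410004653210, 400005643201, 420005643210, 380005461320, 510006543210, 480006453210,
    220000543210], [440005643210, 460005643210, 460005643120, 490005642310, 330006514320,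
    530006543210, 180000543210, 190000543210, 190000543120, 210000542310], [450005643210,
    480005643210, 480005643120, 470005641320, 520006543210, 540006543210, 180000231540,
    220000453210, 220000453120, 200000541320], [270006543210, 270006452301, 270006425031,
    270006240513, 270006204153, 270006021435, 220000543102, 220000451320, 190000541032,
    220000415230, 190000514302, 220000210435, 190000153420, 220000142503, 220000124053],
    [560076543210, 570076543210, 570076543120, 570076541320, 570076514320, 570076154320,
    570071654320], [570067543210, 580076543210, 610076543210, 610076542310, 610076524310,
    610076254310, 600072654310], [580057643210, 590076543210, 630076543210, 630076542310,
    630076524310, 620076254310, 620072654310], [600067543210, 620067543210, 640076543210,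
    680067542310, 680067524310, 680067254310, 660073654210], [610057643210, 630067543210,
    630065743120, 690076543210, 690076534210, 680076354210, 680073654120], [630047653210,
    620057436201, 650076543210, 710076543210, 700076534210, 700076354210, 670073654210],
    [640057643210, 650037654201, 640054376012, 720076543210, 720076534210, 720074365012,
    720073465012], [660067543210, 670047653201, 720047653012, 730076543210, 750067524310,
    750067254310, 740074653210], [680057643210, 700057643210, 670067543120, 720065742310,
    770067534210, 760076453210, 750074653210], [690047653210, 710057643210, 710057463120,
    710054761320, 770076543210, 770076453120, 770074651320], [760057643210, 750057642301,
    750056724031, 740067540312, 740065704132, 780076543210, 780075634120, 550006543210]]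
  | 7 => [
    [20000543210, 70000543210, 70000543120, 70000541320, 160000543210, 43210, 43120, 41320],
    [30000543210, 30000543201, 90000543210, 90000542310, 90000524310, 43210, 34210, 32410],
    [40000543210, 80000543210, 80000534120, 120000543210, 120000534120, 43120, 34210,
    10000043210], [60000543210, 60000543201, 50000543021, 50000540321, 170000543210, 41032,
    10000043210, 10000043201], [240006543210, 370006543210, 470006543210, 470006542310,
    640006543210, 640006453210, 180000543210], [250006543210, 380006543210, 380006543120,
    570006543210, 650006543210, 650006453210, 190000543210], [260006543210, 390006543210,
    480006543210, 390006541230, 390006514230, 750006543210, 130000254310, 100000543210,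
    130000251340, 130000215340], [290006543210, 400006543210, 400006543120, 400006521430,
    400006512430, 760006543210, 180000354210, 180000354120, 180000321540, 180000312540],
    [300006543210, 410006543210, 490006543210, 590006543210, 580006534210, 770006543210,
    200000354210, 210000354210, 140000453210, 130000534210], [370005643210, 370005463201,
    500006543210, 500006542310, 670006543210, 670006453201, 200000543210], [390005643210,
    280006543201, 390005643012, 520006542310, 520006524310, 780006543210, 130000254310,
    130000254013, 110000542310, 110000524310], [400005643210, 420006543210, 510006543210,
    600006543210, 600006534210, 790006543210, 180000354210, 190000354210, 140000543210,
    140000534210], [470005643210, 500005643210, 380005463021, 610006543210, 680006543210,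
    660006453210, 210000543120], [490005643210, 490005634201, 310006543021, 620006543210,
    620006534201, 800006543210, 210000354210, 210000345201, 150000543210, 150000534201],
    [610004653210, 610004653201, 570005643021, 570005460321, 690006543210, 690006452310,
    220000543210], [590005643210, 580005643201, 620005643210, 270006530421, 700006543210,
    810006543210, 140000453210, 130000543201, 150000543210, 230000543210], [640005643210,
    670005643210, 680005643210, 680005642310, 710006543210, 820006543210, 180000543210,
    200000543210, 210000543120, 210000541320], [660005643210, 660005643201, 650005643021,
    690005643210, 720006543210, 830006543210, 210000453120, 210000453102, 190000543021,
    220000543210], [320006543210, 440006543210, 440006543120, 530006542310, 460006215430,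
    460006125430, 190000543210, 180000541320, 210000325410, 210000325140, 130000213540,
    210000235410, 210000235140, 130000123540], [330006543210, 330006452301, 540006543210,
    540006452301, 540006325410, 540006234501, 210000453201, 210000542310, 210000324501,
    150000524130, 110000523410, 210000235410, 110000345210, 150000251403], [340006543210,
    340006325401, 550006543210, 550006542310, 550006325401, 550006235401, 190000543201,
    190000542301, 190000325410, 230000542130, 230000541230, 190000235410, 230000452130,
    230000451230], [350006543210, 450006543210, 350006453012, 450006541230, 430006514320,
    430006154023, 200000543120, 220000541302, 150000524301, 130000215043, 150000520341,
    130000125340, 150000254103, 150000250143], [360006543210, 360006534201, 560006543210,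
    630006543210, 630006534201, 730006453210, 210000541302, 220000543120, 210000514320,
    220000534102, 230000543210, 140000354210, 140000345201, 150000354021], [910076543210,
    990076543210, 990076543120, 1230076543210, 1230076534210, 1230076354210, 1230073654210],
    [920076543210, 1000076543210, 1000076543120, 1090076542310, 1370076543210, 1370076453210,
    1370074653210], [930076543210, 1010076543210, 1100076543210, 1100076542310, 1110076524310,
    1110076254310, 1110072654310], [940076543210, 1020076543210, 1020076534120, 1120076542310,
    1120076524130, 1250076354210, 1250073654210, 850004365210], [970076543210, 1030076543210,
    1030076534120, 1130076452310, 1130076425130, 1420076453210, 1360073654210, 890002654310,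
    890002645130, 880003562410, 880003526140, 740003465210], [990067543210, 1040076543210,
    1140076543210, 1260076543210, 1260076534210, 1260076354210, 1240073654210], [1000067543210,
    1060076543210, 1160076543210, 1150076542310, 1430076543210, 1430076453210, 1380074653210],
    [1020067543210, 1020065742301, 1170076543210, 1170075642301, 1270076534210, 1300076354210,
    1300073652401, 860004365210], [1040057643210, 1040054376201, 1180076543210, 1280076543210,
    1280076534210, 1280074365201, 1280073465201], [1050057643210, 1010065473201, 1190076543210,
    1190076542310, 1460076543210, 1440076453210, 1440074653210], [1070057643210, 950076543201,
    1200076543210, 1200076542310, 1290076534210, 1610076543210, 1610075643210, 840006543210],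
    [1090067543210, 1150067543210, 1210076543210, 1150067541230, 1480076543210, 1480076453210,
    1390074653210], [1120067543210, 1170057643201, 1120065734012, 1270067541320, 1270065714023,
    1650076543210, 1650075634012, 740006251430], [1140057643210, 1180067543210, 1180065743120,
    1320076543210, 1320076534210, 1310076354210, 1310073654120], [1160057643210, 1150057463201,
    1150054763021, 1330076543210, 1500076543210, 1490076453210, 1490074653120], [1190047653210,
    1100067543201, 1350054762031, 1340076543210, 1510076543210, 1510076453210, 1470074653210],
    [1230067543210, 1260067543210, 1260067543120, 1050076541320, 1530076543210, 1530076453210,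
    1400074653210], [1240067543210, 1280047653201, 1310067543210, 1350076543210, 1540067534210,
    1540067354210, 1410074653210], [1260057643210, 1280067543210, 1320067543210, 1190065741320,
    1550076543210, 1540076453210, 1450074653210], [1320047653210, 1310057643201, 1310057463021,
    1340054761320, 1560076543210, 1560076453120, 1520074653210], [1250067543210, 1300067543210,
    1300067453120, 1080076541320, 1650067425310, 1650067245130, 1760076543210, 850004653210,
    860004653210, 860004563120, 740006542130, 740006452310], [1370067543210, 1430067543210,
    1430067543120, 1480067542310, 1070076514320, 1670076543210, 1590075643210, 870006543210],
    [1400067543210, 1450067543210, 1450067543120, 1440067541320, 1570076543210, 1710067453210,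
    1600075643210, 850006251430], [1430057643210, 1380067542301, 1500067543210, 1490067542301,
    1200065714320, 1680076543210, 1620075643210, 860006524310], [1440057643210, 1110067524301,
    1510067543210, 1510067542310, 1220076524310, 1690076543210, 1630075643210, 840004326501],
    [1450057643210, 1410067543201, 1520067543210, 1510057641320, 1580076543210, 1720067453210,
    1640075643210, 890006453210], [1480057643210, 1490057643201, 1390067543012, 1490057640231,
    1290065714320, 1700076543210, 1660075643210, 880006543210], [1530057643210, 1550057643210,
    1550057643120, 1460067541320, 1460065714320, 1710076543210, 1710075634210, 850006521430],
    [1540057643210, 1540056734201, 1560057643210, 1470067541320, 1470065714302, 1720076543210,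
    1720075634201, 890006543210], [1570057643210, 1580057643210, 1580057643120, 1220057621430,
    960076501432, 1730076543210, 1730075643210, 900006543210], [1590067543210, 1620067543210,
    1620067543120, 1660067542310, 1610067514320, 1740076543210, 1770076543210, 870005643210,
    860005624310, 860005624130, 880005642310, 840006514320], [1600067543210, 1640067543210,
    1640067543120, 1630067541320, 1730067543210, 1750076543210, 1780076543210, 850002651430,
    890004653210, 890004653120, 840003420651, 900006543210], [980076543210, 980076452301,
    980074625031, 980074260513, 980072406153, 980072041635, 980070214365, 890006543102,
    890006451320, 860006521043, 890004615230, 860005612403, 860004310526, 860005164230,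
    890004162503, 860004135062, 890002104365, 860001546320, 860001453602, 890001426053,
    890001240635], [1800876543210, 1810876543210, 1810876543120, 1810876541320, 1810876514320,
    1810876154320, 1810871654320, 1810817654320], [1810786543210, 1820876543210, 1850876543210,
    1850876542310, 1850876524310, 1850876254310, 1850872654310, 1840827654310], [1820687543210,
    1830876543210, 1870876543210, 1870876542310, 1870876524310, 1870876254310, 1860872654310,
    1860827654310], [1830587643210, 1830543287601, 1880876543210, 1880876542310, 1880876524310,
    1880843276501, 1880842376501, 1880824376501], [1840786543210, 1860786543210, 1890876543210,
    1960786542310, 1960786524310, 1960786254310, 1960782654310, 1930837654210], [1850687543210,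
    1870786543210, 1870768543120, 1990876543210, 1990876534210, 1990876354210, 1960873654210,
    1960837654120], [1860687543210, 1880483765201, 1900876543210, 2000786542310, 2000786524310,
    2000786254310, 1970873654210, 1940837654210], [1870587643210, 1880786543210, 1910876543210,
    2010876543210, 2010876534210, 2000876354210, 2000873654210, 1950837654210], [1890687543210,
    1900687543210, 1920876543210, 2020876543210, 2020876534210, 2020876354210, 1980873654210,
    1980837654210], [1910487653210, 1900587436201, 1900543876021, 2040876543210, 2030876534210,
    2030876354210, 2030853764120, 2030835764120], [1930786543210, 1940786543210, 1980786543210,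
    2050876543210, 2090786524310, 2090786254310, 2090782654310, 2070847653210], [1950587643210,
    1940685473201, 2030587643120, 2060876543210, 2130786534210, 2120786354210, 2120783654210,
    2080847653210], [1960687543210, 2000687543210, 1950786543120, 2020768542310, 2140786534210,
    2140786354210, 2110874653210, 2090847653210], [1990587643210, 2010687543210, 2010685743120,
    2010658741320, 2160876543210, 2140876453210, 2140874653120, 2140847651320], [2000587643210,
    2000578462301, 2030786543210, 2030768452301, 2170786534210, 2170768352401, 2120874653210,
    2120847562301], [2010487653210, 1970687543201, 2040786543210, 2040768542310, 2170876543210,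
    2170876453210, 2130874653210, 2130847652310], [2020587643210, 2030487653201, 1980685473012,
    2060658741320, 2180876543210, 2150876453210, 2150874653210, 2100847653210], [2050687543210,
    2060487653201, 2060465871023, 2050654870123, 2200687524310, 2200687254310, 2200652870134,
    2200625870134], [2070786543210, 2080587643201, 2100587643012, 2200568720134, 2190876543210,
    2220786254310, 2220782654310, 2210857643210], [2090687543210, 2120587642301, 2080786543120,
    2150687542310, 2200876543210, 2230786354210, 2240784653210, 2220857643210], [2110687543210,
    2120687543210, 2120678534120, 2100786542310, 2100768524130, 2250687354210, 2240875643210,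
    2240857634120], [2140587643210, 2170587643210, 2130687543120, 2130685741320, 2180658724310,
    2250876543210, 2250875642310, 2230857643210], [2240687543210, 2240678452301, 2220687524031,
    2220678250413, 2210786504132, 2210768051423, 2260876543210, 2260867452301, 1790076543210]]
  | 8 => [
    [7030000543210, 7030000543201, 6990000543210, 6990000542310, 6960000543210, 7080000043210,
    7080000042310], [6930000543210, 6800000543210, 6800000534120, 6800000531420, 6800000513240,
    7080000042130, 7080000024310], [7010006543210, 6890006543210, 6890006543120, 6890006541320,
    6840006543210, 6840006453210, 6900000543210], [7000006543210, 6920006543210, 6820006543210,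
    6820006542310, 6820006524310, 6770006543210, 7050000543210, 6950000543210, 6950000542310,
    6950000524310], [6940006543210, 6680006543210, 6680006534120, 6640006543210, 6640006534120,
    6590006543210, 6950000453210, 6950000435120, 6810000543210, 6810000534120], [6300006543210,
    5990006543210, 5990006543120, 5950006543210, 5750006543210, 5690006543210, 6530000543210,
    6530000543120, 6510000543210, 5980000543210], [6390006543210, 6070006543210, 5990005643021,
    5990005640321, 5810006543210, 5780006543210, 6710000453210, 6530000543021, 6530000540321,
    6180000543210], [6890005643210, 6890005463201, 6830006543210, 6830006542310, 6730006543210,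
    6730006453201, 6760000543210], [6680005643210, 6630006543201, 6430006543210, 6340006543210,
    6330006534210, 6250006543210, 6950000453210, 6720000543210, 6580000543210, 6530000435201],
    [6820005643210, 6820005643201, 6660006543210, 6620006543210, 6620006534210, 6540006543210,
    6950000543210, 6950000543201, 6710000543210, 6710000534210], [6420006543210, 5930006543210,
    6420006543012, 5930006541230, 5930006514230, 5930006154230, 7050000543120, 6510000542310,
    6510000524310, 6510000521340, 6510000254310, 6510000251340, 6510000215340], [4840006543210,
    4840006452301, 4840006452031, 4840006540213, 4240006543210, 4240006452301, 6710000453102,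
    6710000541320, 6180000513402, 6180000513042, 6180000154320, 6180000150324, 5820000543210],
    [6640005643210, 6340005643210, 6330005643120, 6190006541320, 6110006543210, 6000006543210,
    6810000543210, 6580000543210, 6530000453021, 6270000543210], [6010006543210, 5400006543210,
    5040006543210, 5300006543210, 4980006534210, 4980006354210, 6950000431520, 6510000543210,
    6530000423510, 6180000534120, 6530000243510, 6180000354120, 5980000213540], [6020006543210,
    5210006543210, 4910006543210, 5210006521430, 4910006521430, 4850006453210, 6720000542310,
    6530000450231, 6530000423501, 6270000524130, 6810000153420, 5980000354210, 5980000321540],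
    [4610006543210, 4480006543201, 4480006453021, 4190006540321, 3640006543210, 3640006453120,
    6530000450312, 6530000540132, 6270000524310, 6180000534012, 6270000254130, 6180000354102,
    4930000543210], [6840005643210, 6730005643210, 6730005643120, 6730005641320, 6650006543210,
    6610006543210, 6900000543210, 6760000543210, 6760000543120, 6760000541320], [5810005643210,
    5810005643201, 5750005643021, 5750005640321, 5480006502143, 5260006543210, 6180000543210,
    6180000543201, 5980000543021, 5980000540321], [6860006543210, 6480006543210, 6400006543210,
    6400006542310, 6380006543210, 6380006453210, 6900000543210, 6950000524310, 6810000534120,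
    6810000531420, 6950000254310, 6810000354120, 6810000351420], [6160006543210, 5720006543210,
    5720006543120, 5390006543210, 5330006543210, 5330006453210, 6900000543210, 6580000425310,
    6580000425130, 5980000543210, 6580000245310, 6580000245130, 5980000453210], [6410006543210,
    6410006453201, 5920006543210, 5920006542310, 5860006543210, 5860006453201, 6760000543210,
    6950000524301, 6530000435201, 6530000432501, 6950000254310, 6530000345210, 6530000342510],
    [6310006543210, 5740006543210, 5840006543120, 5570006543210, 5460006543210, 5430006453210,
    6760000543210, 6580000534210, 6710000534120, 6270000542130, 6810000354210, 6530000345120,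
    6180000453120], [5310006543210, 5310006543201, 5000006543021, 5000006450321, 4490006543210,
    4490006452310, 6760000541032, 6270000543210, 6270000543201, 5980000540321, 6270000452310,
    6270000452301, 5980000453021], [4410006543210, 4410006534201, 3660006543210, 4410006210543,
    4410006201534, 3660006210543, 6580000531402, 5980000540231, 6580000513420, 5980000504213,
    5980000231540, 5980000213504, 4930000543210], [7040076543210, 6780076543210, 6750076543210,
    6750076542310, 6740076543210, 6740076453210, 6740074653210], [6670076543210, 6060076543210,
    6060076543120, 5880076543210, 5850076543210, 5850076453210, 5850074653210], [6550076543210,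
    5580076543210, 5700076543210, 5580076541230, 5580076514230, 5540076543210, 5540075643210,
    5940006543210], [4890076543210, 4260076543210, 4210076543210, 3500076542310, 3550076534210,
    3370076543210, 3370075643210, 3950006543210], [5280076543210, 4470076543210, 4470076543120,
    3750076543210, 3750076534210, 3620076543210, 3620075643210, 4400006543210], [7020076543210,
    6700076543210, 6700076543120, 6700076521430, 6700076512430, 6690076543210, 6690075643210,
    6790006543210], [6600076543210, 5760076543210, 5670076543210, 5640076543210, 5550076534210,
    5590076543210, 5590075643210, 5970006543210], [5420076543210, 4640076543210, 4640076534120,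
    3780076543210, 3780076534120, 3770076354210, 3770073654210, 4560004365210], [6560076543210,
    5520076543210, 5520076543120, 5440076542310, 5560076215430, 5560076125430, 5490076543210,
    5970002654310, 5970002654130, 5940004652310, 6240003216540, 6240003126540], [5140076543210,
    3700076543210, 3230076543210, 3150076542310, 3230076325410, 3150076235410, 3130076543210,
    4950002654310, 4290003654210, 4420004652310, 4290003426510, 4420004236510], [5180076543210,
    3790076543210, 3470076543210, 3470076542310, 3330076325410, 3330076235410, 3280074653210,
    5030002654310, 5010004653210, 5010004652310, 3950003426510, 3950003246510], [4710076543210,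
    2760076543210, 3200076543210, 2760076541230, 2660076514320, 2500076453210, 2590076543210,
    3840002654310, 4630004653210, 3840002651340, 3710002615430, 3240006453210], [5240076543210,
    4030076543210, 3570076543210, 3410076543210, 3310076534210, 3210076453210, 3360074653210,
    5620003654210, 5150003654210, 4360004653210, 3840004635210, 3710005463210], [6780067543210,
    6570076543210, 6370076543210, 6370076542310, 6320076543210, 6320076453210, 6280074653210],
    [6060067543210, 6260054763201, 5900076543210, 5650076543210, 5470076543210, 5470076453210,
    5500074653210], [5580067543210, 4470065743201, 4670076543210, 4160076542310, 4160076524310,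
    3970076543210, 3830075643210, 4420006543210], [6700067543210, 5910076543210, 5890076543210,
    5870076543210, 5870076534210, 5830076543210, 5770075643210, 5970004365210], [5760067543210,
    5760065734201, 4740076543210, 4620076543210, 4620075634201, 4580076543210, 4580075634201,
    4950006543210], [5910057643210, 5660076543201, 4820076543210, 4750076543210, 4750076534210,
    4650076543210, 4650075643210, 5030006543210], [2660067543210, 2120076253401, 1360076543210,
    2500067530142, 1360076523410, 1220076253410, 1040076543210, 3710002654310, 2180003654210,
    3240006530142, 2180003624510, 2330003264510], [5520067543210, 3850076543210, 3650076543210,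
    3580076542310, 3740076325410, 3740076235410, 3510076543210, 5970002654310, 4400004653210,
    3950004652310, 4290004326510, 4290004236510], [2760067543210, 2700076543201, 2760067453012,
    1700076542310, 1360067514320, 1360067154023, 1230076543210, 3840002654310, 3840002564013,
    3120004652310, 2180003615420, 2180005463201], [5560067543210, 4280076543210, 3870076543210,
    3740067541320, 3740067514320, 3670076453210, 3610076543210, 6240003654210, 4970003654210,
    4290004651320, 4290004615320, 3710006453210], [6750067543210, 6370067543210, 6260076543120,
    6220076543210, 6170076543210, 6170076453210, 6090074653210], [5700067543210, 4670067543210,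
    5700065743012, 4670067541230, 4670067514230, 4550076543210, 4550075643012, 4630006543210],
    [5670067543210, 4740067543210, 4640065743021, 4150076543210, 4080076534210, 4070076543210,
    3960075643210, 4520006543210], [6370057643210, 6370057463201, 5900054763021, 5800076543210,
    5710076543210, 5710076453201, 5680074653210], [5890057643210, 4820067543210, 4820065743120,
    4570076543210, 4570076534210, 4370076543210, 4370075643120, 4560006543210], [4160057643210,
    3750067542301, 3750065742031, 4160057640213, 3390076543210, 3040076543210, 3040075643120,
    3120006542301], [5440067543210, 3580067543210, 3730076543210, 3580067541230, 3670067215430,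
    3670067125430, 3440076543210, 5940004653210, 3950004653210, 3950004651230, 3710006215430,
    3710006125430], [3230067543210, 3150067453201, 2820076543021, 2100076543210, 2050076543210,
    2040076453210, 1810076543210, 4290003654210, 4420004563201, 3060004653210, 2740006543210,
    2180006453120], [3470067543210, 3330067543201, 3270076542031, 2570076543210, 2400076543210,
    2400076453210, 2110076543210, 5010004653210, 3950003654201, 4110004653210, 2610006543210,
    2610006453210], [3570067543210, 3570067534201, 3520076543021, 2390076543210, 2390076534201,
    2260076453210, 2300076543210, 5150003654210, 5150003645201, 3020004653210, 3020004635201,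
    2430006453210], [5880067543210, 5650067543210, 5650067543120, 5380076543210, 4960076543210,
    4960076453210, 4900074653210], [5550067543210, 4620057643201, 4080067543210, 4210065730412,
    3930067534210, 3800076543210, 3720075643210, 3840006543210], [5640067543210, 4620067543210,
    4150067543210, 4260065730421, 3930076543210, 3860076543210, 3760075643210, 4290006541320],
    [5870057643210, 4750067543210, 4570067543210, 4750065721430, 4570065721430, 4270076543210,
    4270075621430, 4360006543210], [6220057643210, 5800057643210, 5650057463021, 5650054760321,
    5370076543210, 5290076453210, 5290074652310], [4150057643210, 4080057643201, 3780067543021,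
    3550065740321, 3160076543210, 2980076543210, 2950075643210, 3020006543120], [3410067543210,
    3310067543201, 2390067543210, 2550076450321, 2000076543210, 1960076453210, 1850076543210,
    4360004653210, 3840004653201, 3020004653210, 2330006540321, 2610005461320], [6740067543210,
    6320067543210, 6170067543210, 6170067542310, 6100076543210, 6080076543210, 6040075643210,
    6240006543210], [5850067543210, 5470067543210, 5470067543120, 4960067543210, 4810076543210,
    4790076543210, 4720075643210, 4970006543210], [6090067543210, 5680067543210, 5470057643021,
    5290067543210, 5060076543210, 5120067453210, 5050075643210, 5150006453120], [6320057643210,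
    6280067543201, 5710067543210, 5710067542310, 5630076543210, 5600076543210, 5530075643210,
    5620006543210], [6170057643210, 5710057643210, 5500067543021, 5370067543210, 5190076543210,
    5120076543210, 5090075643210, 5150006543120], [5290057643210, 5290057643201, 4960057643021,
    4900067540321, 4450076543210, 4430076543210, 4390075643210, 4440006543210], [3930057643210,
    3930056734201, 3160057643210, 3500067520431, 3500065702413, 2810076543210, 2810075634201,
    3060006510432], [6100057643210, 5630057643210, 5190057643210, 5190057642310, 5100076514320,
    4940076543210, 4940075643210, 5010006514320], [5060057643210, 5060057643201, 4810057643021,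
    4450057643210, 4230076504132, 4020076543210, 4020075643210, 4110006514032], [3210067543210,
    3210067345201, 2260067543210, 1960067543210, 2290076401532, 1960067345201, 1670076543210,
    3710005643210, 3710005346201, 2430006543210, 2610005641320, 2610005146302], [1740076543210,
    690076543210, 690075643120, 730076421530, 1740072103654, 690072103654, 690071203564,
    2430006543210, 3020006430521, 3020004630251, 4950006412530, 3840005204613, 3840002504163,
    3840006134520, 2180005246031, 3020005210643, 3840001634250, 2180002546301, 3020002510463,
    2430001026534], [5540067543210, 3970067543210, 4550067543210, 3970067541230, 3970067514230,
    3820076154320, 3690076543210, 5940006543210, 4420006543210, 4630006543210, 4420006541230,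
    4420006514230], [6690067543210, 5830067543210, 5830067543120, 5830067521430, 5830067512430,
    5790076154320, 5730076543210, 6790006543210, 5970004365210, 5970004365120, 5970004321650,
    5970004312650], [5590067543210, 4580067543210, 4070067543210, 3860067543210, 3800067534210,
    3810076354210, 3680076543210, 5970006543210, 4950006543210, 4520006543210, 4290006541320,
    3840006534210], [3830067543210, 3620067543201, 3830067543012, 3040067542310, 3040067524310,
    2800076543210, 2720076543210, 4420005643210, 4400006543201, 4420005643012, 3120006543201,
    3120006534201], [5770067543210, 4650067543210, 4370067543210, 4270067543210, 4270067534210,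
    4060076354210, 3980076543210, 5970003465210, 5030006543210, 4560006543210, 4360006543210,
    4360006534210], [3960067543210, 3960067534201, 3770067354021, 2980067543210, 2980067534201,
    2850076354210, 2780076543210, 4520005643210, 4520005634201, 4560004365021, 3020006543120,
    3020006534102], [3760067543210, 3720067543201, 2950067543210, 3370067530421, 2810067543210,
    2560076543210, 2470076543210, 4290005641320, 3840005643201, 3020005643120, 3950006530421,
    3060006510432], [6040067543210, 5530067543210, 5090067543210, 5090067542310, 4940067543210,
    4880076543210, 4860076543210, 6240005643210, 5620005643210, 5150005643120, 5150005641320,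
    5010006514320], [5050067543210, 5050067543201, 4720067543021, 4390067543210, 4020067543210,
    3940076543210, 3920076543210, 5150004653120, 5150004653102, 4970005643021, 4440005643210,
    4110006514032], [2690076543210, 2990073265401, 1440076543210, 1440076542310, 1370076534210,
    1870073265410, 1870072365410, 4560004365201, 4560004362501, 4110006543210, 5010006524310,
    4400006524301, 4970003265410, 3060004365120, 3060004361520, 2330003246510, 4970002365410,
    3060003465120, 3060003461520, 2330002346510], [5160076543210, 3090076543210, 3090075643120,
    3320076521430, 3320076512430, 2910074265310, 2910072465130, 4560006543210, 5150006532410,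
    5150005632140, 5150006523410, 5150005623140, 5970004165320, 3950004265130, 3840006321540,
    3840006312540, 5970001465230, 3950002465310, 3840003621450, 3840003612450], [2480076543210,
    2480076234501, 1020076543210, 1160076532410, 1160076423501, 1020076234501, 950073465210,
    4520006534201, 5150006432501, 3020005642130, 5150006523410, 3120006524301, 4520006243510,
    3060004365210, 3120006342510, 3020005124603, 4290002465310, 4290002356401, 2180004632510,
    2180004523601], [5070076543210, 3030076543210, 3030076543120, 2930076542310, 3030073216540,
    3030073126540, 2930072316540, 4970006543210, 6240006541320, 4520006524310, 4520006524130,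
    4420006512430, 4520006254310, 4520006254130, 4420006152430, 4970003216540, 6240001326540,
    4420002436510, 4420002436150, 3240004652310], [2380076543210, 1150076543210, 2380076453012,
    1150076541230, 980075614320, 980075164023, 910075643210, 5620006543120, 4440006541302,
    3020005614302, 4420006514032, 3020005610342, 4420006154230, 3020005164203, 3020005160243,
    2330003216450, 3710001625430, 2740004653201, 3710001265034, 2740004650231], [3190076543210,
    3190075634201, 2190076543210, 1770076543210, 1770075634201, 1580076453210, 1580074635201,
    5150006541302, 4440006543120, 5150005614320, 4440005634102, 3060006510432, 4360006354210,
    4290006154302, 3020006354012, 2610005416302, 4290001645320, 4360003645201, 3020003645021,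
    2610004561320], [2860076543210, 1860076543210, 1860076543120, 1610076521430, 2860072103654,
    1860072103654, 1860071203654, 4110006510432, 4110006510342, 5030006512430, 3950006503412,
    3950006503142, 3950004123650, 2610005146302, 2610005146032, 4110004320651, 3950001423650,
    2610001546302, 2610001546032, 4110003420651], [7070876543210, 6980876543210, 6980876543120,
    6970876543210, 6970876534210, 6970876354210, 6970873654210, 6970837654210], [6910876543210,
    6360876543210, 6360876543120, 6290876542310, 6350876543210, 6350876453210, 6350874653210,
    6350847653210], [6150876543210, 4690876543210, 4350876543210, 4350876542310, 4460876524310,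
    4460876254310, 4460872654310, 4460827654310], [6130876543210, 4380876543210, 4380876534120,
    4170876542310, 4170876524130, 4320876354210, 4320873654210, 4320837654210], [4220876543210,
    2940876543210, 1950876543210, 1950876542310, 1890876534210, 1910876254310, 1910872654310,
    1910827654310], [3990876543210, 1980876543210, 2970876543210, 2020876543210, 2020876534210,
    1820876354210, 1820873654210, 1820837654210], [4120876543210, 1660876543210, 1660876534120,
    1350876452310, 1350876425130, 1300876453210, 1510873654210, 1510837654210, 2880043765210],
    [1260876543210, 350876543210, 350875634120, 230876452310, 230874625130, 200876453210,
    200874635120, 120837654210, 1470027654310, 1470026745130, 830037562410, 830035726140,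
    450037465210, 450034756120], [6980786543210, 6520876543210, 6500876543210, 6490876543210,
    6490876534210, 6490876354210, 6490873654210, 6450837654210], [6360786543210, 4920876543210,
    4870876543210, 4730876542310, 4800876543210, 4800876453210, 4800874653210, 4680847653210],
    [4690786543210, 5340548763201, 3600876543210, 3600876542310, 3430876524310, 3430876254310,
    3430872654310, 3480847653210], [4380786543210, 2620876543210, 1990876543210, 1840876542310,
    1790876534210, 1940876354210, 1940873654210, 1720857643210], [1660786543210, 1660768452301,
    640876543210, 640867452301, 510876534210, 510867352401, 430873654210, 430837562401,
    860043765210], [6520687543210, 5960876543210, 5610876543210, 5510876543210, 5510876534210,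
    5510876354210, 5450873654210, 5450837654210], [6470687543210, 5340876543210, 5360876543210,
    5360876542310, 5270876543210, 5270876453210, 5170874653210, 5170847653210], [4920687543210,
    4920654872301, 3400876543210, 3400854762301, 3220876543210, 3220876453210, 3220854762301,
    3220845762301], [4780687543210, 2940765843201, 2670876543210, 2670876542310, 2530876534210,
    2510876543210, 2360875643210, 2360857643210], [1920687543210, 1420876543201, 650876543210,
    650876452310, 540876534210, 540876352410, 440874653210, 440847653210, 1030054763210],
    [6290786543210, 4730786543210, 4760876543210, 4730786541230, 4700876543210, 4700876453210,
    4700874653210, 4600847653210], [4350786543210, 3600786543210, 3420876543210, 2790876543210,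
    2450876543210, 2450876453210, 2450874653210, 2410847653210], [4460786543210, 3430786543210,
    2280876543210, 2450786532410, 2450786523410, 2210876354210, 2210873654210, 2080857643210],
    [4170786543210, 1840786543210, 2150876543210, 1790786541320, 1540876534210, 1640876543210,
    1640875643210, 1400857643210], [1350786543210, 640687543201, 1350768534012, 510786451320,
    510768415023, 470876453210, 290874653210, 290847635012, 450051672430], [6500687543210,
    5610786543210, 5610768543120, 5410876543210, 5410876534210, 5410876354210, 5320873654210,
    5320837654120], [4730687543210, 3400584763201, 3290876543210, 2830786542310, 2680876543210,
    2680876453210, 2520874653210, 2540847653210], [4870687543210, 3400786543210, 3400768543120,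
    2830876543210, 2770876543210, 2770876453210, 2640874653210, 2640847653120], [1990687543210,
    1840685743201, 1840658734021, 740876543210, 740867534120, 680876354210, 660875643210,
    660857634120], [5610587643210, 5610584376201, 4830876543210, 4310876543210, 4310876534210,
    4310874365201, 4310873465201, 4250837654210], [5360587643210, 3600685473201, 4050658742130,
    3630876543210, 3450876543210, 3340876453210, 3340874653210, 3380847653210], [2670587643210,
    1950786543201, 2370658734021, 1210876543210, 1190876534210, 940876543210, 940875643210,
    960857643210], [4760687543210, 3290687543210, 4760654873012, 3290687541230, 3070876543210,
    3070876453210, 3070854763012, 3070845763012], [2960587643210, 2280687543201, 1980765843012,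
    1730687532410, 1730687523410, 1100876543210, 1080875643210, 1080857643210], [6970786543210,
    6490786543210, 6490786543120, 6470876541320, 6460876543210, 6460876453210, 6460874653210,
    6440847653210], [6450786543210, 5450786543210, 5320786543210, 5110876543210, 5230786534210,
    5230786354210, 5230783654210, 5080847653210], [4320786543210, 1940786543210, 1940786453120,
    1920876541320, 1640786425310, 1640786245130, 1830874653210, 1550867543210, 2320054763210],
    [6490687543210, 5510786543210, 5410786543210, 5360768541320, 5350876543210, 5350876453210,
    5230874653210, 5200847653210], [1790687543210, 1790685723401, 740687543120, 1540658740132,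
    740685713402, 630876543210, 630875623401, 600857643210], [5510587643210, 5450685473201,
    4310786543210, 4050876543210, 4010876543210, 4000876453210, 4000874653210, 3890847653210],
    [2530587643210, 1890786543201, 1190786543210, 2220658730142, 1190786523410, 900876543210,
    900875643210, 920857643210], [1940687543210, 1720786425301, 680786543210, 650768541320,
    660786425301, 630786345210, 520876543210, 480867543210, 560076543210], [5320687543210,
    4310487653201, 4250786543120, 3530876543210, 3560786534210, 3560786354210, 3490874653210,
    3460847653210], [5410587643210, 4310687543210, 4310685743120, 3630658741320, 3590876543210,
    3560876453210, 3560874653120, 3540847653210], [2830587643210, 2830578462301, 2830574862031,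
    2830547680213, 1530876543210, 1530867452301, 1530864752031, 1530846570213], [3630487653210,
    2790687543201, 3530564872031, 3530546870231, 2230876543210, 2230876453210, 2340874653210,
    2340847652310], [5110687543210, 4050487653201, 3530687543210, 3420654870312, 3250876543210,
    3250876453210, 3100874653210, 3100847653210], [1510786543210, 430786543210, 430786453120,
    360876541320, 290785624310, 290785264130, 270875643210, 140876543210, 2880047653210,
    860047653210, 860047563120, 450057641230, 450057461320, 400075643210], [6350786543210,
    4800786543210, 4800786543120, 4700786542310, 4780876514320, 4770876543210, 4770875643210,
    4660857643210], [4680786543210, 3220587642301, 2640786543210, 2520786542310, 2370876524310,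
    2460786453210, 2460784653210, 2240857643210], [4600786543210, 2540786543210, 3070587643012,
    2540786541230, 2220876543210, 2350786453210, 2350784653210, 2160857643210], [6440786543210,
    5200786543210, 5200786543120, 5170786541320, 5020876543210, 5130786453210, 5130784653210,
    4990857643210], [5080786543210, 3890587643201, 3460786543210, 3100786543210, 3010876543210,
    3170786354210, 3170783654210, 3000857643210], [1300786543210, 510687532401, 510687235041,
    510678410523, 1300768201534, 510678014253, 270783654210, 270738201645, 400073654210],
    [4800687543210, 3220786543210, 2770786543210, 2680786542310, 2670768514320, 2630876543210,
    2460875643210, 2420857643210], [5170687543210, 3430685724301, 3340786543210, 3340786542310,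
    2960876524310, 3080786453210, 2920875643210, 2900857643210], [5200687543210, 3890786543210,
    3540786543210, 3340687541320, 3140876543210, 3300786453210, 3180784653210, 3110857643210],
    [5270587643210, 3480786543201, 3450786543210, 3450786542310, 3260876524310, 3080876543210,
    3080875643210, 3050857643210], [3380587643210, 2410786543201, 3250587642031, 2340786543210,
    1930876543210, 1750786453210, 1750784653210, 1710857643210], [4700687543210, 2680687543210,
    3070786543210, 2680687541230, 2530768514320, 2490876543210, 2350875643210, 2310857643210],
    [2640687543210, 2680587643201, 2540685743021, 1530687542301, 1190658714302, 1120786453210,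
    1130875643210, 1050857643210], [2770587643210, 2520687543201, 2520685743021, 1530786543210,
    1210658714320, 1120876543210, 1120875643120, 1070857643210], [3340587643210, 2450687543201,
    3100685742031, 2230786543210, 1730876543210, 1650876543210, 1750875643210, 1600857643210],
    [3540587643210, 3460687543201, 3460685743021, 2230587641320, 2130876543210, 2170786453210,
    2170784653120, 2070857643210], [6460687543210, 5350687543210, 5350687543120, 5270786541320,
    5270768514320, 5250876543210, 5130875643210, 5130857634210], [5230687543210, 4000687543210,
    3560687543210, 3380786541320, 3250768534210, 3350786453210, 3180875643210, 3170857643210],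
    [5350587643210, 4010687543210, 3590687543210, 3450685741320, 3450658714320, 3350876543210,
    3300875643210, 3300857634210], [3560587643210, 3560578634201, 3490687543021, 2340685741320,
    2340658714302, 2250876543210, 2170875643210, 2170857634201], [5020687543210, 3140687543210,
    3140687543120, 2960687521430, 2970765801432, 2890876543210, 2750875643210, 2750857643210],
    [3140587643210, 3010687543201, 2130687543210, 1730587641320, 2020765801432, 1520876543210,
    1380875643210, 1380857643210], [4660786543210, 2420786543210, 2420786543120, 2310786542310,
    2360786514320, 2140876543210, 2270785643210, 2090867543210, 2320072615430], [4990786543210,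
    3110786543210, 3110786543120, 2900786541320, 2750786543210, 2730876543210, 2840784653210,
    2710867543210, 2880062751430], [2360687543210, 1910786254301, 940786543210, 940786542310,
    900786534210, 760876254310, 720876543210, 700867543210, 890076543210], [2420687543210,
    2240786542301, 1070786543210, 1050786542301, 940687514320, 820876543210, 840785643210,
    770867543210, 860075624310], [2900687543210, 2080786524301, 1600786543210, 1600786542310,
    1080786524310, 990876543210, 1010785643210, 970867543210, 1030073625401], [3110687543210,
    3000786543201, 2070786543210, 1600687541320, 1380786543210, 1330876543210, 1430784653210,
    1290867543210, 1470064753210], [1640687543210, 660687543201, 1400786534012, 630687541320,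
    600786514023, 540768154320, 370876543210, 330867543210, 450067251430], [2310687543210,
    1050687543201, 2160786543012, 1050687540231, 900687514320, 790876543210, 800785643210,
    750867543210, 830075643210], [4770687543210, 2630687543210, 2630687543120, 2490687542310,
    2510786514320, 2510768154320, 2270876543210, 2270867453210, 2320076215430], [2460687543210,
    2460678452301, 1120687543210, 1120678452301, 960786514320, 960768153402, 840876543210,
    840867452301, 860076524310], [2920687543210, 2210687325401, 1650687543210, 1650687542310,
    1100786524310, 1100768254310, 1010876543210, 1010867453210, 1030076325401], [2350687543210,
    1130687543201, 2350678453012, 1130687540231, 920786514320, 920768154023, 800876543210,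
    800867453012, 830076543210], [5130687543210, 3300687543210, 3300687543120, 3080687541320,
    3050786514320, 2890768453210, 2870876543210, 2840867543210, 2880076521430], [3180687543210,
    3170687534201, 2170687543210, 1750678451320, 1710786514302, 1520768453210, 1450876543210,
    1430867543210, 1470076543210], [2750687543210, 1380687543210, 1380687543120, 1080687521430,
    1820786301542, 930876543210, 880876543210, 870867543210, 1000076543210], [2140687543210,
    820687543210, 820687543120, 790687542310, 760687215430, 1280876015432, 620876543210,
    620867543210, 1000021037654], [2730687543210, 1330687543210, 1330687543120, 990687541320,
    930687543210, 1460876012543, 850876543210, 850867543210, 1180076543210], [1550786543210,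
    480786543210, 480786453120, 440784651320, 330786425310, 330786245130, 240874653210,
    150876543210, 2320045763210, 560067543210, 560067453120, 1030054761320, 450076542130,
    450076452310], [2090786543210, 770786543210, 770786543120, 750786542310, 700786514320,
    620786543210, 550876543210, 500876543210, 2320027615430, 860057624310, 860057624130,
    830057642310, 890067514320, 1000021037654], [2710786543210, 1290786543210, 1290786543120,
    970786541320, 870786543210, 850786543210, 810876543210, 780876543210, 2880026751430,
    1470046753210, 1470046753120, 1030037620541, 1000067543210, 1180076543210], [60876543210,
    60867452301, 60864725031, 60846270513, 60842607153, 60824061735, 60820416375, 60802143657,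
    1470076543102, 1470067451320, 860076521043, 1470064715230, 860075612403, 560076310425,
    860057164230, 1470046172503, 560067134052, 860043105276, 860051746320, 560061743502,
    1470041627053, 860041350726, 1470021043657, 560016475320, 860015473602, 860014537062,
    1470014260735, 1470012406375], [7099876543210, 7069876543210, 7069876543120, 7069876541320,
    7069876514320, 7069876154320, 7069871654320, 7069817654320, 7069187654320], [7068976543210,
    6889876543210, 6879876543210, 6879876542310, 6879876524310, 6879876254310, 6879872654310,
    6879827654310, 6859287654310], [6887986543210, 6239876543210, 6219876543210, 6219876542310,
    6219876524310, 6219876254310, 6219872654310, 6149827654310, 6149287654310], [6236987543210,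
    5229876543210, 4599876543210, 4599876542310, 4599876524310, 4599876254310, 4509872654310,
    4509827654310, 4509287654310], [6858976543210, 6148976543210, 6059876543210, 6128976542310,
    6128976524310, 6128976254310, 6128972654310, 6128927654310, 6039387654210], [6877986543210,
    6218976543210, 6218796543120, 6209876543210, 6209876534210, 6209876354210, 6209873654210,
    6129837654210, 6129387654120], [6147986543210, 4508976543210, 4209876543210, 4348976542310,
    4348976524310, 4348976254310, 4348972654310, 4189837654210, 4149387654210], [6216987543210,
    4598976543210, 4549876543210, 4539876543210, 4539876534210, 4539876354210, 4349873654210,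
    4349837654210, 4339387654210], [4595987643210, 4506954387201, 2659876543210, 2609876543210,
    2609876534210, 2589876354210, 2589873654210, 2589837654210, 2449387654210], [6057986543210,
    4207986543210, 4049876543210, 4139876543210, 4139876534210, 4139876354210, 4139873654210,
    3919837654210, 3919387654210], [4206987543210, 2654983765201, 2209876543210, 1769876543210,
    1769876534210, 1769876354210, 1569873654210, 1509837654210, 1509387654210], [4545987643210,
    2657986543210, 2657659843120, 2069876543210, 2069876534210, 1979876354210, 1979873654210,
    1979638754120, 1979368754120], [4046987543210, 2206987543210, 4046543987012, 2019876543210,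
    2019876534210, 2019876354210, 2019543876012, 2019534876012, 2019354876012], [6038976543210,
    4148976543210, 3918976543210, 3909876543210, 4098976524310, 4098976254310, 4098972654310,
    4098927654310, 3889487653210], [4147986543210, 2445948763201, 1508976543210, 1399876543210,
    1628976524310, 1628976254310, 1628972654310, 1418937654210, 1349487653210], [4336987543210,
    2448976543210, 1976987543120, 1689876543210, 1888976534210, 1888976354210, 1638973654210,
    1638937654210, 1599487653210], [6127986543210, 4347986543210, 4338976543120, 4138796542310,
    4308976534210, 4308976354210, 4308973654210, 4109847653210, 4099487653210], [4187986543210,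
    2604987653201, 1568976543210, 1568796542310, 1697986524310, 1697986254310, 1697982654310,
    1419847653210, 1419487652310], [3917986543210, 1507986543210, 2015948763012, 1209876543210,
    1328976534210, 1328976354210, 1328973654210, 1179847653210, 1149487653210], [6206987543210,
    4537986543210, 4537968543120, 4537698541320, 4519876543210, 4519876453210, 4309874653210,
    4309847653120, 4309487651320], [4346987543210, 2587986543210, 1978976543210, 1768796542310,
    1908976534210, 1908976354210, 1699874653210, 1639847653210, 1629487653210], [4535987643210,
    2607986543210, 2068976543210, 2068796542310, 2039876543210, 1909876453210, 1909874653210,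
    1889847653210, 1889487652310], [4136987543210, 1766987543210, 2018976543210, 1687698541320,
    1579876543210, 1579876453210, 1329874653210, 1329847653210, 1319487653210], [1975987643210,
    1765987463201, 1506954873021, 679876543210, 618976534210, 599876453210, 589874653210,
    589847653210, 539487653210], [2064987653210, 1566987543201, 1566954873021, 719876543210,
    619876543210, 619876453210, 619854763120, 619845763120, 579487653210], [3907986543210,
    1397986543210, 1207986543210, 1809876543210, 1277986524310, 1277986254310, 1277982654310,
    1119847653210, 1119487653210], [1685987643210, 1396985473201, 675987643120, 1206549870132,
    469876543210, 429876453210, 429874653210, 419847653210, 419487653210], [3888976543210,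
    1348976543210, 1148976543210, 1118976543210, 1099876543210, 1248976254310, 1248972654310,
    1248927654310, 1069587643210], [1596987543210, 1347965843201, 536987543120, 418976543210,
    329876543210, 318976354210, 288973654210, 288937654210, 229587643210], [4097986543210,
    1627986543210, 1598976543120, 1327986542310, 1279876543210, 1488976354210, 1488973654210,
    1258947653210, 1249587643210], [1316987543210, 535987643201, 1147965843012, 426987541320,
    269876543210, 218976453210, 198974653210, 198947653210, 169587643210], [4107986543210,
    1637986543210, 1637896534120, 1318976542310, 1318796524130, 1497986354210, 1497983654210,
    1259857643210, 1259587634120], [1636987543210, 1626985742301, 587986543210, 538975642301,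
    428796534210, 397986354210, 388974653210, 309857643210, 289587643210], [1885987643210,
    1417986543201, 615987643120, 578976542310, 468796534210, 398976453210, 398974653210,
    349857643210, 319587643210], [4306987543210, 1906987543210, 1887986543120, 1887968541320,
    1577698524310, 1788976453210, 1499875643210, 1499857642310, 1489587643210], [1326987543210,
    585987643201, 1326895734012, 417968541320, 417695814023, 258976453210, 258794635012,
    199857643210, 199586734012], [4515987643210, 2036987543210, 2036985743120, 2036958741320,
    2036598714320, 1789876543210, 1789875643120, 1789857641320, 1789587614320], [1905987643210,
    1696798524301, 617986543210, 617968542310, 597698524301, 499876543210, 399875643210,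
    399857642310, 389587624301], [1575987643210, 595987643201, 1177986543012, 466958741320,
    466598714320, 259876543210, 259875643210, 219857643210, 219587634210], [1097986543210,
    325987643201, 265987643012, 325769810234, 1097659801234, 117986254310, 117982654310,
    117629801345, 117269801345], [1276987543210, 425879632401, 327986543120, 415769810423,
    1117659801423, 187986354210, 139875643210, 179857643210, 179587643210], [1068976543210,
    226987543201, 166987543012, 136987520134, 116798201345, 79876543210, 38972654310,
    38927654310, 29687543210], [1247986543210, 286987542301, 228976543120, 196987530412,
    178976543210, 119876543210, 88973654210, 48947653210, 39687543210], [1486987543210,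
    386987524301, 317986543120, 317968541320, 256987524310, 189876543210, 98975643210,
    98957642310, 89687543210], [1257986543210, 307986543210, 287986534120, 197896452310,
    168976524130, 138796453210, 97983654210, 59867543210, 49687543210], [1496987543210,
    396987543210, 396897453120, 347986541320, 217968524310, 217698254130, 109876543210,
    99867543210, 99687453120], [57986543210, 47986452301, 47894625031, 37986250413, 37892605143,
    28976051423, 28790615243, 9876543210, 9785634120, 10876543210]]
  | _ => []

lemma exhausts_graphCodes : Exhausts (graphCodes 9) 9 := by
  have h₁ : Exhausts (graphCodes 1) 1 :=
    exhausts_zero.succ (C := extensionCertificates 0) (by decide +kernel)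
  have h₂ : Exhausts (graphCodes 2) 2 := h₁.succ (C := extensionCertificates 1) (by decide +kernel)
  have h₃ : Exhausts (graphCodes 3) 3 := h₂.succ (C := extensionCertificates 2) (by decide +kernel)
  have h₄ : Exhausts (graphCodes 4) 4 := h₃.succ (C := extensionCertificates 3) (by decide +kernel)
  have h₅ : Exhausts (graphCodes 5) 5 := h₄.succ (C := extensionCertificates 4) (by decide +kernel)
  have h₆ : Exhausts (graphCodes 6) 6 := h₅.succ (C := extensionCertificates 5) (by decide +kernel)
  have h₇ : Exhausts (graphCodes 7) 7 := h₆.succ (C := extensionCertificates 6) (by decide +kernel)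
  have h₈ : Exhausts (graphCodes 8) 8 := h₇.succ (C := extensionCertificates 7) (by decide +kernel)
  exact h₈.succ (C := extensionCertificates 8) (by decide +kernel)

lemma length_graphCodes : (graphCodes 9).length = 710 := by decide +kernel

lemma isConnectedWithEdges_of_mem_graphCodes {g : ℕ × ℕ} (hg : g ∈ graphCodes 9) :
    isConnectedWithEdges 9 g.1 g.2 = true := by
  have h : ((graphCodes 9).all fun g => isConnectedWithEdges 9 g.1 g.2) = true := by
    decide +kernel
  exact List.all_eq_true.mp h g hg

/-- Whether the values of `f` on `l` are strictly increasing and larger than `x`. -/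
def increases {α : Type} (f : α → ℕ) (l : List α) : ℕ → Bool :=
  List.rec (fun _ => true) (fun a _ ih x => force (f a) fun y => x.blt y && ih y) l

lemma pairwise_of_increases {α : Type} {f : α → ℕ} {l : List α} {x : ℕ}
    (h : increases f l x = true) : (∀ a ∈ l, x < f a) ∧ l.Pairwise (f · < f ·) := by
  induction l generalizing x with
  | nil => simp
  | cons a l ih =>
    change force (f a) (fun y => x.blt y && increases f l y) = true at h
    rw [force_eq, Bool.and_eq_true, Nat.blt_eq] at h
    obtain ⟨h₁, h₂⟩ := ih h.2
    refine ⟨?_, List.pairwise_cons.mpr ⟨h₁, h₂⟩⟩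
    intro b hb
    rcases List.mem_cons.mp hb with rfl | hb
    exacts [h.1, h.1.trans (h₁ b hb)]

lemma pairwise_invariant_graphCodes :
    (graphCodes 9).Pairwise fun g h => invariant (graph g) < invariant (graph h) := by
  have h : increases (fun g => codeInvariant g.1 g.2) (graphCodes 9) 0 = true := by
    decide +kernel
  simpa only [codeInvariant_eq] using (pairwise_of_increases h).2

/-- The graph with code `g`, as a graphlet. -/
def graphlet {g : ℕ × ℕ} (hg : g ∈ graphCodes 9) : Graphlet 9 :=
  have h := isConnectedWithEdges_of_mem_graphCodes hg
  have hconn : (graph g).Connected := connected_of_isConnectedWithEdges h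
  have hcard : (graph g).edgeSet.ncard = 9 := ncard_edgeSet_of_isConnectedWithEdges h
  ⟨⟨g.1, graph g⟩, hconn, by
    obtain ⟨⟨x, y⟩, hxy⟩ : (graph g).edgeSet.Nonempty :=
      Set.nonempty_of_ncard_ne_zero (by omega)
    have : Nontrivial (Fin g.1) := ⟨x, y, (graph g).ne_of_adj hxy⟩
    exact hconn.preconnected.exists_adj_of_nontrivial, hcard⟩

end GraphletCount

open GraphletCount in
/-- The number of isomorphism classes of finite connected simple graphs with no
isolated vertices having exactly 9 edges is 710. -/
theorem graphlet_count_9 :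
    Nat.card (Quot (@graphletIso 9)) = 710 := by
  let f (i : Fin (graphCodes 9).length) : Quot (@graphletIso 9) :=
    Quot.mk _ (graphlet (List.getElem_mem i.2))
  let inv : Quot (@graphletIso 9) → ℕ :=
    Quot.lift (fun G => invariant G.1.2) fun _ _ ⟨φ⟩ => invariant_eq_of_iso φ
  have hf : Function.Bijective f := by
    constructor
    · intro i j hij
      have h : invariant (graph (graphCodes 9)[i]) = invariant (graph (graphCodes 9)[j]) :=
        congrArg inv hij
      have hlt := List.pairwise_iff_getElem.mp pairwise_invariant_graphCodes
      by_contra hne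
      rcases lt_or_gt_of_ne hne with hl | hl
      · exact (hlt i j i.2 j.2 hl).ne h
      · exact (hlt j i j.2 i.2 hl).ne' h
    · rintro ⟨G⟩
      obtain ⟨g, hg, ⟨φ⟩⟩ := exhausts_graphCodes _ G.1.2 G.2.1 G.2.2.2
      obtain ⟨i, hi, rfl⟩ := List.mem_iff_getElem.mp hg
      exact ⟨⟨i, hi⟩, Quot.sound ⟨φ.symm⟩⟩
  rw [← Nat.card_congr (Equiv.ofBijective f hf), Nat.card_eq_fintype_card, Fintype.card_fin,
    length_graphCodes]
end

section
/- The number of isomorphism classes of finite connected simple graphs with no isolated vertices having exactly 10 edges is 2322. -/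
/-!
### Enumeration of connected graphs by number of edges

The classes of connected graphs with `k + 1` edges are produced from those with `k` edges by
attaching pendant vertices or by joining two vertices.  The functions below are evaluated by the
kernel, so they are written with recursors, raw literals and continuations (`force x k` evaluates
`x` before passing it on to `k`).

Vertex `v` is represented by the bit position `80 * (v + 1)`.  A colouring of the vertices is
packed into one natural number whose digit in base `2 ^ 80` at that position is the colour of `v`;
the lowest digit does not carry information and only serves to keep the numbers in play distinct
in their low bits.
-/

namespace GraphletEnum

/-- A list of edges between vertices given by their bit positions. -/
inductive EdgeList
  | nil
  | cons (u v : ℕ) (E : EdgeList)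

/-- Binary trees of graphs: a node stores an isomorphism invariant, the number of vertices, the
edges, a packed relabelling of the vertices and the code of the relabelled graph. -/
inductive Tree
  | leaf
  | node (l : Tree) (key n : ℕ) (E : EdgeList) (P code : ℕ) (r : Tree)

section Algorithm

variable {α : Type}

noncomputable section

/-- Evaluate `x` to a literal and pass it on to `k`. -/
def force {α : Type} (x : ℕ) (k : ℕ → α) : α :=
  Nat.rec (k (nat_lit 0)) (fun n _ => k (Nat.succ n)) x

/-- Boolean case distinction by the raw recursor. -/
def cond' {α : Type} (b : Bool) (x y : α) : α := Bool.rec y x b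

/-- The base `2 ^ 80` digit at bit position `p`. -/
def dig (C p : ℕ) : ℕ := Nat.land (Nat.shiftRight C p) (nat_lit 1208925819614629174706175)

/-- Add to the colour of every vertex the squares of the colours of its neighbours. -/
def step (E : EdgeList) (C : ℕ) : ℕ :=
  EdgeList.rec C (fun u v _ ih =>
    Nat.add (Nat.shiftLeft (Nat.pow (dig C u) (nat_lit 2)) v)
      (Nat.add (Nat.shiftLeft (Nat.pow (dig C v) (nat_lit 2)) u) ih)) E

/-- Three refinement steps. -/
def three (E : EdgeList) (C : ℕ) (k : ℕ → α) : α :=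
  force (step E C) fun C => force (step E C) fun C => force (step E C) k

/-- The constant colouring `1` of `n` vertices, with lowest digit `s`. -/
def ones (s n : ℕ) : ℕ :=
  Nat.add s (Nat.shiftLeft (Nat.div (Nat.shiftLeft (nat_lit 1) (Nat.mul (nat_lit 80) n))
    (nat_lit 1208925819614629174706175)) (nat_lit 80))

/-- A hash of the sum of all colours. -/
def read (C : ℕ) : ℕ :=
  Nat.mod (Nat.mul (Nat.mod (Nat.shiftRight C (nat_lit 80)) (nat_lit 1208925819614629174706175))
    (nat_lit 748572847584758473857)) (nat_lit 2305843009213693951)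

/-- The list of the bit positions of `n` vertices. -/
def range (n : ℕ) (k : List ℕ → α) : α :=
  Nat.rec (fun k => k List.nil) (fun v ih k =>
    ih fun L => force (Nat.mul (nat_lit 80) (Nat.succ v)) fun p => k (List.cons p L)) n k

/-- The secondary invariant: the sum over all vertices `p` of the squared hash of the refinement
of the colouring that distinguishes `p`. -/
def inv₂ (s n : ℕ) (E : EdgeList) : ℕ :=
  range n fun V => List.rec (nat_lit 0) (fun p _ ih =>
    Nat.add (Nat.pow (force (step E (Nat.add (ones s n) (Nat.shiftLeft (nat_lit 1) p)))
      fun C => three E C read) (nat_lit 2)) ih) V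

/-- Truncated colours. -/
def keys (s C : ℕ) (V : List ℕ) : ℕ :=
  List.rec s (fun p _ ih =>
    Nat.add (Nat.shiftLeft (Nat.land (Nat.shiftRight C p) (nat_lit 8191)) p) ih) V

/-- The packed adjacency matrix. -/
def rows (s : ℕ) (E : EdgeList) : ℕ :=
  EdgeList.rec s (fun u v _ ih =>
    Nat.add (Nat.shiftLeft (nat_lit 1) (Nat.add (Nat.mul (nat_lit 16) u) v))
      (Nat.add (Nat.shiftLeft (nat_lit 1) (Nat.add (Nat.mul (nat_lit 16) v) u)) ih)) E

/-- The row of `v` in the packed adjacency matrix. -/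
def row (A v : ℕ) : ℕ :=
  Nat.mod (Nat.shiftRight A (Nat.mul (nat_lit 16) v)) (Nat.shiftLeft (nat_lit 1) (nat_lit 1280))

/-- Split off an element of a list with maximal priority; `v` is the best candidate so far. -/
def pull (K : ℕ) (k : ℕ → List ℕ → α) (R : List ℕ) : ℕ → List ℕ → α :=
  List.rec (fun v acc => k v acc) (fun w _ ih v acc =>
    cond' (Nat.ble (dig K w) (dig K v)) (ih v (List.cons w acc)) (ih w (List.cons v acc))) R

/-- `pull` on a nonempty list, `z` on the empty one. -/
def pull₁ (K : ℕ) (k : ℕ → List ℕ → α) (R : List ℕ) (z : α) : α :=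
  List.rec z (fun w R _ => pull K k R w List.nil) R

/-- Greedy relabelling: number the vertices by decreasing priority, where a numbered vertex
raises the priorities of its neighbours. -/
def place (A : ℕ) (V : List ℕ) : ℕ → ℕ → List ℕ → ℕ → ℕ :=
  List.rec (fun _ _ _ P => P) (fun _ _ ih i K R P =>
    pull₁ K (fun v R' =>
      force (Nat.add (Nat.add K v) (Nat.shiftLeft (row A v) i)) fun K' =>
      force (Nat.add (Nat.add P (Nat.mul v i))
        (Nat.shiftLeft (Nat.sub (nat_lit 25) i) v)) fun P' =>
      force (Nat.succ i) fun i => ih i K' R' P') R P) V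

/-- The label of the vertex at position `v` under the packed relabelling `P`. -/
def nib (P v : ℕ) : ℕ := Nat.land (Nat.shiftRight P v) (nat_lit 15)

/-- The adjacency matrix of the relabelled graph as a bit set. -/
def enc (P : ℕ) (E : EdgeList) : ℕ :=
  EdgeList.rec (nat_lit 0) (fun u v _ ih => Nat.lor
    (Nat.lor (Nat.shiftLeft (nat_lit 1) (Nat.add (Nat.mul (nat_lit 16) (nib P u)) (nib P v)))
      (Nat.shiftLeft (nat_lit 1) (Nat.add (Nat.mul (nat_lit 16) (nib P v)) (nib P u)))) ih) E

/-- Whether `P` is a bijective relabelling of `n` vertices. -/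
def valid (n P : ℕ) : Bool :=
  range n fun V => Nat.beq
    (List.rec (nat_lit 1) (fun v _ ih => Nat.lor (Nat.shiftLeft (nat_lit 2) (nib P v)) ih) V)
    (Nat.pred (Nat.shiftLeft (nat_lit 2) n))

/-- The vertices of maximal priority. -/
def maxes (K : ℕ) (V : List ℕ) (k : List ℕ → α) : ℕ → List ℕ → α :=
  List.rec (fun _ acc => k acc) (fun v _ ih x acc => force (dig K v) fun y =>
    cond' (Nat.ble x y)
      (cond' (Nat.ble y x) (ih x (List.cons v acc)) (ih y (List.cons v List.nil)))
      (ih x acc)) V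

/-- The relabelling of minimal code among those starting at one of the given vertices. -/
def best (V : List ℕ) (n : ℕ) (E : EdgeList) (K A : ℕ) (k : ℕ → α) (L : List ℕ) : ℕ → ℕ → α :=
  List.rec (fun P _ => k P) (fun v _ ih P c =>
    force (place A V (Nat.sub (nat_lit 26) n) (Nat.add K (Nat.shiftLeft (nat_lit 2147483648) v)) V
      (dig K (nat_lit 0))) fun P' =>
    force (enc P' E) fun c' => cond' (Nat.ble c c') (ih P c) (ih P' c')) L

/-- A heuristically canonical relabelling.  It is verified whenever it is used, so nothing has to
be proved about it. -/
def canon (s : ℕ) (V : List ℕ) (n : ℕ) (E : EdgeList) (C : ℕ) (k : ℕ → α) : α :=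
  force (keys s C V) fun K => force (rows s E) fun A =>
    maxes K V (fun L => best V n E K A k L (nat_lit 0)
      (Nat.shiftLeft (nat_lit 1) (nat_lit 256))) (nat_lit 0) List.nil

/-- Comparison of graphs by their invariants. -/
def lexle (i n : ℕ) (E : EdgeList) (j m : ℕ) (F : EdgeList) : Bool :=
  cond' (Nat.beq i j) (Nat.ble (inv₂ i n E) (inv₂ j m F)) (Nat.ble i j)

/-- Whether two relabelled graphs are certified to be isomorphic. -/
def same (n P c m Q d : ℕ) : Bool :=
  cond' (Nat.beq c d) (cond' (Nat.beq n m) (cond' (valid n P) (valid m Q) false) false) false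

/-- Insert a graph into a search tree, unless the tree contains a relabelled copy. -/
def insert (i n : ℕ) (E : EdgeList) (P c : ℕ) (t : Tree) : (Tree → α) → α :=
  Tree.rec (fun k => k (Tree.node Tree.leaf i n E P c Tree.leaf)) (fun l j m F Q d r ihl ihr k =>
    cond' (same n P c m Q d) (k (Tree.node l j m F Q d r)) <|
    cond' (lexle i n E j m F) (ihl fun l' => k (Tree.node l' j m F Q d r))
      (ihr fun r' => k (Tree.node l j m F Q d r'))) t

/-- Insert the graph with refined colouring `C`. -/
def addGraph (V : List ℕ) (n : ℕ) (E : EdgeList) (C : ℕ) (t : Tree) (k : Tree → α) : α :=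
  force (read C) fun i => canon i V n E C fun P => force (enc P E) fun c => insert i n E P c t k

/-- The vertices of colour `2`. -/
def leaves (C : ℕ) (k : List ℕ → α) (V : List ℕ) : List ℕ → α :=
  List.rec k (fun v _ ih acc =>
    cond' (Nat.beq (dig C v) (nat_lit 2)) (ih (List.cons v acc)) (ih acc)) V

/-- Whether the colour of `p` is maximal among the elements of `L` other than `u`. -/
def isMax (C p u : ℕ) (L : List ℕ) : Bool :=
  force (dig C p) fun x => List.rec true (fun w _ ih =>
    cond' (cond' (Nat.beq w u) true (Nat.ble (dig C w) x)) ih false) L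

/-- A new lowest digit. -/
def salt (s u v : ℕ) : ℕ :=
  Nat.land (Nat.add s (Nat.add (Nat.shiftLeft u (nat_lit 20)) (Nat.shiftLeft v (nat_lit 35))))
    (nat_lit 1208925819614629174706175)

/-- Insert the graph obtained by attaching a pendant vertex `p` to `u`, if `p` is of maximal
colour among the leaves of the new graph. -/
def addPendant (s p : ℕ) (V : List ℕ) (n : ℕ) (E : EdgeList) (L : List ℕ) (u : ℕ) (t : Tree)
    (k : Tree → α) : α :=
  force (step (EdgeList.cons u p E) (ones s n)) fun C => three (EdgeList.cons u p E) C fun C =>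
    cond' (isMax C p u L) (addGraph V n (EdgeList.cons u p E) C t k) (k t)

/-- Insert the graphs obtained by attaching a pendant vertex `p` to an element of `U`. -/
def addPendants (s p : ℕ) (V : List ℕ) (n : ℕ) (E : EdgeList) (L : List ℕ) (U : List ℕ) :
    Tree → (Tree → α) → α :=
  List.rec (fun t k => k t) (fun u _ ih t k =>
    addPendant (salt s u (nat_lit 0)) p V n E L u t fun t' => ih t' k) U

/-- Whether all elements of `L` are among `u` and `v`. -/
def covered (u v : ℕ) (L : List ℕ) : Bool :=
  List.rec true (fun w _ ih => cond' (cond' (Nat.beq w u) true (Nat.beq w v)) ih false) L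

/-- Whether `u` and `v` are not adjacent. -/
def noEdge (u v : ℕ) (E : EdgeList) : Bool :=
  EdgeList.rec true (fun a b _ ih =>
    cond' (cond' (Nat.beq a u) (Nat.beq b v) (cond' (Nat.beq a v) (Nat.beq b u) false)) false ih) E

/-- Insert a graph after computing its refined colouring. -/
def addRefined (s : ℕ) (V : List ℕ) (n : ℕ) (E : EdgeList) (t : Tree) (k : Tree → α) : α :=
  force (step E (ones s n)) fun C => three E C fun C => addGraph V n E C t k

/-- Insert the graphs without leaves obtained by joining `v` to an element of `U`. -/
def addEdgesAt (s : ℕ) (V : List ℕ) (n : ℕ) (E : EdgeList) (L : List ℕ) (v : ℕ) (U : List ℕ) :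
    Tree → (Tree → α) → α :=
  List.rec (fun t k => k t) (fun u _ ih t k =>
    cond' (cond' (covered u v L) (noEdge u v E) false)
      (addRefined (salt s u v) V n (EdgeList.cons u v E) t fun t' => ih t' k) (ih t k)) U

/-- Insert the graphs without leaves obtained by joining two elements of `U`. -/
def addEdges (s : ℕ) (V : List ℕ) (n : ℕ) (E : EdgeList) (L : List ℕ) (U : List ℕ) :
    Tree → (Tree → α) → α :=
  List.rec (fun t k => k t) (fun v U ih t k => addEdgesAt s V n E L v U t fun t' => ih t' k) U

/-- Insert all relevant one-edge extensions of a graph. -/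
def extend (s n : ℕ) (E : EdgeList) (t : Tree) (k : Tree → α) : α :=
  range n fun V => force (Nat.succ n) fun m => force (Nat.mul (nat_lit 80) m) fun p =>
  force (step E (ones s n)) fun C => leaves C (fun L =>
    addPendants s p (List.cons p V) m E L V t fun t => addEdges s V n E L V t k) V List.nil

/-- Insert all relevant one-edge extensions of all graphs in a tree. -/
def next (s : Tree) : Tree → (Tree → α) → α :=
  Tree.rec (fun t k => k t) (fun _ s n E _ _ _ ihl ihr t k =>
    ihl t fun t₁ => extend s n E t₁ fun t₂ => ihr t₂ k) s

/-- The tree of the connected graphs with `m` edges. -/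
def level (m : ℕ) : (Tree → α) → α :=
  Nat.rec (fun k => k (Tree.node Tree.leaf (nat_lit 0) (nat_lit 1) EdgeList.nil (nat_lit 0)
    (nat_lit 0) Tree.leaf)) (fun _ ih k => ih fun t => next t Tree.leaf k) m

/-- The number of nodes. -/
def size (t : Tree) : ℕ :=
  Tree.rec (nat_lit 0) (fun _ _ _ _ _ _ _ ihl ihr => Nat.succ (Nat.add ihl ihr)) t

/-- Whether the invariants of the nodes strictly increase in the in-order traversal, starting
above those of the graph `i n E`; `k` receives the last graph. -/
def strict (t : Tree) : ℕ → ℕ → EdgeList → (ℕ → ℕ → EdgeList → Bool) → Bool :=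
  Tree.rec (fun i n E k => k i n E) (fun _ j m F _ _ _ ihl ihr i n E k =>
    ihl i n E fun i n E => cond' (lexle j m F i n E) false (ihr j m F k)) t

end

end Algorithm

/-! ### Elimination of continuations -/

section Continuations

variable {α : Type}

theorem force_eq (x : ℕ) (k : ℕ → α) : force x k = k x := by cases x <;> rfl

theorem cond'_eq (b : Bool) (x y : α) : cond' b x y = if b then x else y := by cases b <;> rfl

theorem cond'_iff {b x y : Bool} :
    cond' b x y = true ↔ (b = true → x = true) ∧ (¬ b = true → y = true) := by
  cases b <;> simp [cond']

theorem three_eq (E : EdgeList) (C : ℕ) (k : ℕ → α) :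
    three E C k = k (step E (step E (step E C))) := by
  simp only [three, force_eq]

/-- The bit position of a vertex. -/
def pos (v : ℕ) : ℕ := 80 * (v + 1)

theorem pos_injective : Function.Injective pos := fun a b h => by
  simp only [pos] at h
  omega

/-- The bit positions of the vertices less than `n`. -/
def verts : ℕ → List ℕ
  | 0 => []
  | n + 1 => pos n :: verts n

theorem range_eq (n : ℕ) (k : List ℕ → α) : range n k = k (verts n) := by
  induction n generalizing k with
  | zero => rfl
  | succ n ih => exact (ih _).trans (force_eq _ _)

theorem mem_verts {p n : ℕ} : p ∈ verts n ↔ ∃ v : Fin n, p = pos v := by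
  induction n with
  | zero => simp [verts]
  | succ n ih =>
    simp only [verts, List.mem_cons, ih, Fin.exists_iff]
    grind

theorem pos_mem_verts {n : ℕ} (v : Fin n) : pos v ∈ verts n := mem_verts.2 ⟨v, rfl⟩

theorem pos_self_notMem_verts (n : ℕ) : pos n ∉ verts n := fun h => by
  obtain ⟨v, hv⟩ := mem_verts.1 h
  exact v.2.ne (pos_injective hv).symm

theorem nodup_verts (n : ℕ) : (verts n).Nodup := by
  induction n with
  | zero => exact List.nodup_nil
  | succ n ih => exact List.nodup_cons.2 ⟨pos_self_notMem_verts n, ih⟩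

theorem sum_map_verts (f : ℕ → ℕ) (n : ℕ) : ((verts n).map f).sum = ∑ v : Fin n, f (pos v) := by
  induction n with
  | zero => rfl
  | succ n ih => simp [verts, ih, Fin.sum_univ_castSucc, add_comm]

theorem exists_maxes_eq (K : ℕ) (V : List ℕ) (k : List ℕ → α) (x : ℕ) (acc : List ℕ) :
    ∃ L, maxes K V k x acc = k L := by
  induction V generalizing x acc with
  | nil => exact ⟨acc, rfl⟩
  | cons v V ih =>
    have h : maxes K (v :: V) k x acc = cond' (Nat.ble x (dig K v))
      (cond' (Nat.ble (dig K v) x) (maxes K V k x (v :: acc)) (maxes K V k (dig K v) [v]))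
      (maxes K V k x acc) :=
      force_eq (dig K v) fun y => cond' (Nat.ble x y)
        (cond' (Nat.ble y x) (maxes K V k x (v :: acc)) (maxes K V k y [v])) (maxes K V k x acc)
    rw [h, cond'_eq, cond'_eq]
    split_ifs
    exacts [ih _ _, ih _ _, ih _ _]

theorem exists_best_eq (V : List ℕ) (n : ℕ) (E : EdgeList) (K A : ℕ) (k : ℕ → α) (L : List ℕ)
    (P c : ℕ) : ∃ Q, best V n E K A k L P c = k Q := by
  induction L generalizing P c with
  | nil => exact ⟨P, rfl⟩
  | cons v L ih =>
    have h : ∃ P' c', best V n E K A k (v :: L) P c =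
      cond' (Nat.ble c c') (best V n E K A k L P c) (best V n E K A k L P' c') :=
      ⟨_, _, (force_eq _ fun P' => force (enc P' E) fun c' =>
        cond' (Nat.ble c c') (best V n E K A k L P c) (best V n E K A k L P' c')).trans
          (force_eq _ _)⟩
    obtain ⟨P', c', h⟩ := h
    rw [h, cond'_eq]
    split_ifs
    exacts [ih _ _, ih _ _]

theorem exists_canon_eq (s : ℕ) (V : List ℕ) (n : ℕ) (E : EdgeList) (C : ℕ) (k : ℕ → α) :
    ∃ P, canon s V n E C k = k P := by
  simp only [canon, force_eq]
  obtain ⟨L, hL⟩ := exists_maxes_eq (keys s C V) V (fun L => best V n E (keys s C V) (rows s E) k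
    L (nat_lit 0) (Nat.shiftLeft (nat_lit 1) (nat_lit 256))) (nat_lit 0) []
  exact hL ▸ exists_best_eq ..

theorem exists_leaves_eq (C : ℕ) (k : List ℕ → α) (V acc : List ℕ) :
    ∃ L, (∀ w, w ∈ L ↔ w ∈ acc ∨ w ∈ V ∧ dig C w = 2) ∧ leaves C k V acc = k L := by
  induction V generalizing acc with
  | nil => exact ⟨acc, by simp, rfl⟩
  | cons v V ih =>
    have h : leaves C k (v :: V) acc =
      cond' (Nat.beq (dig C v) 2) (leaves C k V (v :: acc)) (leaves C k V acc) := rfl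
    rw [cond'_eq] at h
    split_ifs at h with hv
    · obtain ⟨L, hL, e⟩ := ih (v :: acc)
      have := Nat.eq_of_beq_eq_true hv
      exact ⟨L, by grind, h.trans e⟩
    · obtain ⟨L, hL, e⟩ := ih acc
      have : dig C v ≠ 2 := fun e => hv (by rw [e]; rfl)
      exact ⟨L, by grind, h.trans e⟩

end Continuations

theorem isMax_iff {C p u : ℕ} {L : List ℕ} :
    isMax C p u L = true ↔ ∀ w ∈ L, w ≠ u → dig C w ≤ dig C p := by
  rw [isMax, force_eq]
  induction L with
  | nil => simp
  | cons w L ih =>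
    change cond' (cond' (Nat.beq w u) true (Nat.ble (dig C w) (dig C p))) _ false = true ↔ _
    rw [List.forall_mem_cons, ← ih]
    simp only [cond'_iff, Nat.beq_eq, Nat.ble_eq]
    grind

theorem covered_iff {u v : ℕ} {L : List ℕ} :
    covered u v L = true ↔ ∀ w ∈ L, w = u ∨ w = v := by
  induction L with
  | nil => exact iff_of_true rfl (by simp)
  | cons w L ih =>
    change cond' (cond' (Nat.beq w u) true (Nat.beq w v)) (covered u v L) false = true ↔ _
    rw [List.forall_mem_cons, ← ih]
    simp only [cond'_iff, Nat.beq_eq]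
    grind

/-! ### The graph of an edge list -/

/-- Adjacency of bit positions in an edge list. -/
def EdgeList.Adj : EdgeList → ℕ → ℕ → Prop
  | nil, _, _ => False
  | cons u v E, p, q => p = u ∧ q = v ∨ p = v ∧ q = u ∨ E.Adj p q

/-- The number of edges in an edge list. -/
def EdgeList.length : EdgeList → ℕ
  | nil => 0
  | cons _ _ E => E.length + 1

/-- An edge list without loops and repetitions between the first `n` vertices. -/
def EdgeList.WF (n : ℕ) : EdgeList → Prop
  | nil => True
  | cons u v E => u ∈ verts n ∧ v ∈ verts n ∧ u ≠ v ∧ ¬ E.Adj u v ∧ E.WF n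

theorem EdgeList.Adj.symm {E : EdgeList} {p q : ℕ} (h : E.Adj p q) : E.Adj q p := by
  induction E with
  | nil => exact h
  | cons u v E ih => rcases h with h | h | h <;> simp_all [EdgeList.Adj]

theorem EdgeList.WF.ne {n : ℕ} {E : EdgeList} (hE : E.WF n) {p q : ℕ} (h : E.Adj p q) : p ≠ q := by
  induction E with
  | nil => exact h.elim
  | cons u v E ih =>
    obtain ⟨-, -, huv, -, hE⟩ := hE
    rcases h with ⟨rfl, rfl⟩ | ⟨rfl, rfl⟩ | h
    exacts [huv, huv.symm, ih hE h]

theorem EdgeList.WF.mem_verts {n : ℕ} {E : EdgeList} (hE : E.WF n) {p q : ℕ} (h : E.Adj p q) :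
    p ∈ verts n := by
  induction E with
  | nil => exact h.elim
  | cons u v E ih =>
    obtain ⟨hu, hv, -, -, hE⟩ := hE
    rcases h with ⟨rfl, rfl⟩ | ⟨rfl, rfl⟩ | h
    exacts [hu, hv, ih hE h]

theorem EdgeList.WF.mono {n : ℕ} {E : EdgeList} (hE : E.WF n) : E.WF (n + 1) := by
  induction E with
  | nil => trivial
  | cons u v E ih =>
    obtain ⟨hu, hv, h₁, h₂, hE⟩ := hE
    exact ⟨List.mem_cons_of_mem _ hu, List.mem_cons_of_mem _ hv, h₁, h₂, ih hE⟩

theorem noEdge_iff {u v : ℕ} {E : EdgeList} : noEdge u v E = true ↔ ¬ E.Adj u v := by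
  induction E with
  | nil => exact iff_of_true rfl id
  | cons a b E ih =>
    change cond' (cond' (Nat.beq a u) (Nat.beq b v) (cond' (Nat.beq a v) (Nat.beq b u) false))
      false (noEdge u v E) = true ↔ _
    simp only [cond'_iff, Nat.beq_eq, ih, EdgeList.Adj]
    grind

/-- The graph on `n` vertices with a given list of edges. -/
def graph (n : ℕ) (E : EdgeList) : SimpleGraph (Fin n) where
  Adj a b := a ≠ b ∧ E.Adj (pos a) (pos b)
  symm := ⟨fun _ _ h => ⟨h.1.symm, h.2.symm⟩⟩
  loopless := ⟨fun _ h => h.1 rfl⟩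

theorem EdgeList.WF.graph_adj {n : ℕ} {E : EdgeList} (hE : E.WF n) {a b : Fin n} :
    (graph n E).Adj a b ↔ E.Adj (pos a) (pos b) :=
  ⟨And.right, fun h => ⟨fun e => hE.ne h (by rw [e]), h⟩⟩

theorem EdgeList.WF.ncard_edgeSet {n : ℕ} {E : EdgeList} (hE : E.WF n) :
    (graph n E).edgeSet.ncard = E.length := by
  induction E with
  | nil =>
    have : graph n EdgeList.nil = ⊥ := by
      ext a b
      simp [graph, EdgeList.Adj]
    simp [this, EdgeList.length]
  | cons u v E ih =>
    have hE' := hE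
    obtain ⟨hu, hv, huv, hnot, hE⟩ := hE
    obtain ⟨a, rfl⟩ := GraphletEnum.mem_verts.1 hu
    obtain ⟨b, rfl⟩ := GraphletEnum.mem_verts.1 hv
    have : (graph n (cons (pos a) (pos b) E)).edgeSet =
        Set.insert s(a, b) (graph n E).edgeSet := by
      ext e
      induction e with
      | h x y =>
        change (graph n _).Adj x y ↔ s(x, y) = s(a, b) ∨ (graph n E).Adj x y
        rw [hE'.graph_adj, hE.graph_adj, EdgeList.Adj]
        simp only [pos_injective.eq_iff, Fin.val_inj, Sym2.eq_iff, or_assoc]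
    rw [this]
    refine (Set.ncard_insert_of_notMem (fun h => hnot ?_) (Set.toFinite _)).trans ?_
    · exact hE.graph_adj.1 h
    · rw [ih hE, EdgeList.length]
/-! ### Colour refinement -/

section Refinement

variable {V W : Type} [Fintype V] [Fintype W]

open Classical in
/-- Add to the colour of every vertex the squares of the colours of its neighbours. -/
noncomputable def refine (G : SimpleGraph V) (c : V → ℕ) (v : V) : ℕ :=
  c v + ∑ w, if G.Adj v w then c w ^ 2 else 0

/-- Four refinement steps. -/
noncomputable def refine₄ (G : SimpleGraph V) (c : V → ℕ) : V → ℕ := (refine G)^[4] c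

/-- A hash function with values less than `2 ^ 61 - 1`. -/
def hash (x : ℕ) : ℕ := x % (2 ^ 80 - 1) * 748572847584758473857 % (2 ^ 61 - 1)

/-- The primary invariant of a graph. -/
noncomputable def graphKey (G : SimpleGraph V) : ℕ := hash (∑ v, refine₄ G (fun _ => 1) v)

open Classical in
/-- The secondary invariant of a graph. -/
noncomputable def graphInv (G : SimpleGraph V) : ℕ :=
  ∑ p, hash (∑ v, refine₄ G (fun v => 1 + if v = p then 1 else 0) v) ^ 2

variable {G : SimpleGraph V} {H : SimpleGraph W}

theorem refine_comp (φ : G ≃g H) (c : W → ℕ) : refine G (c ∘ φ) = refine H c ∘ φ := by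
  funext v
  simp only [refine, Function.comp_apply]
  congr 1
  rw [← φ.toEquiv.sum_comp]
  refine Finset.sum_congr rfl fun w _ => ?_
  congr 1
  exact propext φ.map_adj_iff.symm

theorem refine₄_comp (φ : G ≃g H) (c : W → ℕ) : refine₄ G (c ∘ φ) = refine₄ H c ∘ φ := by
  simp only [refine₄, Function.iterate_succ_apply, Function.iterate_zero_apply, refine_comp]

theorem sum_refine₄_comp (φ : G ≃g H) (c : W → ℕ) :
    ∑ v, refine₄ G (c ∘ φ) v = ∑ w, refine₄ H c w := by
  rw [refine₄_comp]
  exact φ.toEquiv.sum_comp (refine₄ H c)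

theorem graphKey_congr (φ : G ≃g H) : graphKey G = graphKey H :=
  congrArg hash (sum_refine₄_comp φ fun _ => 1)

theorem graphInv_congr (φ : G ≃g H) : graphInv G = graphInv H := by
  classical
  rw [graphInv, graphInv, ← φ.toEquiv.sum_comp]
  refine Finset.sum_congr rfl fun p _ => ?_
  rw [← sum_refine₄_comp φ]
  congr! 5 with v _ w
  change _ = 1 + if φ w = φ p then 1 else 0
  congr 2
  exact propext φ.injective.eq_iff.symm

theorem refine_le {B : ℕ} {c : V → ℕ} (hV : Fintype.card V ≤ 11) (hc : ∀ v, c v ≤ B) (v : V) :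
    refine G c v ≤ B + 11 * B ^ 2 := by
  refine add_le_add (hc v) ((Finset.sum_le_card_nsmul _ _ (B ^ 2) fun w _ => ?_).trans ?_)
  · split_ifs
    exacts [Nat.pow_le_pow_left (hc w) 2, zero_le]
  · exact Nat.mul_le_mul_right _ hV

end Refinement

/-! ### Packed colourings -/

/-- The number `C` packs the colouring `c`. -/
def Packs {n : ℕ} (C : ℕ) (c : Fin n → ℕ) : Prop :=
  ∃ s < 2 ^ 80, C = s + ∑ v, c v * (2 ^ 80) ^ ((v : ℕ) + 1)

theorem digit_sum {n b : ℕ} {c : Fin n → ℕ} (hc : ∀ v, c v < b) (v : Fin n) :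
    (∑ v, c v * b ^ (v : ℕ)) / b ^ (v : ℕ) % b = c v := by
  induction n with
  | zero => exact v.elim0
  | succ n ih =>
    have h : ∑ v, c v * b ^ (v : ℕ) = c 0 + b * ∑ v : Fin n, c v.succ * b ^ (v : ℕ) := by
      rw [Fin.sum_univ_succ, Finset.mul_sum]
      congr 1
      · simp
      · refine Finset.sum_congr rfl fun v _ => ?_
        rw [Fin.val_succ, pow_succ]
        ring
    rw [h]
    have hb : 0 < b := (Nat.zero_le _).trans_lt (hc 0)
    refine Fin.cases ?_ (fun v => ?_) v
    · simp [Nat.mod_eq_of_lt (hc 0)]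
    · rw [Fin.val_succ, pow_succ', ← Nat.div_div_eq_div_mul, Nat.add_mul_div_left _ _ hb,
        Nat.div_eq_of_lt (hc 0), zero_add]
      exact ih (fun v => hc v.succ) v

theorem two_pow_pos (v : ℕ) : 2 ^ pos v = (2 ^ 80) ^ (v + 1) := pow_mul ..

theorem dig_eq (C p : ℕ) : dig C p = C / 2 ^ p % 2 ^ 80 := by
  rw [← Nat.shiftRight_eq_div_pow, ← Nat.and_two_pow_sub_one_eq_mod]
  rfl

section Packs

variable {n C : ℕ} {c : Fin n → ℕ}

theorem Packs.dig (h : Packs C c) (hc : ∀ v, c v < 2 ^ 80) (v : Fin n) :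
    dig C (pos v) = c v := by
  obtain ⟨s, hs, rfl⟩ := h
  have := digit_sum (c := (Fin.cons s c : Fin (n + 1) → ℕ))
    (Fin.cases hs hc) v.succ
  rw [Fin.sum_univ_succ] at this
  simp only [Fin.cons_zero, Fin.cons_succ, Fin.val_succ, Fin.val_zero, pow_zero, mul_one] at this
  rw [dig_eq, two_pow_pos, this]

theorem Packs.read (h : Packs C c) : read C = hash (∑ v, c v) := by
  obtain ⟨s, hs, rfl⟩ := h
  have h₁ : (s + ∑ v, c v * (2 ^ 80) ^ ((v : ℕ) + 1)) >>> 80 =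
      ∑ v, c v * (2 ^ 80) ^ (v : ℕ) := by
    have : ∑ v, c v * (2 ^ 80) ^ ((v : ℕ) + 1) = 2 ^ 80 * ∑ v, c v * (2 ^ 80) ^ (v : ℕ) := by
      rw [Finset.mul_sum]
      refine Finset.sum_congr rfl fun v _ => ?_
      rw [pow_succ]
      ring
    rw [Nat.shiftRight_eq_div_pow, this, Nat.add_mul_div_left _ _ (by positivity),
      Nat.div_eq_of_lt hs, zero_add]
  have h₂ : (∑ v, c v * (2 ^ 80) ^ (v : ℕ)) ≡ ∑ v, c v [MOD 2 ^ 80 - 1] := by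
    refine Nat.ModEq.sum fun v _ => ?_
    have : (2 ^ 80) ^ (v : ℕ) ≡ 1 ^ (v : ℕ) [MOD 2 ^ 80 - 1] := Nat.ModEq.pow _ rfl
    simpa using this.mul_left (c v)
  change (_ >>> 80) % (2 ^ 80 - 1) * _ % _ = _
  rw [h₁, h₂]
  rfl

theorem packs_ones {s : ℕ} (hs : s < 2 ^ 80) (n : ℕ) :
    Packs (ones s n) (fun _ : Fin n => 1) := by
  refine ⟨s, hs, ?_⟩
  have h : (1 <<< (80 * n)) / (2 ^ 80 - 1) = ∑ v : Fin n, (2 ^ 80) ^ (v : ℕ) := by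
    rw [Fin.sum_univ_eq_sum_range (fun v => (2 ^ 80) ^ v) n, Nat.one_shiftLeft, pow_mul]
    have h₄ : (2 ^ 80) ^ n = (2 ^ 80 - 1) * (∑ v ∈ Finset.range n, (2 ^ 80) ^ v) + 1 := by
      rw [mul_comm]
      exact (geom_sum_mul_add (2 ^ 80 - 1) n).symm
    rw [h₄, Nat.mul_add_div (by norm_num)]
    norm_num
  change s + ((1 <<< (80 * n)) / (2 ^ 80 - 1)) <<< 80 = _
  rw [h, Nat.shiftLeft_eq, Finset.sum_mul]
  simp only [pow_succ, one_mul]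

theorem Packs.add_single (h : Packs C c) (p : Fin n) :
    Packs (C + 1 <<< pos p) (fun v => c v + if v = p then 1 else 0) := by
  obtain ⟨s, hs, rfl⟩ := h
  refine ⟨s, hs, ?_⟩
  simp [add_mul, Finset.sum_add_distrib, add_assoc, Nat.one_shiftLeft, two_pow_pos]

theorem Packs.step {E : EdgeList} (hE : E.WF n) (h : Packs C c) (hc : ∀ v, c v < 2 ^ 80) :
    Packs (step E C) (refine (graph n E) c) := by
  classical
  have key : GraphletEnum.step E C = C + ∑ v : Fin n,
      (∑ w : Fin n, if E.Adj (pos v) (pos w) then c w ^ 2 else 0) * (2 ^ 80) ^ ((v : ℕ) + 1) := by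
    induction E with
    | nil => simp [EdgeList.Adj, GraphletEnum.step]
    | cons u v E ih =>
      obtain ⟨hu, hv, huv, hnot, hE⟩ := hE
      obtain ⟨a, rfl⟩ := mem_verts.1 hu
      obtain ⟨b, rfl⟩ := mem_verts.1 hv
      have hab : a ≠ b := fun e => huv (by rw [e])
      have hstep : GraphletEnum.step (EdgeList.cons (pos a) (pos b) E) C =
          (GraphletEnum.dig C (pos a) ^ 2) <<< pos b +
            ((GraphletEnum.dig C (pos b) ^ 2) <<< pos a + GraphletEnum.step E C) := rfl
      have hsum (x y : Fin n) : (if (EdgeList.cons (pos a) (pos b) E).Adj (pos x) (pos y)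
          then c y ^ 2 else 0) = (if y = b then if x = a then c b ^ 2 else 0 else 0) +
          (if y = a then if x = b then c a ^ 2 else 0 else 0) +
          if E.Adj (pos x) (pos y) then c y ^ 2 else 0 := by
        simp only [EdgeList.Adj, pos_injective.eq_iff, Fin.val_inj]
        have := fun h : E.Adj (pos b) (pos a) => hnot h.symm
        grind
      rw [hstep, ih hE, h.dig hc, h.dig hc]
      simp only [hsum, Finset.sum_add_distrib, add_mul, Finset.sum_ite_eq', Finset.mem_univ,
        if_true, ite_mul, zero_mul, Nat.shiftLeft_eq, two_pow_pos]
      ring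
  obtain ⟨s, hs, e⟩ := h
  refine ⟨s, hs, ?_⟩
  rw [key, e, add_assoc, ← Finset.sum_add_distrib]
  simp only [refine, hE.graph_adj, add_mul]

end Packs

section Invariants

variable {n : ℕ} {E : EdgeList} {s : ℕ}

theorem refined_packs {C : ℕ} {c : Fin n → ℕ} (hE : E.WF n) (hn : n ≤ 11) (h : Packs C c)
    (hc : ∀ v, c v ≤ 2) :
    Packs (step E (step E (step E (step E C)))) (refine₄ (graph n E) c) ∧
      ∀ v, refine₄ (graph n E) c v < 2 ^ 80 := by
  have hn : Fintype.card (Fin n) ≤ 11 := by simpa using hn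
  have h₁ := refine_le (G := graph n E) hn hc
  have h₂ := refine_le (G := graph n E) hn h₁
  have h₃ := refine_le (G := graph n E) hn h₂
  have h₄ := refine_le (G := graph n E) hn h₃
  refine ⟨Packs.step hE (Packs.step hE (Packs.step hE (Packs.step hE h ?_) ?_) ?_) ?_, ?_⟩
  exacts [fun v => (hc v).trans_lt (by norm_num), fun v => (h₁ v).trans_lt (by norm_num),
    fun v => (h₂ v).trans_lt (by norm_num), fun v => (h₃ v).trans_lt (by norm_num),
    fun v => (h₄ v).trans_lt (by norm_num)]

theorem read_refined (hE : E.WF n) (hn : n ≤ 11) (hs : s < 2 ^ 80) :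
    read (step E (step E (step E (step E (ones s n))))) = graphKey (graph n E) :=
  (refined_packs hE hn (packs_ones hs n) fun _ => by norm_num).1.read

theorem inv₂_eq (hE : E.WF n) (hn : n ≤ 11) (hs : s < 2 ^ 80) :
    inv₂ s n E = graphInv (graph n E) := by
  have h (V : List ℕ) : (List.rec (nat_lit 0) (fun p _ ih =>
      Nat.add (Nat.pow (force (step E (Nat.add (ones s n) (Nat.shiftLeft (nat_lit 1) p)))
        fun C => three E C read) (nat_lit 2)) ih) V : ℕ) =
      (V.map fun p => read (step E (step E (step E (step E (ones s n + 1 <<< p))))) ^ 2).sum := by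
    induction V with
    | nil => rfl
    | cons p V ih =>
      rw [List.map_cons, List.sum_cons, ← ih]
      simp only [force_eq, three_eq]
      rfl
  rw [inv₂, range_eq, h, sum_map_verts, graphInv]
  refine Finset.sum_congr rfl fun p _ => ?_
  rw [(refined_packs hE hn ((packs_ones hs n).add_single p) fun v => ?_).1.read]
  · congr!
  · split_ifs <;> norm_num

theorem graphKey_lt {V : Type} [Fintype V] (G : SimpleGraph V) : graphKey G < 2 ^ 80 :=
  (Nat.mod_lt _ (by norm_num)).trans (by norm_num)

end Invariants
/-! ### Certified isomorphisms -/

section Relabelling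

variable {n P : ℕ} {E : EdgeList}

theorem nib_lt (P v : ℕ) : nib P v < 16 :=
  (Nat.and_two_pow_sub_one_eq_mod (P >>> v) 4).trans_lt (Nat.mod_lt _ (by norm_num))

theorem testBit_enc {i : ℕ} :
    (enc P E).testBit i = true ↔ ∃ p q, E.Adj p q ∧ i = 16 * nib P p + nib P q := by
  induction E with
  | nil => simp [enc, EdgeList.Adj]
  | cons u v E ih =>
    change ((1 <<< (16 * nib P u + nib P v) ||| 1 <<< (16 * nib P v + nib P u)) |||
      enc P E).testBit i = true ↔ _
    simp only [Nat.testBit_or, Nat.one_shiftLeft, Nat.testBit_two_pow, Bool.or_eq_true, ih,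
      EdgeList.Adj, decide_eq_true_eq]
    constructor
    · rintro ((rfl | rfl) | ⟨p, q, h, rfl⟩)
      exacts [⟨u, v, by simp⟩, ⟨v, u, by simp⟩, ⟨p, q, by simp [h]⟩]
    · rintro ⟨p, q, ⟨rfl, rfl⟩ | ⟨rfl, rfl⟩ | h, rfl⟩
      exacts [.inl (.inl rfl), .inl (.inr rfl), .inr ⟨p, q, h, rfl⟩]

theorem exists_perm_of_valid (h : valid n P = true) :
    ∃ σ : Equiv.Perm (Fin n), ∀ v : Fin n, nib P (pos v) = σ v := by
  have hbit (V : List ℕ) (i : ℕ) : Nat.testBit (List.rec (nat_lit 1)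
      (fun v _ ih => Nat.lor (Nat.shiftLeft (nat_lit 2) (nib P v)) ih) V) i = true ↔
      i = 0 ∨ ∃ v ∈ V, i = nib P v + 1 := by
    induction V with
    | nil =>
      change Nat.testBit 1 i = true ↔ _
      simp [Nat.testBit_one_eq_true_iff_self_eq_zero]
    | cons v V ih =>
      change Nat.testBit (2 <<< nib P v ||| _) i = true ↔ _
      rw [Nat.testBit_or, Bool.or_eq_true, ih, Nat.shiftLeft_eq, ← pow_succ',
        Nat.testBit_two_pow, decide_eq_true_eq, List.exists_mem_cons_iff]
      grind
  rw [valid, range_eq, Nat.beq_eq] at h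
  have hn : Nat.pred (Nat.shiftLeft (nat_lit 2) n) = 2 ^ (n + 1) - 1 := by
    change (2 <<< n) - 1 = _
    rw [Nat.shiftLeft_eq, ← pow_succ']
  rw [hn] at h
  have hmem (i : ℕ) : i < n ↔ ∃ v : Fin n, i = nib P (pos v) := by
    have := hbit (verts n) (i + 1)
    rw [h, Nat.testBit_two_pow_sub_one] at this
    simp only [decide_eq_true_eq, mem_verts] at this
    grind
  have hlt (v : Fin n) : nib P (pos v) < n := (hmem _).2 ⟨v, rfl⟩
  have hsurj : Function.Surjective (fun v : Fin n => (⟨nib P (pos v), hlt v⟩ : Fin n)) :=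
    fun i => by
      obtain ⟨v, hv⟩ := (hmem i).1 i.2
      exact ⟨v, Fin.ext hv.symm⟩
  exact ⟨Equiv.ofBijective _ (Finite.injective_iff_bijective.1
    (Finite.injective_iff_surjective.2 hsurj)), fun v => rfl⟩

theorem graph_adj_iff_testBit (hE : E.WF n) {σ : Equiv.Perm (Fin n)}
    (hσ : ∀ v : Fin n, nib P (pos v) = σ v) (a b : Fin n) :
    (graph n E).Adj a b ↔ (enc P E).testBit (16 * σ a + σ b) = true := by
  rw [hE.graph_adj, testBit_enc]
  constructor
  · exact fun h => ⟨_, _, h, by rw [hσ, hσ]⟩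
  · rintro ⟨p, q, h, e⟩
    obtain ⟨v, rfl⟩ := mem_verts.1 (hE.mem_verts h)
    obtain ⟨w, rfl⟩ := mem_verts.1 (hE.mem_verts h.symm)
    have hp := nib_lt P (pos a)
    have hq := nib_lt P (pos b)
    have hv := nib_lt P (pos v)
    have hw := nib_lt P (pos w)
    rw [hσ] at hp hq hv hw
    rw [hσ, hσ] at e
    have h₁ : σ a = σ v := Fin.ext (by omega)
    have h₂ : σ b = σ w := Fin.ext (by omega)
    rwa [σ.injective h₁, σ.injective h₂]

theorem nonempty_iso_of_same {m Q : ℕ} {F : EdgeList} (hE : E.WF n) (hF : F.WF m)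
    (h : same n P (enc P E) m Q (enc Q F) = true) : Nonempty (graph n E ≃g graph m F) := by
  simp only [same, cond'_iff, Nat.beq_eq] at h
  have hc : enc P E = enc Q F := by grind
  have hn : n = m := by grind
  subst hn
  obtain ⟨σ, hσ⟩ := exists_perm_of_valid (n := n) (P := P) (by grind)
  obtain ⟨τ, hτ⟩ := exists_perm_of_valid (n := n) (P := Q) (by grind)
  refine ⟨⟨σ.trans τ.symm, fun {a b} => ?_⟩⟩
  rw [graph_adj_iff_testBit hE hσ, graph_adj_iff_testBit hF hτ, hc]
  simp

end Relabelling
/-! ### Search trees -/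

/-- The data stored at a node of a tree. -/
structure Entry where
  key : ℕ
  n : ℕ
  E : EdgeList
  P : ℕ
  code : ℕ

/-- The entries of a tree in order. -/
def Tree.toList : Tree → List Entry
  | leaf => []
  | node l key n E P code r => l.toList ++ ⟨key, n, E, P, code⟩ :: r.toList

theorem size_eq (t : Tree) : size t = t.toList.length := by
  induction t with
  | leaf => rfl
  | node l key n E P code r ihl ihr =>
    change Nat.succ (size l + size r) = _
    simp [Tree.toList, ihl, ihr, add_assoc]

/-- An entry that describes a connected graph with `m` edges. The invariant is not required to be
correct for the one-vertex graph. -/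
structure Entry.Sound (m : ℕ) (x : Entry) : Prop where
  wf : x.E.WF x.n
  n_le : x.n ≤ m + 1
  length_eq : x.E.length = m
  connected : (graph x.n x.E).Connected
  key_lt : x.key < 2 ^ 80
  key_eq : m ≠ 0 → x.key = graphKey (graph x.n x.E)
  code_eq : x.code = enc x.P x.E

/-- All entries of the tree describe connected graphs with `m` edges. -/
def Tree.Sound (m : ℕ) (t : Tree) : Prop := ∀ x ∈ t.toList, x.Sound m

/-- The tree contains a graph isomorphic to `G`. -/
def Tree.Rep (t : Tree) (G : Σ n, SimpleGraph (Fin n)) : Prop :=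
  ∃ x ∈ t.toList, Nonempty (G.2 ≃g graph x.n x.E)

theorem Tree.Rep.of_iso {t : Tree} {G H : Σ n, SimpleGraph (Fin n)} (h : t.Rep H)
    (φ : G.2 ≃g H.2) : t.Rep G :=
  let ⟨x, hx, ⟨ψ⟩⟩ := h
  ⟨x, hx, ⟨φ.trans ψ⟩⟩

theorem Tree.rep_node {l r : Tree} {key n P code : ℕ} {E : EdgeList}
    {G : Σ n, SimpleGraph (Fin n)} :
    (Tree.node l key n E P code r).Rep G ↔
      l.Rep G ∨ Nonempty (G.2 ≃g graph n E) ∨ r.Rep G := by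
  simp [Tree.Rep, Tree.toList, or_and_right, exists_or]

theorem Tree.sound_node {l r : Tree} {m key n P code : ℕ} {E : EdgeList} :
    (Tree.node l key n E P code r).Sound m ↔
      l.Sound m ∧ Entry.Sound m ⟨key, n, E, P, code⟩ ∧ r.Sound m := by
  simp only [Tree.Sound, Tree.toList, List.forall_mem_append, List.forall_mem_cons]

section Adds

variable {α : Type}

/-- The operation `f` on trees of connected graphs with `m` edges adds graphs, among them
representatives of all elements of `S`. -/
def Adds (m : ℕ) (f : Tree → (Tree → α) → α) (S : Set (Σ n, SimpleGraph (Fin n))) : Prop :=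
  ∀ t k, t.Sound m → ∃ t', f t k = k t' ∧ t'.Sound m ∧
    (∀ G, t.Rep G → t'.Rep G) ∧ ∀ G ∈ S, t'.Rep G

variable {m : ℕ} {f g : Tree → (Tree → α) → α} {S T : Set (Σ n, SimpleGraph (Fin n))}

theorem adds_empty : Adds m (fun t (k : Tree → α) => k t) ∅ :=
  fun t _ ht => ⟨t, rfl, ht, fun _ => id, fun _ h => h.elim⟩

theorem Adds.mono (hf : Adds m f S) (h : T ⊆ S) : Adds m f T := fun t k ht =>
  let ⟨t', h₁, h₂, h₃, h₄⟩ := hf t k ht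
  ⟨t', h₁, h₂, h₃, fun G hG => h₄ G (h hG)⟩

theorem Adds.comp (hf : Adds m f S) (hg : Adds m g T) :
    Adds m (fun t k => f t fun t' => g t' k) (S ∪ T) := fun t k ht =>
  let ⟨t₁, e₁, h₁, i₁, j₁⟩ := hf t (fun t' => g t' k) ht
  let ⟨t₂, e₂, h₂, i₂, j₂⟩ := hg t₁ k h₁
  ⟨t₂, e₁.trans e₂, h₂, fun G hG => i₂ G (i₁ G hG), fun G hG => hG.elim
    (fun h => i₂ G (j₁ G h)) (j₂ G)⟩

theorem adds_insert {i n P c : ℕ} {E : EdgeList} (hx : Entry.Sound m ⟨i, n, E, P, c⟩) :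
    Adds m (fun t (k : Tree → α) => insert i n E P c t k) {⟨n, graph n E⟩} := by
  intro t k ht
  simp only [Set.mem_singleton_iff, forall_eq]
  induction t generalizing k with
  | leaf =>
    refine ⟨_, rfl, ?_, ?_, ?_⟩
    · exact Tree.sound_node.2 ⟨ht, hx, ht⟩
    · rintro G ⟨x, hx, -⟩
      cases hx
    · exact Tree.rep_node.2 (.inr (.inl ⟨.refl⟩))
  | node l j m' F Q d r ihl ihr =>
    obtain ⟨hl, hy, hr⟩ := Tree.sound_node.1 ht
    have h : insert i n E P c (Tree.node l j m' F Q d r) k =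
      cond' (same n P c m' Q d) (k (Tree.node l j m' F Q d r))
        (cond' (lexle i n E j m' F) (insert i n E P c l fun l' => k (Tree.node l' j m' F Q d r))
          (insert i n E P c r fun r' => k (Tree.node l j m' F Q d r'))) := rfl
    rw [h, cond'_eq, cond'_eq]
    split_ifs with hs
    · refine ⟨_, rfl, ht, fun _ => id, Tree.rep_node.2 (.inr (.inl ?_))⟩
      refine nonempty_iso_of_same hx.wf hy.wf (P := P) (Q := Q) ?_
      rwa [← hx.code_eq, ← hy.code_eq]
    · obtain ⟨t', e, h₁, h₂, h₃⟩ := ihl (fun l' => k (Tree.node l' j m' F Q d r)) hl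
      refine ⟨_, e, Tree.sound_node.2 ⟨h₁, hy, hr⟩, fun G hG => ?_, Tree.rep_node.2 (.inl h₃)⟩
      exact Tree.rep_node.2 ((Tree.rep_node.1 hG).imp_left (h₂ G))
    · obtain ⟨t', e, h₁, h₂, h₃⟩ := ihr (fun r' => k (Tree.node l j m' F Q d r')) hr
      refine ⟨_, e, Tree.sound_node.2 ⟨hl, hy, h₁⟩, fun G hG => ?_,
        Tree.rep_node.2 (.inr (.inr h₃))⟩
      exact Tree.rep_node.2 ((Tree.rep_node.1 hG).imp_right (Or.imp_right (h₂ G)))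

theorem exists_addGraph_eq (V : List ℕ) (n : ℕ) (E : EdgeList) (C : ℕ) (t : Tree) (k : Tree → α) :
    ∃ P, addGraph V n E C t k = insert (read C) n E P (enc P E) t k := by
  obtain ⟨P, hP⟩ := exists_canon_eq (read C) V n E C
    fun P => force (enc P E) fun c => insert (read C) n E P c t k
  refine ⟨P, ?_⟩
  rw [addGraph, force_eq, hP, force_eq]

theorem adds_addGraph {n C : ℕ} {V : List ℕ} {E : EdgeList} (hE : E.WF n) (hn : n ≤ m + 1)
    (hm : E.length = m) (hconn : (graph n E).Connected) (hC : read C = graphKey (graph n E)) :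
    Adds m (fun t (k : Tree → α) => addGraph V n E C t k) {⟨n, graph n E⟩} := by
  intro t k ht
  have hlt : read C < 2 ^ 80 := by
    rw [hC]
    exact graphKey_lt _
  obtain ⟨P, e⟩ := exists_addGraph_eq V n E C t k
  have hi : Adds m (fun t (k : Tree → α) => insert (read C) n E P (enc P E) t k) {⟨n, graph n E⟩} :=
    adds_insert ⟨hE, hn, hm, hconn, hlt, fun _ => hC, rfl⟩
  obtain ⟨t', h⟩ := hi t k ht
  exact ⟨t', e.trans h.1, h.2⟩

theorem adds_addRefined {n s : ℕ} {V : List ℕ} {E : EdgeList} (hE : E.WF n) (hn : n ≤ m + 1)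
    (hm : E.length = m) (hconn : (graph n E).Connected) (hs : s < 2 ^ 80) (hn' : n ≤ 11) :
    Adds m (fun t (k : Tree → α) => addRefined s V n E t k) {⟨n, graph n E⟩} := by
  simp only [addRefined, force_eq, three_eq]
  exact adds_addGraph hE hn hm hconn (read_refined hE hn' hs)

end Adds

/-! ### One-edge extensions -/

theorem salt_lt (s u v : ℕ) : salt s u v < 2 ^ 80 :=
  (Nat.and_two_pow_sub_one_eq_mod _ 80).trans_lt (Nat.mod_lt _ (by norm_num))

theorem refine_one_eq_two {V : Type} [Fintype V] {G : SimpleGraph V} {v : V} :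
    refine G (fun _ => 1) v = 2 ↔ ∃! w, G.Adj v w := by
  classical
  rw [Fintype.existsUnique_iff_card_one, refine]
  simp
  omega

theorem graph_cons_comm (n u v : ℕ) (E : EdgeList) :
    graph n (.cons u v E) = graph n (.cons v u E) := by
  ext a b
  simp only [graph, EdgeList.Adj]
  tauto

/-- The graphs without leaves obtained by joining two vertices. -/
def edgeExtensions (n : ℕ) (E : EdgeList) : Set (Σ n, SimpleGraph (Fin n)) :=
  {G | ∃ u v : Fin n, u ≠ v ∧ ¬ E.Adj (pos u) (pos v) ∧
    (∀ x, ¬ ∃! y, (graph n (.cons (pos u) (pos v) E)).Adj x y) ∧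
    G = ⟨n, graph n (.cons (pos u) (pos v) E)⟩}

/-- The graphs obtained by attaching a pendant vertex that has maximal colour among the leaves. -/
def pendantExtensions (n : ℕ) (E : EdgeList) : Set (Σ n, SimpleGraph (Fin n)) :=
  {G | ∃ (u : Fin n) (G' : SimpleGraph (Fin (n + 1))),
    G' = graph (n + 1) (.cons (pos u) (pos n) E) ∧
    (∀ x, (∃! y, G'.Adj x y) → refine₄ G' (fun _ => 1) x ≤ refine₄ G' (fun _ => 1) (Fin.last n)) ∧
    G = ⟨n + 1, G'⟩}

section Extensions

variable {α : Type} {m n s : ℕ} {E : EdgeList}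

theorem connected_cons (hconn : (graph n E).Connected) (u v : ℕ) :
    (graph n (.cons u v E)).Connected :=
  hconn.mono fun _ _ (h : (graph n E).Adj _ _) => ⟨h.1, .inr (.inr h.2)⟩

theorem connected_pendant (hconn : (graph n E).Connected) (u : Fin n) :
    (graph (n + 1) (.cons (pos u) (pos n) E)).Connected := by
  have hφ {a b : Fin n} (h : (graph n E).Adj a b) :
      (graph (n + 1) (.cons (pos u) (pos n) E)).Adj a.castSucc b.castSucc :=
    ⟨fun e => h.1 (Fin.castSucc_injective _ e), .inr (.inr h.2)⟩
  have hlast : (graph (n + 1) (.cons (pos u) (pos n) E)).Adj (Fin.last n) u.castSucc :=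
    ⟨(Fin.castSucc_lt_last u).ne', .inr (.inl ⟨rfl, rfl⟩)⟩
  rw [SimpleGraph.connected_iff_exists_forall_reachable]
  refine ⟨u.castSucc, Fin.lastCases hlast.reachable.symm fun v => ?_⟩
  exact (hconn.preconnected u v).map ⟨Fin.castSucc, hφ⟩

theorem wf_pendant (hE : E.WF n) (u : Fin n) :
    EdgeList.WF (n + 1) (.cons (pos u) (pos n) E) :=
  ⟨List.mem_cons_of_mem _ (pos_mem_verts u), List.mem_cons_self,
    fun e => u.2.ne (pos_injective e), fun h => pos_self_notMem_verts n (hE.mem_verts h.symm),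
    hE.mono⟩

variable {L : List ℕ}
  (hL : ∀ w, w ∈ L ↔ ∃ v : Fin n, w = pos v ∧ ∃! y, (graph n E).Adj v y)

include hL in
theorem covered_of_forall_not_leaf (hE : E.WF n) {u v : Fin n} (huv : u ≠ v)
    (hadj : ¬ E.Adj (pos u) (pos v))
    (h : ∀ x, ¬ ∃! y, (graph n (.cons (pos u) (pos v) E)).Adj x y) :
    covered (pos u) (pos v) L = true := by
  rw [covered_iff]
  intro w hw
  obtain ⟨w, rfl, hw'⟩ := (hL w).1 hw
  by_contra! hne
  refine h w ?_
  have hE' : EdgeList.WF n (.cons (pos u) (pos v) E) :=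
    ⟨pos_mem_verts u, pos_mem_verts v, fun e => huv (Fin.ext (pos_injective e)), hadj, hE⟩
  refine (existsUnique_congr fun y => ?_).1 hw'
  rw [hE.graph_adj, hE'.graph_adj, EdgeList.Adj]
  tauto

include hL in
theorem isMax_of_forall_le (hE : E.WF n) {C : ℕ} {u : Fin n}
    (hC : ∀ v : Fin (n + 1), dig C (pos v) =
      refine₄ (graph (n + 1) (.cons (pos u) (pos n) E)) (fun _ => 1) v)
    (h : ∀ x, (∃! y, (graph (n + 1) (.cons (pos u) (pos n) E)).Adj x y) →
      refine₄ (graph (n + 1) (.cons (pos u) (pos n) E)) (fun _ => 1) x ≤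
        refine₄ (graph (n + 1) (.cons (pos u) (pos n) E)) (fun _ => 1) (Fin.last n)) :
    isMax C (pos n) (pos u) L = true := by
  rw [isMax_iff]
  intro w hw hne
  obtain ⟨w, rfl, y, hy, hy'⟩ := (hL w).1 hw
  have h₁ := hC w.castSucc
  have h₂ := hC (Fin.last n)
  rw [Fin.val_castSucc] at h₁
  rw [Fin.val_last] at h₂
  rw [h₁, h₂]
  have hne' : pos w ≠ pos n := fun e => w.2.ne (pos_injective e)
  refine h _ ⟨y.castSucc, (wf_pendant hE u).graph_adj.2 (.inr (.inr hy.2)),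
    Fin.lastCases (fun hz => ?_) fun z hz => ?_⟩
  · have hz := (wf_pendant hE u).graph_adj.1 hz
    simp only [Fin.val_castSucc, Fin.val_last, EdgeList.Adj] at hz
    have : ¬ E.Adj (pos w) (pos n) := fun h => pos_self_notMem_verts n (hE.mem_verts h.symm)
    tauto
  · have hz := (wf_pendant hE u).graph_adj.1 hz
    simp only [Fin.val_castSucc, EdgeList.Adj] at hz
    rw [hy' z (hE.graph_adj.2 (by tauto))]

include hL in
theorem adds_addPendant (hE : E.WF n) (hn : n ≤ m + 1) (hm : E.length = m)
    (hconn : (graph n E).Connected) (hs : s < 2 ^ 80) (hn' : n + 1 ≤ 11) {V : List ℕ}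
    (u : Fin n) :
    Adds (m + 1) (fun t (k : Tree → α) => addPendant s (pos n) V (n + 1) E L (pos u) t k)
      {G | ∃ G' : SimpleGraph (Fin (n + 1)), G' = graph (n + 1) (.cons (pos u) (pos n) E) ∧
        (∀ x, (∃! y, G'.Adj x y) →
          refine₄ G' (fun _ => 1) x ≤ refine₄ G' (fun _ => 1) (Fin.last n)) ∧
        G = ⟨n + 1, G'⟩} := by
  simp only [addPendant, force_eq, three_eq, cond'_eq]
  have hE' := wf_pendant hE u
  obtain ⟨hC, hlt⟩ := refined_packs hE' hn' (packs_ones hs (n + 1)) fun _ => by norm_num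
  split_ifs with h
  · refine (adds_addGraph hE' (by omega) (by rw [EdgeList.length, hm])
      (connected_pendant hconn u) (read_refined hE' hn' hs)).mono ?_
    rintro G ⟨G', rfl, -, rfl⟩
    rfl
  · refine adds_empty.mono ?_
    rintro G ⟨G', rfl, hmax, -⟩
    exact h (isMax_of_forall_le hL hE (fun v => hC.dig hlt v) hmax)

include hL in
theorem adds_addPendants (hE : E.WF n) (hn : n ≤ m + 1) (hm : E.length = m)
    (hconn : (graph n E).Connected) (hn' : n + 1 ≤ 11) (V : List ℕ) :
    Adds (m + 1) (fun t (k : Tree → α) =>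
      addPendants s (pos n) V (n + 1) E L (verts n) t k) (pendantExtensions n E) := by
  have h (U : List ℕ) (hU : ∀ u ∈ U, u ∈ verts n) : Adds (m + 1)
      (fun t (k : Tree → α) => addPendants s (pos n) V (n + 1) E L U t k)
      {G | ∃ u ∈ U, ∃ G' : SimpleGraph (Fin (n + 1)), G' = graph (n + 1) (.cons u (pos n) E) ∧
        (∀ x, (∃! y, G'.Adj x y) →
          refine₄ G' (fun _ => 1) x ≤ refine₄ G' (fun _ => 1) (Fin.last n)) ∧
        G = ⟨n + 1, G'⟩} := by
    induction U with
    | nil => exact adds_empty.mono fun G ⟨u, hu, _⟩ => by cases hu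
    | cons u U ih =>
      rw [List.forall_mem_cons] at hU
      obtain ⟨u, rfl⟩ := mem_verts.1 hU.1
      refine ((adds_addPendant hL hE hn hm hconn (salt_lt ..) hn' u).comp
        (ih hU.2)).mono ?_
      rintro G ⟨u', hu', h⟩
      rcases List.mem_cons.1 hu' with rfl | hu'
      exacts [.inl h, .inr ⟨u', hu', h⟩]
  refine (h (verts n) fun _ => id).mono ?_
  rintro G ⟨u, G', h₁, h₂, h₃⟩
  exact ⟨_, pos_mem_verts u, G', h₁, h₂, h₃⟩

theorem adds_addEdgesAt (hE : E.WF n) (hn : n ≤ m + 1) (hm : E.length = m)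
    (hconn : (graph n E).Connected) (hn' : n + 1 ≤ 11) {V : List ℕ} {v : ℕ} (hv : v ∈ verts n)
    {U : List ℕ} (hU : ∀ u ∈ U, u ∈ verts n ∧ u ≠ v) :
    Adds (m + 1) (fun t (k : Tree → α) => addEdgesAt s V n E L v U t k)
      {G | ∃ u ∈ U, covered u v L = true ∧ ¬ E.Adj u v ∧ G = ⟨n, graph n (.cons u v E)⟩} := by
  induction U with
  | nil => exact adds_empty.mono fun G ⟨u, hu, _⟩ => by cases hu
  | cons u U ih =>
    rw [List.forall_mem_cons] at hU
    obtain ⟨⟨hu, huv⟩, hU⟩ := hU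
    have e : (fun t (k : Tree → α) => addEdgesAt s V n E L v (u :: U) t k) =
        fun t k => cond' (cond' (covered u v L) (noEdge u v E) false)
          (addRefined (salt s u v) V n (.cons u v E) t fun t' => addEdgesAt s V n E L v U t' k)
          (addEdgesAt s V n E L v U t k) := rfl
    rw [e]
    simp only [cond'_eq (cond' _ _ _)]
    split_ifs with h
    · simp only [cond'_iff, noEdge_iff] at h
      have hnot : ¬ E.Adj u v := by
        by_contra hadj
        have : covered u v L = true := by
          by_contra hc
          simpa using h.2 hc
        exact h.1 this hadj
      refine ((adds_addRefined (E := .cons u v E) ⟨hu, hv, huv, hnot, hE⟩ (by omega)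
        (by rw [EdgeList.length, hm]) (connected_cons hconn u v) (salt_lt ..) (by omega)).comp
        (ih hU)).mono ?_
      rintro G ⟨u', hu', h'⟩
      rcases List.mem_cons.1 hu' with rfl | hu'
      exacts [.inl h'.2.2, .inr ⟨u', hu', h'⟩]
    · refine (ih hU).mono ?_
      rintro G ⟨u', hu', hc, hadj, rfl⟩
      rcases List.mem_cons.1 hu' with rfl | hu'
      · refine absurd ?_ h
        rw [cond'_iff, noEdge_iff]
        exact ⟨fun _ => hadj, fun hc' => absurd hc hc'⟩
      · exact ⟨u', hu', hc, hadj, rfl⟩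

include hL in
theorem adds_addEdges (hE : E.WF n) (hn : n ≤ m + 1) (hm : E.length = m)
    (hconn : (graph n E).Connected) (hn' : n + 1 ≤ 11) (V : List ℕ) :
    Adds (m + 1) (fun t (k : Tree → α) => addEdges s V n E L (verts n) t k)
      (edgeExtensions n E) := by
  have h (U : List ℕ) (hU : ∀ u ∈ U, u ∈ verts n) (hd : U.Nodup) : Adds (m + 1)
      (fun t (k : Tree → α) => addEdges s V n E L U t k)
      {G | ∃ u ∈ U, ∃ v ∈ U, u ≠ v ∧ covered u v L = true ∧ covered v u L = true ∧
        ¬ E.Adj u v ∧ G = ⟨n, graph n (.cons u v E)⟩} := by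
    induction U with
    | nil => exact adds_empty.mono fun G ⟨u, hu, _⟩ => by cases hu
    | cons v U ih =>
      rw [List.forall_mem_cons] at hU
      rw [List.nodup_cons] at hd
      refine ((adds_addEdgesAt hE hn hm hconn hn' hU.1 fun u hu =>
        ⟨hU.2 u hu, fun e => hd.1 (e ▸ hu)⟩).comp (ih hU.2 hd.2)).mono ?_
      rintro G ⟨a, ha, b, hb, hab, hc, hc', hadj, rfl⟩
      rw [List.mem_cons] at ha hb
      rcases ha with rfl | ha <;> rcases hb with rfl | hb
      · exact absurd rfl hab
      · exact .inl ⟨b, hb, hc', fun h => hadj h.symm, by rw [graph_cons_comm]⟩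
      · exact .inl ⟨a, ha, hc, hadj, rfl⟩
      · exact .inr ⟨a, ha, b, hb, hab, hc, hc', hadj, rfl⟩
  refine (h (verts n) (fun _ => id) (nodup_verts n)).mono ?_
  rintro G ⟨u, v, huv, hadj, hleaf, rfl⟩
  refine ⟨_, pos_mem_verts u, _, pos_mem_verts v, fun e => huv (Fin.ext (pos_injective e)),
    covered_of_forall_not_leaf hL hE huv hadj hleaf,
    covered_of_forall_not_leaf hL hE huv.symm (fun h => hadj h.symm) ?_, hadj, rfl⟩
  rwa [graph_cons_comm]

omit hL in
theorem adds_extend (hE : E.WF n) (hn : n ≤ m + 1) (hm : E.length = m)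
    (hconn : (graph n E).Connected) (hs : s < 2 ^ 80) (hn' : n + 1 ≤ 11) :
    Adds (m + 1) (fun t (k : Tree → α) => extend s n E t k)
      (pendantExtensions n E ∪ edgeExtensions n E) := by
  intro t k ht
  obtain ⟨L, hL, e⟩ := exists_leaves_eq (step E (ones s n)) (fun L =>
    addPendants s (pos n) (pos n :: verts n) (n + 1) E L (verts n) t
      fun t => addEdges s (verts n) n E L (verts n) t k) (verts n) []
  have hL' (w : ℕ) : w ∈ L ↔ ∃ v : Fin n, w = pos v ∧ ∃! y, (graph n E).Adj v y := by
    rw [hL]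
    simp only [List.not_mem_nil, false_or, mem_verts]
    have h₁ (v : Fin n) : dig (step E (ones s n)) (pos v) = 2 ↔ ∃! y, (graph n E).Adj v y := by
      rw [((packs_ones hs n).step hE fun _ => by norm_num).dig fun v => ?_, refine_one_eq_two]
      exact (refine_le (by simp; omega) (fun _ => le_rfl) v).trans_lt (by norm_num)
    constructor
    · rintro ⟨⟨v, rfl⟩, h⟩
      exact ⟨v, rfl, (h₁ v).1 h⟩
    · rintro ⟨v, rfl, h⟩
      exact ⟨⟨v, rfl⟩, (h₁ v).2 h⟩
  have h := (adds_addPendants (α := α) (s := s) hL' hE hn hm hconn hn' (pos n :: verts n)).comp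
    (adds_addEdges (α := α) (s := s) hL' hE hn hm hconn hn' (verts n))
  obtain ⟨t', e', h'⟩ := h t k ht
  refine ⟨t', ?_, h'⟩
  simp only [extend, range_eq, force_eq]
  exact e.trans e'

end Extensions

section Levels

variable {α : Type} {m : ℕ}

theorem adds_next {s : Tree} (hs : s.Sound m) (hm : m + 2 ≤ 11) :
    Adds (m + 1) (fun t (k : Tree → α) => next s t k)
      {G | ∃ x ∈ s.toList, G ∈ pendantExtensions x.n x.E ∪ edgeExtensions x.n x.E} := by
  induction s with
  | leaf => exact adds_empty.mono fun G ⟨x, hx, _⟩ => by cases hx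
  | node l i n E P c r ihl ihr =>
    obtain ⟨hl, hx, hr⟩ := Tree.sound_node.1 hs
    have hn := hx.n_le
    refine ((ihl hl).comp ((adds_extend hx.wf hn hx.length_eq hx.connected hx.key_lt
      (by omega)).comp (ihr hr))).mono ?_
    rintro G ⟨x, hx, h⟩
    rw [Tree.toList, List.mem_append, List.mem_cons] at hx
    rcases hx with hx | rfl | hx
    exacts [.inl ⟨x, hx, h⟩, .inr (.inl h), .inr (.inr ⟨x, hx, h⟩)]

end Levels

/-! ### Every connected graph is an extension -/

section Completeness

open SimpleGraph

theorem ncard_edgeSet_congr {V W : Type} [Finite V] [Finite W] {G : SimpleGraph V}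
    {H : SimpleGraph W} (φ : G ≃g H) : G.edgeSet.ncard = H.edgeSet.ncard :=
  Nat.card_congr φ.mapEdgeSet

/-- Deleting a vertex. -/
def deleteIso {n : ℕ} (H : SimpleGraph (Fin (n + 1))) (v : Fin (n + 1)) :
    H.comap v.succAbove ≃g H.induce {v}ᶜ where
  toEquiv := finSuccAboveEquiv v
  map_rel_iff' := Iff.rfl

theorem connected_delete_leaf {n : ℕ} {H : SimpleGraph (Fin (n + 1))} (hH : H.Connected)
    {v : Fin (n + 1)} (hv : ∃! w, H.Adj v w) : (H.comap v.succAbove).Connected := by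
  classical
  exact (deleteIso H v).connected_iff.2
    (hH.induce_compl_singleton_of_degree_eq_one (degree_eq_one_iff_existsUnique_adj.2 hv))

theorem ncard_edgeSet_delete_leaf {n : ℕ} {H : SimpleGraph (Fin (n + 1))}
    {v : Fin (n + 1)} (hv : ∃! w, H.Adj v w) :
    (H.comap v.succAbove).edgeSet.ncard = H.edgeSet.ncard - 1 := by
  classical
  have h := card_edgeFinset_deleteIncidenceSet H v
  rw [degree_eq_one_iff_existsUnique_adj.2 hv, ← card_edgeFinset_induce_compl_singleton] at h
  rw [ncard_edgeSet_congr (deleteIso H v), Set.ncard_eq_toFinset_card', Set.ncard_eq_toFinset_card']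
  exact h

theorem existsUnique_adj_iff {V W : Type} {G : SimpleGraph V} {H : SimpleGraph W} (φ : G ≃g H)
    {v : V} : (∃! w, G.Adj v w) ↔ ∃! w, H.Adj (φ v) w :=
  φ.toEquiv.existsUnique_congr fun {_} => φ.map_adj_iff.symm

theorem exists_pendantExtension {n : ℕ} {E : EdgeList} (hE : E.WF n)
    {H : SimpleGraph (Fin (n + 1))} {v : Fin (n + 1)} (hv : ∃! w, H.Adj v w)
    (hmax : ∀ x, (∃! y, H.Adj x y) → refine₄ H (fun _ => 1) x ≤ refine₄ H (fun _ => 1) v)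
    (φ : H.comap v.succAbove ≃g graph n E) :
    ∃ G ∈ pendantExtensions n E, Nonempty (H ≃g G.2) := by
  obtain ⟨w, hw, hw'⟩ := hv
  obtain rfl | ⟨u, rfl⟩ := v.eq_self_or_eq_succAbove w
  · exact (H.irrefl hw).elim
  set G' := graph (n + 1) (.cons (pos (φ u)) (pos n) E) with hG'
  have hadj {a b : Fin (n + 1)} : G'.Adj a b ↔ _ := (wf_pendant hE (φ u)).graph_adj
  have hnot (p : ℕ) : ¬ E.Adj (pos n) p := fun h => pos_self_notMem_verts n (hE.mem_verts h)
  have hne (a : Fin n) : (a : ℕ) ≠ n := a.2.ne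
  let e : Fin (n + 1) ≃ Fin (n + 1) :=
    (finSuccEquiv' v).trans (φ.toEquiv.optionCongr.trans (finSuccEquiv' (Fin.last n)).symm)
  have hev : e v = Fin.last n := by simp [e]
  have hes (a : Fin n) : e (v.succAbove a) = (φ a).castSucc := by
    simp [e]
  have hlast (a : Fin n) : G'.Adj (Fin.last n) (φ a).castSucc ↔ H.Adj v (v.succAbove a) := by
    rw [hadj, EdgeList.Adj]
    simp only [Fin.val_last, Fin.val_castSucc, pos_injective.eq_iff, hnot, hne, (hne _).symm,
      true_and, false_and, false_or, or_false, Fin.val_inj, φ.injective.eq_iff]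
    exact ⟨fun h => h ▸ hw, fun h => Fin.succAbove_right_injective (hw' _ h)⟩
  let ψ : H ≃g G' :=
    { toEquiv := e
      map_rel_iff' := by
        intro a b
        rcases v.eq_self_or_eq_succAbove a with ha | ⟨a, rfl⟩ <;>
          rcases v.eq_self_or_eq_succAbove b with hb | ⟨b, rfl⟩
        · simp [ha, hb]
        · rw [ha, hev, hes, hlast]
        · rw [hb, hev, hes, G'.adj_comm, hlast, H.adj_comm]
        · rw [hes, hes, hadj, EdgeList.Adj]
          simp only [Fin.val_castSucc, pos_injective.eq_iff, hne, and_false, false_and, false_or]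
          rw [← hE.graph_adj, φ.map_adj_iff, comap_adj] }
  refine ⟨_, ⟨φ u, G', rfl, fun x hx => ?_, rfl⟩, ⟨ψ⟩⟩
  have hψ (x) : refine₄ G' (fun _ => 1) (ψ x) = refine₄ H (fun _ => 1) x :=
    (congrFun (refine₄_comp ψ fun _ => 1) x).symm
  obtain ⟨x, rfl⟩ := ψ.surjective x
  rw [← hev]
  exact (hψ x).trans_le ((hmax x ((existsUnique_adj_iff ψ).2 hx)).trans (hψ v).ge)

theorem exists_edgeExtension {n : ℕ} {E : EdgeList} (hE : E.WF n)
    {H : SimpleGraph (Fin n)} {a b : Fin n} (hab : H.Adj a b) (hH : ∀ x, ¬ ∃! y, H.Adj x y)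
    (φ : H.deleteEdges {s(a, b)} ≃g graph n E) :
    ∃ G ∈ edgeExtensions n E, Nonempty (H ≃g G.2) := by
  have hne : φ a ≠ φ b := φ.injective.ne hab.ne
  have hE' : ¬ E.Adj (pos (φ a)) (pos (φ b)) := by
    rw [← hE.graph_adj, φ.map_adj_iff]
    simp
  have hwf : EdgeList.WF n (.cons (pos (φ a)) (pos (φ b)) E) :=
    ⟨pos_mem_verts _, pos_mem_verts _, fun e => hne (Fin.ext (pos_injective e)), hE', hE⟩
  let ψ : H ≃g graph n (.cons (pos (φ a)) (pos (φ b)) E) :=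
    { toEquiv := φ.toEquiv
      map_rel_iff' := by
        intro x y
        change (graph n _).Adj (φ x) (φ y) ↔ _
        rw [hwf.graph_adj, EdgeList.Adj, ← hE.graph_adj, φ.map_adj_iff]
        simp only [pos_injective.eq_iff, Fin.val_inj, φ.injective.eq_iff, deleteEdges_adj,
          Set.mem_singleton_iff, Sym2.eq_iff]
        grind [H.adj_comm] }
  exact ⟨_, ⟨φ a, φ b, hne, hE', fun x hx => hH _ ((existsUnique_adj_iff ψ.symm).1 hx), rfl⟩, ⟨ψ⟩⟩

theorem exists_extension {m N : ℕ} {s : Tree} (hs : s.Sound m)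
    (hrep : ∀ G : Σ n, SimpleGraph (Fin n), G.2.Connected → G.2.edgeSet.ncard = m → s.Rep G)
    {H : SimpleGraph (Fin N)} (hH : H.Connected) (hm : H.edgeSet.ncard = m + 1) :
    ∃ x ∈ s.toList, ∃ G ∈ pendantExtensions x.n x.E ∪ edgeExtensions x.n x.E,
      Nonempty (H ≃g G.2) := by
  classical
  by_cases hleaf : ∃ v, ∃! w, H.Adj v w
  · obtain _ | N := N
    · exact hleaf.choose.elim0
    obtain ⟨v, hv, hmax⟩ := Finset.exists_max_image {v | ∃! w, H.Adj v w}
      (refine₄ H fun _ => 1) (hleaf.imp fun v hv => by simpa using hv)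
    simp only [Finset.mem_filter_univ] at hv hmax
    obtain ⟨x, hx, ⟨φ⟩⟩ := hrep ⟨N, H.comap v.succAbove⟩ (connected_delete_leaf hH hv)
      ((ncard_edgeSet_delete_leaf hv).trans (by rw [hm]; rfl))
    obtain rfl : N = x.n := Fin.equiv_iff_eq.1 ⟨φ.toEquiv⟩
    obtain ⟨G, hG, h⟩ := exists_pendantExtension (hs x hx).wf hv hmax φ
    exact ⟨x, hx, G, .inl hG, h⟩
  · simp only [not_exists] at hleaf
    have hnt : Nontrivial (Fin N) := by
      obtain ⟨e, he⟩ : H.edgeSet.Nonempty := Set.nonempty_of_ncard_ne_zero (by omega)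
      induction e with
      | h a b => exact ⟨a, b, (H.mem_edgeSet.1 he).ne⟩
    have hcyc : ¬ H.IsAcyclic := fun h => by
      obtain ⟨v, hv⟩ := IsTree.exists_vert_degree_one_of_nontrivial ⟨hH, h⟩
      exact hleaf v (degree_eq_one_iff_existsUnique_adj.1 hv)
    rw [isAcyclic_iff_forall_isBridge] at hcyc
    push Not at hcyc
    obtain ⟨e, he, hbr⟩ := hcyc
    induction e with
    | h a b =>
      obtain ⟨x, hx, ⟨φ⟩⟩ := hrep ⟨N, H.deleteEdges {s(a, b)}⟩
        (hH.connected_delete_edge_of_not_isBridge hbr) (by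
          rw [edgeSet_deleteEdges, Set.ncard_sdiff_singleton_of_mem he, hm]
          rfl)
      obtain rfl : N = x.n := Fin.equiv_iff_eq.1 ⟨φ.toEquiv⟩
      obtain ⟨G, hG, h⟩ := exists_edgeExtension (hs x hx).wf he (by simpa using hleaf) φ
      exact ⟨x, hx, G, .inr hG, h⟩

end Completeness

section Levels

theorem exists_level_eq {α : Type} {m : ℕ} (hm : m ≤ 10) (k : Tree → α) :
    ∃ t, level m k = k t ∧ t.Sound m ∧
      ∀ G : Σ n, SimpleGraph (Fin n), G.2.Connected → G.2.edgeSet.ncard = m → t.Rep G := by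
  induction m generalizing k with
  | zero =>
    refine ⟨_, rfl, ?_, ?_⟩
    · rintro x hx
      obtain rfl : x = ⟨0, 1, .nil, 0, 0⟩ := by simpa [Tree.toList] using hx
      exact ⟨trivial, le_rfl, rfl, SimpleGraph.Connected.of_subsingleton, by norm_num,
        fun h => (h rfl).elim, rfl⟩
    · rintro ⟨N, G⟩ hG hcard
      refine ⟨_, List.mem_singleton_self _, ?_⟩
      obtain rfl : G = ⊥ := by
        rwa [Set.ncard_eq_zero, SimpleGraph.edgeSet_eq_empty] at hcard
      obtain ⟨_, _⟩ := SimpleGraph.connected_bot_iff.1 hG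
      obtain rfl : N = 1 := le_antisymm (Fin.subsingleton_iff_le_one.1 ‹_›)
        (Fin.pos_iff_nonempty.2 ‹_›)
      rw [Subsingleton.elim (graph 1 _) ⊥]
      exact ⟨.refl⟩
  | succ m ih =>
    obtain ⟨s, e, hs, hrep⟩ := ih (by omega) fun s => next s Tree.leaf k
    obtain ⟨t, e', ht, -, h⟩ := adds_next hs (by omega) Tree.leaf k fun _ h => nomatch h
    refine ⟨t, e.trans e', ht, fun ⟨N, H⟩ hH hm => ?_⟩
    obtain ⟨x, hx, G, hG, ⟨φ⟩⟩ := exists_extension hs hrep hH hm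
    exact (h G ⟨x, hx, hG⟩).of_iso φ

end Levels

/-! ### Distinctness -/

/-- The invariants by which the entries of a tree are sorted. -/
noncomputable def invariants (i n : ℕ) (E : EdgeList) : ℕ ×ₗ ℕ := toLex (i, inv₂ i n E)

theorem lexle_iff {i n j m : ℕ} {E F : EdgeList} :
    lexle i n E j m F = true ↔ invariants i n E ≤ invariants j m F := by
  simp only [lexle, cond'_iff, Nat.beq_eq, Nat.ble_eq, invariants, Prod.Lex.toLex_le_toLex]
  grind

/-- The list of invariants of the entries of a tree. -/
noncomputable def Tree.invariants (t : Tree) : List (ℕ ×ₗ ℕ) :=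
  t.toList.map fun x => GraphletEnum.invariants x.key x.n x.E

theorem isChain_of_strict {t : Tree} {i n : ℕ} {E : EdgeList} {k : ℕ → ℕ → EdgeList → Bool}
    (h : strict t i n E k = true) (l : List (ℕ ×ₗ ℕ))
    (hk : ∀ i n E, k i n E = true → (invariants i n E :: l).IsChain (· < ·)) :
    (invariants i n E :: (t.invariants ++ l)).IsChain (· < ·) := by
  induction t generalizing i n E k l with
  | leaf => exact hk _ _ _ h
  | node t₁ j m F P c t₂ ih₁ ih₂ =>
    rw [Tree.invariants, Tree.toList, List.map_append, List.map_cons, List.append_assoc,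
      List.cons_append]
    refine ih₁ h _ fun i n E h => ?_
    rw [cond'_iff, lexle_iff, not_le] at h
    have hlt := not_le.1 fun hle => Bool.noConfusion (h.1 hle)
    exact List.isChain_cons_cons.2 ⟨hlt, ih₂ (h.2 hlt) l hk⟩

theorem pairwise_of_strict {t : Tree} {i n : ℕ} {E : EdgeList}
    (h : strict t i n E (fun _ _ _ => true) = true) : t.invariants.Pairwise (· < ·) := by
  have := isChain_of_strict h [] fun _ _ _ _ => List.isChain_singleton _
  rw [List.append_nil] at this
  exact (List.isChain_iff_pairwise.1 this).of_cons

theorem level_ten : level 10 (fun t => cond' (Nat.beq (size t) (nat_lit 2322))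
    (strict t (nat_lit 0) (nat_lit 1) EdgeList.nil fun _ _ _ => true) false) = true := by
  decide +kernel

/-- A list of representatives of the isomorphism classes of connected graphs with `10` edges. -/
theorem exists_complete_list : ∃ l : List Entry, l.length = 2322 ∧ (∀ x ∈ l, x.Sound 10) ∧
    (l.Pairwise fun x y => invariants x.key x.n x.E < invariants y.key y.n y.E) ∧
    ∀ G : Σ n, SimpleGraph (Fin n), G.2.Connected → G.2.edgeSet.ncard = 10 →
      ∃ x ∈ l, Nonempty (G.2 ≃g graph x.n x.E) := by
  obtain ⟨t, e, ht, hrep⟩ := exists_level_eq le_rfl fun t =>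
    cond' (Nat.beq (size t) (nat_lit 2322))
      (strict t (nat_lit 0) (nat_lit 1) EdgeList.nil fun _ _ _ => true) false
  have h := e.symm.trans level_ten
  rw [cond'_iff, Nat.beq_eq, size_eq] at h
  have hsize : t.toList.length = 2322 := by
    by_contra hne
    exact Bool.noConfusion (h.2 hne)
  exact ⟨t.toList, hsize, ht, List.pairwise_map.1 (pairwise_of_strict (h.1 hsize)), hrep⟩

theorem invariants_congr {x y : Entry} (hx : x.Sound 10) (hy : y.Sound 10)
    (φ : graph x.n x.E ≃g graph y.n y.E) :
    invariants x.key x.n x.E = invariants y.key y.n y.E := by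
  rw [invariants, invariants, inv₂_eq hx.wf hx.n_le hx.key_lt, inv₂_eq hy.wf hy.n_le hy.key_lt,
    hx.key_eq (by norm_num), hy.key_eq (by norm_num), graphKey_congr φ, graphInv_congr φ]

/-- The graphlet described by an entry. -/
def Entry.Sound.graphlet {x : Entry} (hx : x.Sound 10) : Graphlet 10 :=
  ⟨⟨x.n, graph x.n x.E⟩, hx.connected, fun v => by
    have hcard := hx.wf.ncard_edgeSet.trans hx.length_eq
    obtain ⟨e, he⟩ : (graph x.n x.E).edgeSet.Nonempty := Set.nonempty_of_ncard_ne_zero (by omega)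
    induction e with
    | h a b =>
      have : Nontrivial (Fin x.n) := ⟨a, b, ((graph x.n x.E).mem_edgeSet.1 he).ne⟩
      exact hx.connected.preconnected.exists_adj_of_nontrivial v,
    hx.wf.ncard_edgeSet.trans hx.length_eq⟩

theorem equivalence_graphletIso (k : ℕ) : Equivalence (@graphletIso k) :=
  ⟨fun _ => ⟨.refl⟩, fun ⟨φ⟩ => ⟨φ.symm⟩, fun ⟨φ⟩ ⟨ψ⟩ => ⟨φ.trans ψ⟩⟩

end GraphletEnum

/-- The number of isomorphism classes of finite connected simple graphs with no
isolated vertices having exactly 10 edges is 2322. -/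
theorem graphlet_count_10 :
    Nat.card (Quot (@graphletIso 10)) = 2322 := by
  obtain ⟨l, hl, hsound, hpair, hrep⟩ := GraphletEnum.exists_complete_list
  let f (i : Fin l.length) : Quot (@graphletIso 10) :=
    Quot.mk _ (hsound _ (l.get_mem i)).graphlet
  have hf : Function.Bijective f := by
    constructor
    · intro i j hij
      obtain ⟨φ⟩ := (GraphletEnum.equivalence_graphletIso 10).quot_mk_eq_iff _ _ |>.1 hij
      have h := GraphletEnum.invariants_congr (hsound _ (l.get_mem i)) (hsound _ (l.get_mem j)) φ
      have hne := List.pairwise_iff_get.1 hpair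
      rcases lt_trichotomy i j with hlt | rfl | hlt
      · exact ((hne _ _ hlt).ne h).elim
      · rfl
      · exact ((hne _ _ hlt).ne h.symm).elim
    · rintro ⟨G, hG, -, hcard⟩
      obtain ⟨x, hx, ⟨φ⟩⟩ := hrep G hG hcard
      obtain ⟨i, rfl⟩ := List.mem_iff_get.1 hx
      exact ⟨i, Quot.sound ⟨φ.symm⟩⟩
  rw [← Nat.card_eq_of_bijective f hf, Nat.card_fin, hl]
end

section
/- Let x_1, ..., x_m be vectors in ℝⁿ with all coordinates nonnegative, and define the histogram intersection kernel κ_HI(x, y) = Σ_{i=1}^n min(x_i, y_i). Then the m×m Gram matrix K with entries K_{jk} = κ_HI(x_j, x_k) is symmetric positive semidefinite; that is, the histogram intersection kernel is a valid kernel function on nonnegative real vectors (such as graphlet-distribution embeddings of graphs). -/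
/-- The kernel `min` is positive semidefinite on nonnegative reals: `min s t` is the length of
the intersection of `(0, s]` and `(0, t]`. -/
theorem Matrix.posSemidef_of_min {ι : Type*} [Finite ι] (a : ι → ℝ) (ha : ∀ j, 0 ≤ a j) :
    (Matrix.of fun j k : ι => min (a j) (a k)).PosSemidef := by
  have h := MeasureTheory.posSemidef_matrix_measure_inter (μ := MeasureTheory.volume)
    (s := fun j => Set.Ioc 0 (a j)) (fun _ => measurableSet_Ioc) fun _ => measure_Ioc_lt_top.ne
  have h_min (j k : ι) :
      MeasureTheory.volume.real (Set.Ioc 0 (a j) ∩ Set.Ioc 0 (a k)) = min (a j) (a k) := by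
    rw [Set.Ioc_inter_Ioc, sup_idem, Real.volume_real_Ioc_of_le (le_inf (ha j) (ha k)), sub_zero]
  simpa only [h_min] using h

/-- The histogram intersection kernel `κ_HI(x, y) = ∑ i, min (x i) (y i)` is a valid
kernel on nonnegative real vectors: for any vectors `x 1, …, x m` in `ℝⁿ` with
nonnegative coordinates, the Gram matrix `K j k = ∑ i, min (x j i) (x k i)` is
symmetric positive semidefinite. -/
theorem histogram_intersection_kernel_posSemidef {n m : ℕ}
    (x : Fin m → Fin n → ℝ) (hx : ∀ j i, 0 ≤ x j i) :
    (Matrix.of fun j k : Fin m => ∑ i, min (x j i) (x k i)).PosSemidef := by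
  have h_sum : (Matrix.of fun j k : Fin m => ∑ i, min (x j i) (x k i)) =
      ∑ i, Matrix.of fun j k : Fin m => min (x j i) (x k i) := by
    ext j k
    simp [Matrix.sum_apply]
  rw [h_sum]
  exact Matrix.posSemidef_sum _ fun i _ =>
    Matrix.posSemidef_of_min (fun j => x j i) fun j => hx j i
end
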